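/- arXiv:math/9610203 — 2 statements merged into one kernel-verified Lean document; each statement's English description precedes it below -/
import Mathlib

section
/- Let n ≥ 2 be an integer, let N = 4n − 3 and p = 1 + N(N − 2) = 16(n − 1)². Then there is a dense open subset U of the space ((ℂ^{n+1})*)^N of N-tuples of linear forms on ℂ^{n+1} (with its natural topology as a finite-dimensional complex vector space) such that for every tuple (H₁, …, H_N) ∈ U the hypersurface {∑_{j=1}^N H_j^p = 0} in ℙ_n(ℂ) is hyperbolic; concretely: for all entire functions f₀, …, f_n : ℂ → ℂ having no common zero and satisfying ∑_{j=1}^N H_j(f₀(z), …, f_n(z))^p = 0 for all z ∈ ℂ, the induced map to ℙ_n(ℂ) is constant, i.e. for all z, w ∈ ℂ the vectors (f₀(z), …, f_n(z)) and (f₀(w), …, f_n(w)) in ℂ^{n+1} are ℂ-linearly dependent. -/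
set_option linter.all false

section
namespace FW

/-- chart vectors -/
def vv {n q : ℕ} (ε : Fin q → Bool) (x y : Fin (n+1) → ℂ) (t : Fin q → ℂ) (k : Fin q) :
    Fin (n+1) → ℂ := if ε k then x + t k • y else t k • x + y

def Bad {n N q : ℕ} (σ : Fin N → Fin q) (α β : Fin (n+1)) (ε : Fin q → Bool) :
    Set (Fin N → ((Fin (n + 1) → ℂ) →L[ℂ] ℂ)) :=
  {H | ∃ P : (Fin (n+1) → ℂ) × (Fin (n+1) → ℂ) × (Fin q → ℂ),
    (P ∈ Metric.closedBall (0 : (Fin (n+1) → ℂ) × (Fin (n+1) → ℂ) × (Fin q → ℂ)) 1) ∧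
    ((P.1 α = 1 ∧ P.1 β = 0 ∧ P.2.1 α = 0 ∧ P.2.1 β = 1) ∧
    ∀ j, H j (vv ε P.1 P.2.1 P.2.2 (σ j)) = 0)}

lemma vv_cont {n q : ℕ} (ε : Fin q → Bool) (k : Fin q) :
    Continuous (fun P : (Fin (n+1) → ℂ) × (Fin (n+1) → ℂ) × (Fin q → ℂ) => vv ε P.1 P.2.1 P.2.2 k) := by
  unfold vv
  split_ifs <;> fun_prop

lemma bad_closed {n N q : ℕ} (σ : Fin N → Fin q) (α β : Fin (n+1)) (ε : Fin q → Bool) :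
    IsClosed (Bad σ α β ε) := by
  set K := Metric.closedBall (0 : (Fin (n+1) → ℂ) × (Fin (n+1) → ℂ) × (Fin q → ℂ)) 1
  haveI : CompactSpace K := isCompact_iff_compactSpace.1 (isCompact_closedBall _ _)
  have hc := isClosedMap_snd_of_compactSpace (X := K)
    (Y := Fin N → ((Fin (n + 1) → ℂ) →L[ℂ] ℂ))
  have : Bad σ α β ε = Set.image Prod.snd {Q : K × (Fin N → ((Fin (n + 1) → ℂ) →L[ℂ] ℂ)) |
      (Q.1.1.1 α = 1 ∧ Q.1.1.1 β = 0 ∧ Q.1.1.2.1 α = 0 ∧ Q.1.1.2.1 β = 1) ∧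
    ∀ j, Q.2 j (vv ε Q.1.1.1 Q.1.1.2.1 Q.1.1.2.2 (σ j)) = 0} := by
    ext H
    constructor
    · rintro ⟨P, hP, h⟩
      exact ⟨(⟨P, hP⟩, H), h, rfl⟩
    · rintro ⟨⟨⟨P, hP⟩, H'⟩, h, rfl⟩
      exact ⟨P, hP, h⟩
  rw [this]
  apply hc
  have hx : Continuous (fun Q : K × (Fin N → ((Fin (n + 1) → ℂ) →L[ℂ] ℂ)) => Q.1.1.1) := by fun_prop
  have hy : Continuous (fun Q : K × (Fin N → ((Fin (n + 1) → ℂ) →L[ℂ] ℂ)) => Q.1.1.2.1) := by fun_prop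
  have hset : {Q : K × (Fin N → ((Fin (n + 1) → ℂ) →L[ℂ] ℂ)) |
      (Q.1.1.1 α = 1 ∧ Q.1.1.1 β = 0 ∧ Q.1.1.2.1 α = 0 ∧ Q.1.1.2.1 β = 1) ∧
    ∀ j, Q.2 j (vv ε Q.1.1.1 Q.1.1.2.1 Q.1.1.2.2 (σ j)) = 0} =
      ({Q : K × (Fin N → ((Fin (n + 1) → ℂ) →L[ℂ] ℂ)) | Q.1.1.1 α = 1} ∩
        ({Q : K × (Fin N → ((Fin (n + 1) → ℂ) →L[ℂ] ℂ)) | Q.1.1.1 β = 0} ∩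
        ({Q : K × (Fin N → ((Fin (n + 1) → ℂ) →L[ℂ] ℂ)) | Q.1.1.2.1 α = 0} ∩
        {Q : K × (Fin N → ((Fin (n + 1) → ℂ) →L[ℂ] ℂ)) | Q.1.1.2.1 β = 1}))) ∩
      ⋂ j, {Q : K × (Fin N → ((Fin (n + 1) → ℂ) →L[ℂ] ℂ)) |
        Q.2 j (vv ε Q.1.1.1 Q.1.1.2.1 Q.1.1.2.2 (σ j)) = 0} := by
    ext Q
    simp only [Set.mem_inter_iff, Set.mem_iInter]
    rfl
  rw [hset]
  refine IsClosed.inter ?_ ?_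
  · refine IsClosed.inter (isClosed_eq (by fun_prop) (by fun_prop)) ?_
    refine IsClosed.inter (isClosed_eq (by fun_prop) (by fun_prop)) ?_
    exact IsClosed.inter (isClosed_eq (by fun_prop) (by fun_prop)) (isClosed_eq (by fun_prop) (by fun_prop))
  · refine isClosed_iInter fun j => isClosed_eq ?_ (by fun_prop)
    refine Continuous.clm_apply (by fun_prop) ?_
    exact (vv_cont ε (σ j)).comp (continuous_subtype_val.comp continuous_fst)

/-- extend by pivots -/
noncomputable def ext2 {n : ℕ} (α β : Fin (n+1)) (c d : ℂ) (x : {γ : Fin (n+1) // γ ≠ α ∧ γ ≠ β} → ℂ) :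
    Fin (n+1) → ℂ := fun γ => if h : γ ≠ α ∧ γ ≠ β then x ⟨γ, h⟩ else if γ = α then c else d

abbrev Par (n N q : ℕ) (α β : Fin (n+1)) : Type :=
  ({γ : Fin (n+1) // γ ≠ α ∧ γ ≠ β} → ℂ) × ({γ : Fin (n+1) // γ ≠ α ∧ γ ≠ β} → ℂ) ×
    (Fin q → ℂ) × (Fin N → Fin n → ℂ)

noncomputable def piv {n q : ℕ} (α β : Fin (n+1)) (ε : Fin q → Bool) (k : Fin q) : Fin (n+1) :=
  if ε k then α else β

noncomputable def coords {n N q : ℕ} (σ : Fin N → Fin q) (α β : Fin (n+1)) (ε : Fin q → Bool)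
    (Q : Par n N q α β) (j : Fin N) : Fin (n+1) → ℂ :=
  Fin.insertNth (piv α β ε (σ j))
    (- ∑ i : Fin n, vv ε (ext2 α β 1 0 Q.1) (ext2 α β 0 1 Q.2.1) Q.2.2.1 (σ j)
      ((piv α β ε (σ j)).succAbove i) * Q.2.2.2 j i) (Q.2.2.2 j)

noncomputable def toCLM {n N : ℕ} :
    (Fin N → Fin (n+1) → ℂ) →ₗ[ℝ] (Fin N → ((Fin (n + 1) → ℂ) →L[ℂ] ℂ)) where
  toFun c j := ∑ i, c j i • ContinuousLinearMap.proj (R := ℂ) (φ := fun _ : Fin (n+1) => ℂ) i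
  map_add' c d := by ext j; simp [add_mul, Finset.sum_add_distrib]
  map_smul' r c := by
    ext j; simp [Finset.mul_sum, mul_assoc]

lemma bad_sub {n N q : ℕ} (σ : Fin N → Fin q) (α β : Fin (n+1)) (ε : Fin q → Bool) (hab : α ≠ β) :
    Bad σ α β ε ⊆ Set.range (fun Q : Par n N q α β => toCLM (coords σ α β ε Q)) := by
  rintro H ⟨⟨x, y, t⟩, -, ⟨h1, h2, h3, h4⟩, hH⟩
  simp only at h1 h2 h3 h4 hH
  refine ⟨⟨fun γ => x γ, fun γ => y γ, t, fun j i => H j (Pi.single ((piv α β ε (σ j)).succAbove i) 1)⟩, ?_⟩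
  have hx : ext2 α β 1 0 (fun γ => x γ) = x := by
    ext γ; unfold ext2
    split_ifs with h h' <;> simp_all
  have hy : ext2 α β 0 1 (fun γ => y γ) = y := by
    ext γ; unfold ext2
    split_ifs with h h' <;> simp_all
  funext j
  have key : ∀ v, H j v = ∑ i, v i * H j (Pi.single i 1) := by
    intro v
    conv_lhs => rw [pi_eq_sum_univ' v]
    rw [map_sum]
    simp
  have hv : vv ε x y t (σ j) (piv α β ε (σ j)) = 1 := by
    unfold vv piv; split_ifs <;> simp [*]
  have h0 := hH j
  rw [key, Fin.sum_univ_succAbove _ (piv α β ε (σ j)), hv] at h0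
  ext v
  rw [key]
  have htc : ∀ c : Fin N → Fin (n+1) → ℂ, (toCLM c) j v = ∑ i, c j i * v i := by
    intro c; simp [toCLM]
  rw [htc]
  simp only [coords, hx, hy]
  rw [Fin.sum_univ_succAbove _ (piv α β ε (σ j)), Fin.sum_univ_succAbove _ (piv α β ε (σ j))]
  simp only [Fin.insertNth_apply_same, Fin.insertNth_apply_succAbove]
  have : H j (Pi.single (piv α β ε (σ j)) 1) = - ∑ i : Fin n, vv ε x y t (σ j)
      ((piv α β ε (σ j)).succAbove i) * H j (Pi.single ((piv α β ε (σ j)).succAbove i) 1) := by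
    linear_combination h0
  rw [this]
  congr 1
  · ring
  · exact Finset.sum_congr rfl fun i _ => mul_comm _ _

lemma coords_contDiff {n N q : ℕ} (σ : Fin N → Fin q) (α β : Fin (n+1)) (ε : Fin q → Bool) :
    ContDiff ℝ 1 (coords σ α β ε : Par n N q α β → _) := by
  rw [contDiff_pi]; intro j
  rw [contDiff_pi]; intro i
  have he : ∀ c d γ, ContDiff ℝ 1 (fun x : {γ : Fin (n+1) // γ ≠ α ∧ γ ≠ β} → ℂ => ext2 α β c d x γ) := by
    intro c d γ
    unfold ext2
    split_ifs <;> fun_prop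
  unfold coords
  refine Fin.succAboveCases (piv α β ε (σ j)) ?_ ?_ i
  · simp only [Fin.insertNth_apply_same]
    refine ContDiff.neg (ContDiff.sum fun i _ => ContDiff.mul ?_ (by fun_prop))
    have h1 : ∀ c d γ, ContDiff ℝ 1 (fun Q : Par n N q α β => ext2 α β c d Q.1 γ) := fun c d γ =>
      (he c d γ).comp contDiff_fst
    have h2 : ∀ c d γ, ContDiff ℝ 1 (fun Q : Par n N q α β => ext2 α β c d Q.2.1 γ) := fun c d γ =>
      (he c d γ).comp (contDiff_fst.comp contDiff_snd)
    unfold vv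
    split_ifs
    · simp only [Pi.add_apply, Pi.smul_apply, smul_eq_mul]
      exact (h1 _ _ _).add (ContDiff.mul (by fun_prop) (h2 _ _ _))
    · simp only [Pi.add_apply, Pi.smul_apply, smul_eq_mul]
      exact (ContDiff.mul (by fun_prop) (h1 _ _ _)).add (h2 _ _ _)
  · intro i
    simp only [Fin.insertNth_apply_succAbove]
    fun_prop

lemma dim_par {n N q : ℕ} (α β : Fin (n+1)) (hab : α ≠ β) :
    Module.finrank ℝ (Par n N q α β) = 2 * ((n - 1) + (n - 1) + q + N * n) := by
  have hc : Fintype.card {γ : Fin (n+1) // γ ≠ α ∧ γ ≠ β} = n - 1 := by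
    rw [Fintype.card_subtype]
    have : (Finset.univ.filter fun γ : Fin (n+1) => γ ≠ α ∧ γ ≠ β) = (Finset.univ.erase α).erase β := by
      ext; simp; tauto
    rw [this, Finset.card_erase_of_mem (by simp [hab.symm]), Finset.card_erase_of_mem (by simp)]
    simp
  have hf : ∀ (ι : Type) [Fintype ι], Module.finrank ℝ (ι → ℂ) = Fintype.card ι * 2 := by
    intro ι _
    simp [Module.finrank_pi_fintype]
  have h3 : Module.finrank ℝ (Fin N → Fin n → ℂ) = N * (n * 2) := by
    rw [Module.finrank_pi_fintype]; simp [hf]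
  rw [Module.finrank_prod, Module.finrank_prod, Module.finrank_prod, hf, hf, h3, hc]
  simp
  ring

lemma dim_F {n N : ℕ} : Module.finrank ℝ (Fin N → ((Fin (n + 1) → ℂ) →L[ℂ] ℂ)) = 2 * (N * (n+1)) := by
  have hT := Module.finrank_mul_finrank ℝ ℂ (Fin N → ((Fin (n + 1) → ℂ) →L[ℂ] ℂ))
  rw [← hT, Complex.finrank_real_complex]
  congr 1
  rw [Module.finrank_pi_fintype]
  have : Module.finrank ℂ ((Fin (n + 1) → ℂ) →L[ℂ] ℂ) = n + 1 := by
    rw [← (LinearMap.toContinuousLinearMap (𝕜 := ℂ) (E := Fin (n+1) → ℂ) (F' := ℂ)).finrank_eq]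
    rw [Module.finrank_linearMap]; simp
  simp [this]

theorem bad_dense {n N q : ℕ} (h : (n - 1) + (n - 1) + q < N) (hn : 2 ≤ n) :
    Dense (⋃ s : {s : (Fin N → Fin q) × Fin (n+1) × Fin (n+1) × (Fin q → Bool) // s.2.1 ≠ s.2.2.1},
      Bad s.1.1 s.1.2.1 s.1.2.2.1 s.1.2.2.2)ᶜ := by
  apply dense_compl_of_dimH_lt_finrank
  rw [dimH_iUnion]
  refine lt_of_le_of_lt (iSup_le (a := ((2 * ((n - 1) + (n - 1) + q + N * n) : ℕ) : ENNReal)) ?_) ?_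
  · rintro ⟨⟨σ, α, β, ε⟩, hab⟩
    refine (dimH_mono (bad_sub σ α β ε hab)).trans ?_
    rw [← dim_par α β hab]
    apply ContDiff.dimH_range_le
    exact (LinearMap.toContinuousLinearMap toCLM).contDiff.comp (coords_contDiff σ α β ε)
  · rw [dim_F]
    norm_cast
    nlinarith

theorem generic_forms {n N q : ℕ} (h : (n - 1) + (n - 1) + q < N) (hn : 2 ≤ n) :
    ∃ U : Set (Fin N → ((Fin (n + 1) → ℂ) →L[ℂ] ℂ)), IsOpen U ∧ Dense U ∧
      ∀ H ∈ U, ∀ (σ : Fin N → Fin q) (x y : Fin (n+1) → ℂ), LinearIndependent ℂ ![x, y] →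
      ∀ a b : Fin q → ℂ, (∀ k, a k ≠ 0 ∨ b k ≠ 0) →
      ∃ j, H j (a (σ j) • x + b (σ j) • y) ≠ 0 := by
  refine ⟨_, ?_, bad_dense h hn, ?_⟩
  · rw [isOpen_compl_iff]
    exact isClosed_iUnion_of_finite fun s => bad_closed _ _ _ _
  intro H hH σ x y hxy a b hab
  by_contra! hcon
  apply hH
  -- choose the maximal minor
  obtain ⟨⟨α, β⟩, -, hmax⟩ := Finset.exists_max_image (Finset.univ : Finset (Fin (n+1) × Fin (n+1)))
    (fun s => ‖x s.1 * y s.2 - x s.2 * y s.1‖) ⟨(0, 0), by simp⟩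
  simp only [Finset.mem_univ, forall_const, Prod.forall] at hmax
  set D := x α * y β - x β * y α with hD
  have hD0 : D ≠ 0 := by
    intro h0
    rw [h0] at hmax
    have hz : ∀ i j, x i * y j - x j * y i = 0 := fun i j => by
      have := hmax i j; simpa using this
    rw [LinearIndependent.pair_iff] at hxy
    by_cases hx : ∃ i, x i ≠ 0
    · obtain ⟨i, hi⟩ := hx
      have := (hxy (y i) (- x i) (by ext j; simp; linear_combination -(hz i j))).2
      exact hi (by simpa using this)
    · push Not at hx
      have := (hxy 1 0 (by ext j; simp [hx])).1
      simp at this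
  have hne : α ≠ β := by
    rintro rfl; apply hD0; rw [hD]; ring
  -- normalised basis
  set x' : Fin (n+1) → ℂ := fun γ => (x γ * y β - x β * y γ) / D with hx'
  set y' : Fin (n+1) → ℂ := fun γ => (x α * y γ - x γ * y α) / D with hy'
  have ex : x = x α • x' + x β • y' := by
    ext γ; simp [hx', hy']; field_simp; rw [hD]; ring
  have ey : y = y α • x' + y β • y' := by
    ext γ; simp [hx', hy']; field_simp; rw [hD]; ring
  set a' : Fin q → ℂ := fun k => a k * x α + b k * y α with ha'
  set b' : Fin q → ℂ := fun k => a k * x β + b k * y β with hb'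
  have hcomb : ∀ k, a k • x + b k • y = a' k • x' + b' k • y' := by
    intro k
    conv_lhs => rw [ex, ey]
    simp only [ha', hb']
    module
  have hab' : ∀ k, a' k ≠ 0 ∨ b' k ≠ 0 := by
    intro k
    by_contra! hh
    obtain ⟨h1, h2⟩ := hh
    have e1 : a k * D = 0 := by rw [hD]; simp only [ha', hb'] at h1 h2; linear_combination y β * h1 - y α * h2
    have e2 : b k * D = 0 := by rw [hD]; simp only [ha', hb'] at h1 h2; linear_combination x α * h2 - x β * h1
    rcases hab k with h | h
    · exact h ((mul_eq_zero.1 e1).resolve_right hD0)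
    · exact h ((mul_eq_zero.1 e2).resolve_right hD0)
  classical
  set ε : Fin q → Bool := fun k => decide (‖b' k‖ ≤ ‖a' k‖) with hε
  set t : Fin q → ℂ := fun k => if ‖b' k‖ ≤ ‖a' k‖ then b' k / a' k else a' k / b' k with ht
  rw [Set.mem_iUnion]
  refine ⟨⟨⟨σ, α, β, ε⟩, hne⟩, ⟨x', y', t⟩, ?_, ⟨?_, ?_, ?_, ?_⟩, ?_⟩
  · rw [mem_closedBall_zero_iff, Prod.norm_def, Prod.norm_def]
    refine max_le ?_ (max_le ?_ ?_)
    · rw [pi_norm_le_iff_of_nonneg zero_le_one]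
      intro γ
      simp only [hx', norm_div]
      exact div_le_one_of_le₀ (hmax γ β) (norm_nonneg _)
    · rw [pi_norm_le_iff_of_nonneg zero_le_one]
      intro γ
      simp only [hy', norm_div]
      exact div_le_one_of_le₀ (hmax α γ) (norm_nonneg _)
    · rw [pi_norm_le_iff_of_nonneg zero_le_one]
      intro k
      simp only [ht]
      split_ifs with hk
      · rw [norm_div]; exact div_le_one_of_le₀ hk (norm_nonneg _)
      · rw [norm_div]; exact div_le_one_of_le₀ (not_le.1 hk).le (norm_nonneg _)
  · simp [hx', ← hD, hD0]
  · simp [hx', mul_comm]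
  · simp [hy', mul_comm]
  · simp [hy', ← hD, hD0]
  · intro j
    have hj := hcon j
    rw [hcomb] at hj
    have hk := hab' (σ j)
    simp only [vv, hε, ht]
    by_cases hle : ‖b' (σ j)‖ ≤ ‖a' (σ j)‖
    · have ha0 : a' (σ j) ≠ 0 := by
        rcases hk with h | h
        · exact h
        · intro h0; rw [h0] at hle; simp at hle; exact h hle
      have : x' + (b' (σ j) / a' (σ j)) • y' = (a' (σ j))⁻¹ • (a' (σ j) • x' + b' (σ j) • y') := by
        rw [smul_add, smul_smul, smul_smul, inv_mul_cancel₀ ha0, one_smul, div_eq_inv_mul]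
      simp only [hle, decide_true, if_true]
      rw [this, map_smul, hj, smul_zero]
    · have hb0 : b' (σ j) ≠ 0 := by
        intro h0; apply hle; rw [h0]; simp
      have : (a' (σ j) / b' (σ j)) • x' + y' = (b' (σ j))⁻¹ • (a' (σ j) • x' + b' (σ j) • y') := by
        rw [smul_add, smul_smul, smul_smul, inv_mul_cancel₀ hb0, one_smul, div_eq_inv_mul]
      simp only [hle, decide_false, if_false]
      simp only [Bool.false_eq_true, if_false]
      rw [this, map_smul, hj, smul_zero]

end FW
end

section
open Real Metric Set Filter Topology
namespace FW

lemma poisson_diff {u : ℂ → ℝ} {R s : ℝ} (hs : 0 < s)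
    (hu : InnerProductSpace.HarmonicOnNhd u (closedBall 0 R)) {z w : ℂ}
    (hz : ‖z‖ ≤ R - s) (hw : ‖w‖ ≤ R - s) :
    |u w - u z| ≤ 2 * R / s ^ 2 * ‖w - z‖ * circleAverage (fun x => |u x|) 0 R := by
  have hR : 0 < R := by linarith [norm_nonneg z]
  have hzb : z ∈ ball (0:ℂ) R := by simp; linarith
  have hwb : w ∈ ball (0:ℂ) R := by simp; linarith
  have huc : ContinuousOn u (sphere 0 |R|) := by
    intro x hx
    have : x ∈ closedBall (0:ℂ) R := by
      rw [abs_of_pos hR] at hx; exact sphere_subset_closedBall hx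
    exact ((hu x this).1.continuousAt).continuousWithinAt
  have hci : ∀ v ∈ ball (0:ℂ) R, CircleIntegrable ((Complex.re ∘ herglotzRieszKernel 0 v) • u) 0 R := by
    intro v hv
    apply ContinuousOn.circleIntegrable'
    apply ContinuousOn.smul _ huc
    exact Complex.continuous_re.comp_continuousOn (continuousOn_herglotzRieszKernel_sphere hv)
  have h1 := hu.circleAverage_re_herglotzRieszKernel_smul hzb
  have h2 := hu.circleAverage_re_herglotzRieszKernel_smul hwb
  rw [← h1, ← h2, ← circleAverage_sub (hci w hwb) (hci z hzb)]
  refine (abs_circleAverage_le_circleAverage_abs).trans ?_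
  have h3 : circleAverage (fun x => (2 * R / s ^ 2 * ‖w - z‖) • |u x|) 0 R =
      2 * R / s ^ 2 * ‖w - z‖ * circleAverage (fun x => |u x|) 0 R := by
    rw [circleAverage_fun_smul, smul_eq_mul]
  rw [← h3]
  apply circleAverage_mono
  · exact ((hci w hwb).sub (hci z hzb)).abs
  · apply ContinuousOn.circleIntegrable'
    exact ContinuousOn.mul continuousOn_const huc.abs
  · intro x hx
    rw [abs_of_pos hR] at hx
    have hxn : ‖x‖ = R := by simpa using hx
    have hxz : s ≤ ‖x - z‖ := by
      have := norm_sub_norm_le x z; linarith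
    have hxw : s ≤ ‖x - w‖ := by
      have := norm_sub_norm_le x w; linarith
    have hz0 : x - z ≠ 0 := by intro h; rw [h, norm_zero] at hxz; linarith
    have hw0 : x - w ≠ 0 := by intro h; rw [h, norm_zero] at hxw; linarith
    have key : herglotzRieszKernel 0 w x - herglotzRieszKernel 0 z x =
        2 * x * (w - z) / ((x - w) * (x - z)) := by
      rw [herglotzRieszKernel_def, herglotzRieszKernel_def]
      simp only [sub_zero]
      field_simp
      ring
    simp only [Pi.abs_apply, Pi.sub_apply, smul_eq_mul, Pi.mul_apply, Function.comp]
    rw [← sub_mul, abs_mul, ← Complex.sub_re, key]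
    apply mul_le_mul_of_nonneg_right _ (abs_nonneg _)
    refine (Complex.abs_re_le_norm _).trans ?_
    rw [norm_div, norm_mul, norm_mul, norm_mul, hxn, Complex.norm_ofNat, div_mul_eq_mul_div]
    apply div_le_div_of_nonneg_left (by positivity) (by positivity)
    nlinarith

lemma log_diff {z w a : ℂ} (hza : z ≠ a) (h : ‖w - z‖ / ‖z - a‖ ≤ 1 / 2) :
    w ≠ a ∧ |log ‖w - a‖ - log ‖z - a‖| ≤ 2 * (‖w - z‖ / ‖z - a‖) := by
  have hpos : 0 < ‖z - a‖ := norm_pos_iff.2 (sub_ne_zero.2 hza)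
  set t := ‖w - z‖ / ‖z - a‖ with ht
  have ht0 : 0 ≤ t := by positivity
  have hwz : ‖w - z‖ = t * ‖z - a‖ := by rw [ht]; field_simp
  have e : w - a = (w - z) + (z - a) := by ring
  have u1 : ‖w - a‖ ≤ (1 + t) * ‖z - a‖ := by
    rw [e]; refine (norm_add_le _ _).trans ?_; linarith
  have u2 : (1 - t) * ‖z - a‖ ≤ ‖w - a‖ := by
    have := norm_sub_norm_le (z - a) (z - w)
    have h3 : z - a - (z - w) = w - a := by ring
    rw [h3, norm_sub_rev z w] at this; linarith
  have hwpos : 0 < ‖w - a‖ := lt_of_lt_of_le (mul_pos (by linarith) hpos) u2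
  refine ⟨fun h => by simp [h] at hwpos, ?_⟩
  rw [← Real.log_div hwpos.ne' hpos.ne']
  have v1 : ‖w - a‖ / ‖z - a‖ ≤ 1 + t := by rw [div_le_iff₀ hpos]; exact u1
  have v2 : 1 - t ≤ ‖w - a‖ / ‖z - a‖ := by rw [le_div_iff₀ hpos]; exact u2
  have hp : 0 < ‖w - a‖ / ‖z - a‖ := by positivity
  rw [abs_le]
  constructor
  · have := Real.one_sub_inv_le_log_of_pos hp
    have : (‖w - a‖ / ‖z - a‖)⁻¹ ≤ (1 - t)⁻¹ := inv_anti₀ (by linarith) v2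
    have : (1 - t)⁻¹ ≤ 1 + 2 * t := by
      rw [inv_le_iff_one_le_mul₀ (by linarith)]
      nlinarith
    linarith
  · have := Real.log_le_sub_one_of_pos hp
    linarith

lemma growth {A : Finset ℂ} {e : ℂ → ℤ} {F : ℂ → ℂ} {R s K : ℝ} (hs : 0 < s)
    (he : ∀ a ∈ A, e a ≠ 0)
    (hF : AnalyticOnNhd ℂ F (closedBall 0 R)) (hF0 : ∀ x ∈ closedBall (0:ℂ) R, F x ≠ 0)
    (hK1 : 2 * R / s ^ 2 * circleAverage (fun x => |log ‖F x‖|) 0 R ≤ K) (hK2 : 1 / s ≤ K)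
    {z : ℂ} (hz : ‖z‖ ≤ R - 2 * s) (hzA : ∀ a ∈ A, z ≠ a) (l : ℕ) :
    ‖iteratedDeriv l (fun x => (∏ a ∈ A, (x - a) ^ (e a)) * F x) z‖ ≤
      l.factorial * (exp 2 * ‖(∏ a ∈ A, (z - a) ^ (e a)) * F z‖) *
        (2 * ((∑ a ∈ A, |(e a : ℝ)| / ‖z - a‖) + K)) ^ l := by
  have hK : 0 < K := lt_of_lt_of_le (by positivity) hK2
  set S := ∑ a ∈ A, |(e a : ℝ)| / ‖z - a‖ with hS
  have hS0 : 0 ≤ S := by positivity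
  set ε : ℝ := 1 / (2 * (S + K)) with hε
  have hε0 : 0 < ε := by positivity
  have hεs : ε ≤ s := by
    rw [hε, div_le_iff₀ (by positivity)]
    rw [div_le_iff₀ hs] at hK2
    nlinarith
  have hSε : S * ε ≤ 1 / 2 := by
    rw [hε, mul_one_div, div_le_iff₀ (by positivity)]; linarith
  have hKε : K * ε ≤ 1 := by
    rw [hε, mul_one_div, div_le_iff₀ (by positivity)]; linarith
  have hta : ∀ w, ‖w - z‖ ≤ ε → ∀ a ∈ A, ‖w - z‖ / ‖z - a‖ ≤ 1 / 2 := by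
    intro w hw a ha
    have hpos : 0 < ‖z - a‖ := norm_pos_iff.2 (sub_ne_zero.2 (hzA a ha))
    have h1 : |(e a : ℝ)| / ‖z - a‖ ≤ S :=
      Finset.single_le_sum (f := fun a => |(e a : ℝ)| / ‖z - a‖) (fun i _ => by positivity) ha
    have h2 : (1 : ℝ) ≤ |(e a : ℝ)| := by
      exact_mod_cast Int.one_le_abs (he a ha)
    have h3 : 1 / ‖z - a‖ ≤ S := le_trans (by gcongr) h1
    calc ‖w - z‖ / ‖z - a‖ ≤ ε / ‖z - a‖ := by gcongr
      _ = (1 / ‖z - a‖) * ε := by ring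
      _ ≤ S * ε := by gcongr
      _ ≤ _ := hSε
  have hwR : ∀ w, ‖w - z‖ ≤ ε → ‖w‖ ≤ R - s := by
    intro w hw
    have : w = (w - z) + z := by ring
    rw [this]; refine (norm_add_le _ _).trans ?_; linarith
  have hlogψ : ∀ w, ‖w‖ ≤ R - s → (∀ a ∈ A, w ≠ a) →
      log ‖(∏ a ∈ A, (w - a) ^ (e a)) * F w‖ = ∑ a ∈ A, (e a : ℝ) * log ‖w - a‖ + log ‖F w‖ := by
    intro w hw hwA
    have hFw : F w ≠ 0 := hF0 w (by simp; linarith)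
    rw [norm_mul, Real.log_mul _ (norm_ne_zero_iff.2 hFw), norm_prod, Real.log_prod]
    · congr 1
      apply Finset.sum_congr rfl
      intro a ha
      rw [norm_zpow, Real.log_zpow]
    · intro a ha
      exact norm_ne_zero_iff.2 (zpow_ne_zero _ (sub_ne_zero.2 (hwA a ha)))
    · rw [norm_ne_zero_iff, Finset.prod_ne_zero_iff]
      intro a ha
      exact (zpow_ne_zero _ (sub_ne_zero.2 (hwA a ha)))
  have hne : ∀ w, ‖w‖ ≤ R - s → (∀ a ∈ A, w ≠ a) → (∏ a ∈ A, (w - a) ^ (e a)) * F w ≠ 0 := by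
    intro w hw hwA
    refine mul_ne_zero ?_ (hF0 w (by simp; linarith))
    rw [Finset.prod_ne_zero_iff]
    intro a ha
    exact (zpow_ne_zero _ (sub_ne_zero.2 (hwA a ha)))
  have hharm : InnerProductSpace.HarmonicOnNhd (fun x => log ‖F x‖) (closedBall 0 R) :=
    fun x hx => (hF x hx).harmonicAt_log_norm (hF0 x hx)
  have hbound : ∀ w, ‖w - z‖ ≤ ε → (∀ a ∈ A, w ≠ a) ∧
      ‖(∏ a ∈ A, (w - a) ^ (e a)) * F w‖ ≤ exp 2 * ‖(∏ a ∈ A, (z - a) ^ (e a)) * F z‖ := by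
    intro w hw
    have hwA : ∀ a ∈ A, w ≠ a := fun a ha => (log_diff (hzA a ha) (hta w hw a ha)).1
    refine ⟨hwA, ?_⟩
    have hw0 := norm_pos_iff.2 (hne w (hwR w hw) hwA)
    have hz0 := norm_pos_iff.2 (hne z (by linarith) hzA)
    rw [← Real.log_le_log_iff hw0 (by positivity), Real.log_mul (by positivity) hz0.ne', Real.log_exp,
      hlogψ w (hwR w hw) hwA, hlogψ z (by linarith) hzA]
    have h1 : ∑ a ∈ A, (e a : ℝ) * log ‖w - a‖ - ∑ a ∈ A, (e a : ℝ) * log ‖z - a‖ ≤ 1 := by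
      rw [← Finset.sum_sub_distrib]
      calc _ ≤ ∑ a ∈ A, (|(e a : ℝ)| / ‖z - a‖) * (2 * ε) := by
            apply Finset.sum_le_sum
            intro a ha
            rw [← mul_sub]
            refine (le_abs_self _).trans ?_
            rw [abs_mul, div_mul_eq_mul_div, mul_div_assoc]
            apply mul_le_mul_of_nonneg_left _ (abs_nonneg _)
            refine (log_diff (hzA a ha) (hta w hw a ha)).2.trans ?_
            rw [mul_div_assoc]
            gcongr
        _ = S * ε * 2 := by rw [← Finset.sum_mul]; ring
        _ ≤ 1 := by linarith
    have h2 : log ‖F w‖ - log ‖F z‖ ≤ 1 := by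
      have := poisson_diff hs hharm (z := z) (w := w) (by linarith) (hwR w hw)
      have h0 : 0 ≤ circleAverage (fun x => |log ‖F x‖|) 0 R :=
        circleAverage_nonneg_of_nonneg fun x _ => abs_nonneg _
      have hR : 0 ≤ R := by linarith [norm_nonneg z]
      calc _ ≤ _ := le_abs_self _
        _ ≤ _ := this
        _ = (2 * R / s ^ 2 * circleAverage (fun x => |log ‖F x‖|) 0 R) * ‖w - z‖ := by ring
        _ ≤ K * ε := by gcongr
        _ ≤ 1 := hKε
    linarith
  have hd : DiffContOnCl ℂ (fun x => (∏ a ∈ A, (x - a) ^ (e a)) * F x) (ball z ε) := by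
    apply DifferentiableOn.diffContOnCl
    rw [closure_ball _ hε0.ne']
    intro w hw
    have hw' : ‖w - z‖ ≤ ε := by simpa [dist_eq_norm] using hw
    apply DifferentiableAt.differentiableWithinAt
    apply DifferentiableAt.mul
    · apply DifferentiableAt.fun_finsetProd
      intro a ha
      apply DifferentiableAt.zpow (by fun_prop)
      left
      exact sub_ne_zero.2 ((hbound w hw').1 a ha)
    · have := hwR w hw'
      exact (hF w (by simp; linarith)).differentiableAt
  have := Complex.norm_iteratedDeriv_le_of_forall_mem_sphere_norm_le l hε0 hd
    (C := exp 2 * ‖(∏ a ∈ A, (z - a) ^ (e a)) * F z‖)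
    (fun w hw => (hbound w (by simpa [dist_eq_norm] using hw.le)).2)
  refine this.trans (le_of_eq ?_)
  rw [hε, one_div, inv_pow, div_inv_eq_mul]

end FW
end

section
open Real Metric Set Filter Topology MeasureTheory
namespace FW

noncomputable def sq (t : ℝ) : ℝ := |sin t| ^ (-(1/2) : ℝ)

lemma sq_meas : Measurable sq := by
  unfold sq
  exact (Real.measurable_sin.norm.pow_const _)

lemma sq_int0 : IntervalIntegrable sq volume 0 (π / 2) := by
  have h : IntervalIntegrable (fun x : ℝ => (2 / π) ^ (-(1/2) : ℝ) * x ^ (-(1/2) : ℝ)) volume 0 (π/2) :=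
    (intervalIntegral.intervalIntegrable_rpow' (by norm_num)).const_mul _
  refine h.mono_fun' sq_meas.aestronglyMeasurable ?_
  rw [uIoc_of_le (by positivity)]
  filter_upwards [ae_restrict_mem measurableSet_Ioc] with t ht
  have h1 : 2 / π * t ≤ sin t := Real.mul_le_sin ht.1.le ht.2
  have h2 : 0 < 2 / π * t := by have := ht.1; positivity
  unfold sq
  rw [Real.norm_of_nonneg (by positivity), ← Real.mul_rpow (by positivity) ht.1.le]
  apply Real.rpow_le_rpow_of_nonpos h2 _ (by norm_num)
  exact h1.trans (le_abs_self _)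

lemma sq_period : Function.Periodic sq π := by
  intro t; simp [sq]

lemma sq_int (a b : ℝ) : IntervalIntegrable sq volume a b := by
  have h2 : IntervalIntegrable sq volume (π/2) π := by
    have := (sq_int0.comp_sub_left π).symm
    have e : (fun x => sq (π - x)) = sq := by
      funext x; simp [sq]
    rw [e] at this
    convert this using 1 <;> ring
  have h3 : IntervalIntegrable sq volume 0 (0 + π) := by
    rw [zero_add]; exact sq_int0.trans h2
  exact sq_period.intervalIntegrable Real.pi_pos.ne' h3 a b

lemma inv_sqrt_bound {r θ : ℝ} (hr : 1 ≤ r) {a : ℂ} (h : sin (θ - a.arg) ≠ 0) :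
    ‖circleMap 0 r θ - a‖ ^ (-(1/2) : ℝ) ≤ sq (θ - a.arg) := by
  unfold sq
  apply Real.rpow_le_rpow_of_nonpos (abs_pos.2 h) _ (by norm_num)
  have e : ‖circleMap 0 r θ - a‖ = ‖(r : ℂ) * Complex.exp ((θ - a.arg : ℝ) * Complex.I) - ‖a‖‖ := by
    have h1 : circleMap 0 r θ - a = (((r : ℂ) * Complex.exp ((θ - a.arg : ℝ) * Complex.I) - ‖a‖)) *
        Complex.exp (a.arg * Complex.I) := by
      rw [sub_mul, Complex.norm_mul_exp_arg_mul_I, mul_assoc, ← Complex.exp_add]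
      simp [circleMap]
      left
      congr 1; ring
    rw [h1, norm_mul, Complex.norm_exp_ofReal_mul_I, mul_one]
  rw [e]
  refine le_trans ?_ (Complex.abs_im_le_norm _)
  have : ((r : ℂ) * Complex.exp ((θ - a.arg : ℝ) * Complex.I) - ‖a‖).im = r * sin (θ - a.arg) := by
    rw [Complex.sub_im, Complex.ofReal_im, sub_zero, Complex.im_ofReal_mul, Complex.exp_ofReal_mul_I_im]
  rw [this, abs_mul, abs_of_pos (show (0:ℝ) < r by linarith)]
  nlinarith [abs_nonneg (sin (θ - a.arg))]

noncomputable def C0 : ℝ := (2 * π)⁻¹ * ∫ t in 0..(2 * π), sq t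

lemma C0_nonneg : 0 ≤ C0 := by
  unfold C0
  apply mul_nonneg (by positivity)
  apply intervalIntegral.integral_nonneg (by positivity)
  intro t _; unfold sq; positivity

lemma inv_sqrt_mean {r : ℝ} (hr : 1 ≤ r) (a : ℂ) :
    CircleIntegrable (fun z => ‖z - a‖ ^ (-(1/2) : ℝ)) 0 r ∧
    circleAverage (fun z => ‖z - a‖ ^ (-(1/2) : ℝ)) 0 r ≤ C0 := by
  have hae : ∀ᵐ θ : ℝ, sin (θ - a.arg) ≠ 0 := by
    have hc : (range (fun n : ℤ => (n : ℝ) * π + a.arg)).Countable := countable_range _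
    filter_upwards [hc.ae_notMem volume] with θ hθ h
    apply hθ
    obtain ⟨n, hn⟩ := Real.sin_eq_zero_iff.1 h
    exact ⟨n, by simp only; linarith⟩
  have hI : IntervalIntegrable (fun θ => sq (θ - a.arg)) volume 0 (2 * π) := by
    have := (sq_int (0 - a.arg) (2 * π - a.arg)).comp_sub_right a.arg
    simpa using this
  have hm : AEStronglyMeasurable (fun θ => ‖circleMap 0 r θ - a‖ ^ (-(1/2) : ℝ)) volume := by
    apply Measurable.aestronglyMeasurable
    exact (((continuous_circleMap 0 r).sub continuous_const).norm.measurable).pow_const _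
  have hI2 : IntervalIntegrable (fun θ => ‖circleMap 0 r θ - a‖ ^ (-(1/2) : ℝ)) volume 0 (2 * π) := by
    refine hI.mono_fun' hm.restrict ?_
    filter_upwards [ae_restrict_of_ae hae] with θ hθ
    rw [Real.norm_of_nonneg (by positivity)]
    exact inv_sqrt_bound hr hθ
  refine ⟨hI2, ?_⟩
  rw [circleAverage, C0, smul_eq_mul]
  apply mul_le_mul_of_nonneg_left _ (by positivity)
  have h1 : ∫ θ in 0..(2*π), sq (θ - a.arg) = ∫ t in 0..(2 * π), sq t := by
    rw [intervalIntegral.integral_comp_sub_right]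
    have hp : Function.Periodic sq (2 * π) := by
      have := sq_period.nsmul 2
      simpa [two_mul] using this
    have := hp.intervalIntegral_add_eq (0 - a.arg) 0
    convert this using 2 <;> ring
  rw [← h1]
  apply intervalIntegral.integral_mono_ae (by positivity) hI2 hI
  filter_upwards [hae] with θ hθ
  exact inv_sqrt_bound hr hθ

end FW
end

section
open Real Metric Set Filter Topology MeasureTheory
namespace FW

lemma circleAverage_mono_cod {c : ℂ} {R : ℝ} (hR : R ≠ 0) {f₁ f₂ : ℂ → ℝ}
    (h1 : CircleIntegrable f₁ c R) (h2 : CircleIntegrable f₂ c R)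
    (h : ∀ᶠ z in codiscreteWithin (sphere c |R|), f₁ z ≤ f₂ z) :
    circleAverage f₁ c R ≤ circleAverage f₂ c R := by
  have e : f₂ =ᶠ[codiscreteWithin (sphere c |R|)] fun z => max (f₁ z) (f₂ z) := by
    filter_upwards [h] with z hz
    rw [max_eq_right hz]
  rw [circleAverage_congr_codiscreteWithin e hR]
  exact circleAverage_mono h1 (h2.congr_codiscreteWithin e) fun x _ => le_max_left _ _

lemma mean_abs_log {R : ℝ} (hR : 1 ≤ R) {a : ℂ} (ha : a ∈ closedBall (0:ℂ) R) :
    circleAverage (fun z => |log ‖z - a‖|) 0 R ≤ 4 * R := by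
  have hi := circleIntegrable_log_norm_sub_const (c := 0) (a := a) R
  have h1 : circleAverage (fun z => |log ‖z - a‖|) 0 R ≤
      circleAverage (fun z => 2 * log (2 * R) - log ‖z - a‖) 0 R := by
    apply circleAverage_mono_cod (by linarith) hi.abs ((circleIntegrable_const _ _ _).sub hi)
    have hs : {a}ᶜ ∈ codiscreteWithin (sphere (0:ℂ) |R|) := by
      simpa using compl_finite_mem_codiscreteWithin (s := sphere (0:ℂ) |R|) (Set.finite_singleton a)
    filter_upwards [hs, self_mem_codiscreteWithin (sphere (0:ℂ) |R|)] with z hz hzs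
    have hp : 0 < ‖z - a‖ := norm_pos_iff.2 (sub_ne_zero.2 (by simpa using hz))
    have hL : 0 ≤ log (2 * R) := Real.log_nonneg (by linarith)
    have hle : log ‖z - a‖ ≤ log (2 * R) := by
      apply Real.log_le_log hp
      refine (norm_sub_le _ _).trans ?_
      have : ‖z‖ = |R| := by simpa using hzs
      rw [abs_of_pos (by linarith)] at this
      have : ‖a‖ ≤ R := by simpa using ha
      linarith
    show |log ‖z - a‖| ≤ 2 * log (2 * R) - log ‖z - a‖
    rw [abs_le]; constructor <;> linarith
  refine h1.trans ?_
  rw [circleAverage_fun_sub (circleIntegrable_const _ _ _) hi, circleAverage_const,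
    circleAverage_log_norm_sub_const_of_mem_closedBall (by rwa [abs_of_pos (by linarith)])]
  have : 0 ≤ log R := Real.log_nonneg hR
  have := Real.log_le_sub_one_of_pos (show 0 < 2 * R by linarith)
  linarith

lemma ldl_local {φ : ℂ → ℂ} (hφ : Meromorphic φ) (hne : ∀ z, meromorphicOrderAt φ z ≠ ⊤) {r R : ℝ}
    (hr : 1 ≤ r) (hrR : r < R) (A : Finset ℂ)
    (hA : ∀ a, a ∈ A ↔ MeromorphicOn.divisor φ (closedBall 0 R) a ≠ 0)
    (nn M s K : ℝ) (hnn : nn = ∑ a ∈ A, |(MeromorphicOn.divisor φ (closedBall 0 R) a : ℝ)|)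
    (hM : M = circleAverage (fun z => |log ‖φ z‖|) 0 R) (hs : s = (R - r) / 2)
    (hK : K = 2 * R / s ^ 2 * (M + 4 * R * nn) + 1 / s) :
    ∃ X : ℂ → ℝ, (∀ z, 1 ≤ X z) ∧ CircleIntegrable X 0 r ∧
      circleAverage X 0 r ≤ 2 + K + nn * C0 ∧
      ∀ᶠ z in codiscreteWithin (sphere (0:ℂ) |r|), ∀ l : ℕ,
        ‖iteratedDeriv l φ z‖ ≤ l.factorial * exp 2 * 2 ^ l * X z ^ (2 * l) * ‖φ z‖ := by
  set D := MeromorphicOn.divisor φ (closedBall 0 R) with hD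
  have hs0 : 0 < s := by rw [hs]; linarith
  have hfin : D.support.Finite := D.finiteSupport (isCompact_closedBall _ _)
  obtain ⟨F, hF, hF0, hFe⟩ := MeromorphicOn.extract_zeros_poles (f := φ) (U := closedBall 0 R)
    (fun x _ => hφ x) (fun u => hne u) hfin
  have hAD : ∀ a ∈ A, a ∈ closedBall (0:ℂ) R := by
    intro a ha
    exact D.supportWithinDomain ((hA a).1 ha)
  have hprod : (∏ᶠ u, (· - u) ^ D u : ℂ → ℂ) = fun x => ∏ a ∈ A, (x - a) ^ (D a) := by
    rw [finprod_eq_prod_of_mulSupport_subset (s := A)]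
    · ext x; simp
    · rw [Function.FactorizedRational.mulSupport]
      intro a ha
      exact (hA a).2 ha
  rw [← hD, hprod] at hFe
  set ψ : ℂ → ℂ := fun x => (∏ a ∈ A, (x - a) ^ (D a)) * F x with hψ
  have hFe' : φ =ᶠ[codiscreteWithin (closedBall (0:ℂ) R)] ψ := hFe
  have hcA : ∀ U : Set ℂ, ∀ᶠ z in codiscreteWithin U, z ∉ A := by
    intro U
    exact compl_finite_mem_codiscreteWithin (A.finite_toSet)
  have hF0' : ∀ x ∈ closedBall (0:ℂ) R, F x ≠ 0 := fun x hx => hF0 ⟨x, hx⟩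
  -- mean of log F
  have hiφ : CircleIntegrable (fun z => log ‖φ z‖) 0 R :=
    MeromorphicOn.circleIntegrable_log_norm fun x _ => hφ x
  have hRabs : |R| = R := abs_of_pos (by linarith)
  have hiF : CircleIntegrable (fun z => log ‖F z‖) 0 R := by
    apply MeromorphicOn.circleIntegrable_log_norm
    intro x hx
    rw [hRabs] at hx
    exact (hF x (sphere_subset_closedBall hx)).meromorphicAt
  have hiA : ∀ a, CircleIntegrable (fun z => |(D a : ℝ)| * |log ‖z - a‖|) 0 R := by
    intro a
    exact (circleIntegrable_log_norm_sub_const (c := 0) (a := a) R).abs.const_smul (a := |(D a : ℝ)|)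
  have hiφ' : CircleIntegrable (fun z => |log ‖φ z‖|) 0 R := hiφ.abs
  have hiF' : CircleIntegrable (fun z => |log ‖F z‖|) 0 R := hiF.abs
  have hmF : circleAverage (fun z => |log ‖F z‖|) 0 R ≤ M + 4 * R * nn := by
    have hsum : CircleIntegrable (fun z => ∑ a ∈ A, |(D a : ℝ)| * |log ‖z - a‖|) 0 R := by
      have := CircleIntegrable.sum A (fun a _ => hiA a)
      convert this using 1
      ext z; simp
    have h1 : circleAverage (fun z => |log ‖F z‖|) 0 R ≤
        circleAverage (fun z => |log ‖φ z‖| + ∑ a ∈ A, |(D a : ℝ)| * |log ‖z - a‖|) 0 R := by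
      apply circleAverage_mono_cod (by linarith) hiF' (hiφ'.add hsum)
      rw [hRabs]
      filter_upwards [codiscreteWithin_mono sphere_subset_closedBall hFe', hcA _,
        self_mem_codiscreteWithin _] with z hz hzA hzs
      have hzA' : ∀ a ∈ A, z ≠ a := fun a ha h => hzA (h ▸ ha)
      have hFz := hF0' z (sphere_subset_closedBall hzs)
      have : log ‖φ z‖ = ∑ a ∈ A, (D a : ℝ) * log ‖z - a‖ + log ‖F z‖ := by
        rw [hz, hψ]
        simp only
        rw [norm_mul, Real.log_mul _ (norm_ne_zero_iff.2 hFz), norm_prod, Real.log_prod]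
        · congr 1
          apply Finset.sum_congr rfl
          intro a ha
          rw [norm_zpow, Real.log_zpow]
        · intro a ha
          exact norm_ne_zero_iff.2 (zpow_ne_zero _ (sub_ne_zero.2 (hzA' a ha)))
        · rw [norm_ne_zero_iff, Finset.prod_ne_zero_iff]
          intro a ha
          exact (zpow_ne_zero _ (sub_ne_zero.2 (hzA' a ha)))
      have e : log ‖F z‖ = log ‖φ z‖ - ∑ a ∈ A, (D a : ℝ) * log ‖z - a‖ := by rw [this]; ring
      show |log ‖F z‖| ≤ |log ‖φ z‖| + ∑ a ∈ A, |(D a : ℝ)| * |log ‖z - a‖|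
      rw [e]
      refine (abs_sub _ _).trans ?_
      gcongr
      refine (Finset.abs_sum_le_sum_abs _ _).trans ?_
      simp [abs_mul]
    refine h1.trans ?_
    rw [circleAverage_fun_add hiφ' hsum, ← hM, circleAverage_fun_sum (fun a _ => hiA a)]
    gcongr
    rw [hnn, Finset.mul_sum]
    apply Finset.sum_le_sum
    intro a ha
    have : circleAverage (fun z => |(D a : ℝ)| * |log ‖z - a‖|) 0 R =
        |(D a : ℝ)| * circleAverage (fun z => |log ‖z - a‖|) 0 R := by
      rw [← smul_eq_mul, ← circleAverage_fun_smul]; rfl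
    rw [this, mul_comm]
    gcongr
    exact mean_abs_log (by linarith) (hAD a ha)
  have hM0 : 0 ≤ M := by rw [hM]; exact circleAverage_nonneg_of_nonneg fun x _ => abs_nonneg _
  have hnn0 : 0 ≤ nn := by rw [hnn]; positivity
  have hR0 : 0 < R := by linarith
  have hK2 : 1 / s ≤ K := by
    rw [hK]; have : 0 ≤ 2 * R / s ^ 2 * (M + 4 * R * nn) := by positivity
    linarith
  have hK1 : 2 * R / s ^ 2 * circleAverage (fun x => |log ‖F x‖|) 0 R ≤ K := by
    rw [hK]
    have : 2 * R / s ^ 2 * circleAverage (fun x => |log ‖F x‖|) 0 R ≤ 2 * R / s ^ 2 * (M + 4 * R * nn) := by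
      gcongr
    have : 0 < 1 / s := by positivity
    linarith
  have hK0 : 0 < K := lt_of_lt_of_le (by positivity) hK2
  have hiS : ∀ a, CircleIntegrable (fun z => |(D a : ℝ)| * ‖z - a‖ ^ (-(1/2) : ℝ)) 0 r := by
    intro a
    exact (inv_sqrt_mean hr a).1.const_smul (a := |(D a : ℝ)|)
  have hiSum : CircleIntegrable (fun z => ∑ a ∈ A, |(D a : ℝ)| * ‖z - a‖ ^ (-(1/2) : ℝ)) 0 r := by
    have := CircleIntegrable.sum A (fun a _ => hiS a)
    convert this using 1
    ext z; simp
  refine ⟨fun z => (1 + √K) + ∑ a ∈ A, |(D a : ℝ)| * ‖z - a‖ ^ (-(1/2) : ℝ), ?_, ?_, ?_, ?_⟩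
  · intro z
    have h1 : 0 ≤ √K := by positivity
    have h2 : 0 ≤ ∑ a ∈ A, |(D a : ℝ)| * ‖z - a‖ ^ (-(1/2) : ℝ) := by positivity
    linarith
  · exact (circleIntegrable_const _ _ _).add hiSum
  · rw [circleAverage_fun_add (circleIntegrable_const _ _ _) hiSum, circleAverage_const,
      circleAverage_fun_sum (fun a _ => hiS a)]
    have h1 : √K ≤ 1 + K := by
      have := Real.sq_sqrt hK0.le
      nlinarith [Real.sqrt_nonneg K]
    have h2 : ∑ a ∈ A, circleAverage (fun z => |(D a : ℝ)| * ‖z - a‖ ^ (-(1/2) : ℝ)) 0 r ≤ nn * C0 := by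
      rw [hnn, Finset.sum_mul]
      apply Finset.sum_le_sum
      intro a ha
      have : circleAverage (fun z => |(D a : ℝ)| * ‖z - a‖ ^ (-(1/2) : ℝ)) 0 r =
          |(D a : ℝ)| * circleAverage (fun z => ‖z - a‖ ^ (-(1/2) : ℝ)) 0 r := by
        rw [← smul_eq_mul, ← circleAverage_fun_smul]; rfl
      rw [this]
      gcongr
      exact (inv_sqrt_mean hr a).2
    linarith
  · have hloc : ∀ᶠ z in codiscreteWithin (ball (0:ℂ) R), φ =ᶠ[𝓝 z] ψ := by
      have h1 := codiscreteWithin_mono ball_subset_closedBall hFe'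
      rw [Filter.Eventually, mem_codiscreteWithin_iff_forall_mem_nhdsNE]
      intro x hx
      have h2 := (mem_codiscreteWithin_iff_forall_mem_nhdsNE.1 h1) x hx
      have h3 : ∀ᶠ y in 𝓝[≠] x, φ y = ψ y := by
        filter_upwards [h2, nhdsWithin_le_nhds (isOpen_ball.mem_nhds hx)] with y hy hy2
        rcases hy with hy | hy
        · exact hy
        · exact absurd hy2 hy
      have h4 : ∀ᶠ y in 𝓝[≠] x, ∀ᶠ y' in 𝓝[≠] x, True := by simp
      have h5 := eventually_eventually_nhdsWithin.2 h3
      filter_upwards [h5, self_mem_nhdsWithin] with y hy hyx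
      left
      have : 𝓝[≠] x ≤ 𝓝[≠] x := le_rfl
      have hopen : 𝓝[{x}ᶜ] y = 𝓝 y := isOpen_compl_singleton.nhdsWithin_eq hyx
      rw [hopen] at hy
      exact hy
    have hsub : sphere (0:ℂ) |r| ⊆ ball 0 R := by
      intro x hx
      rw [abs_of_pos (by linarith)] at hx
      simp at hx ⊢; linarith
    filter_upwards [codiscreteWithin_mono hsub hloc, hcA _, self_mem_codiscreteWithin _] with z hz hzA hzs l
    have hzA' : ∀ a ∈ A, z ≠ a := fun a ha h => hzA (h ▸ ha)
    rw [hz.iteratedDeriv_eq, hz.eq_of_nhds]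
    have hzn : ‖z‖ = r := by
      rw [abs_of_pos (by linarith)] at hzs; simpa using hzs
    have hg := growth hs0 (fun a ha => (hA a).1 ha) hF hF0' hK1 hK2 (z := z) (by rw [hzn, hs]; linarith) hzA' l
    refine hg.trans ?_
    have hSK : (∑ a ∈ A, |(D a : ℝ)| / ‖z - a‖) + K ≤
        ((1 + √K) + ∑ a ∈ A, |(D a : ℝ)| * ‖z - a‖ ^ (-(1/2) : ℝ)) ^ 2 := by
      have h1 : (∑ a ∈ A, |(D a : ℝ)| / ‖z - a‖) ≤ (∑ a ∈ A, |(D a : ℝ)| * ‖z - a‖ ^ (-(1/2) : ℝ)) ^ 2 := by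
        refine le_trans ?_ (Finset.sum_sq_le_sq_sum_of_nonneg ?_)
        · apply Finset.sum_le_sum
          intro a ha
          have h2 : (1 : ℝ) ≤ |(D a : ℝ)| := by
            exact_mod_cast Int.one_le_abs ((hA a).1 ha)
          have h3 : (‖z - a‖ ^ (-(1/2) : ℝ)) ^ 2 = ‖z - a‖⁻¹ := by
            rw [← Real.rpow_natCast, ← Real.rpow_mul (norm_nonneg _)]
            norm_num [Real.rpow_neg_one]
          rw [mul_pow, h3, div_eq_mul_inv]
          gcongr
          nlinarith
        · intro a _; positivity
      have h0 : 0 ≤ ∑ a ∈ A, |(D a : ℝ)| * ‖z - a‖ ^ (-(1/2) : ℝ) := by positivity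
      have := Real.sq_sqrt hK0.le
      nlinarith [Real.sqrt_nonneg K, mul_nonneg (Real.sqrt_nonneg K) h0]
    have hS0 : 0 ≤ ∑ a ∈ A, |(D a : ℝ)| / ‖z - a‖ := by positivity
    rw [mul_pow, pow_mul]
    calc _ ≤ (l.factorial : ℝ) * (exp 2 * ‖ψ z‖) * (2 ^ l * (((1 + √K) + ∑ a ∈ A, |(D a : ℝ)| * ‖z - a‖ ^ (-(1/2) : ℝ)) ^ 2) ^ l) := by
          gcongr
      _ = _ := by ring

end FW
end

section
open Real Metric Set Filter Topology MeasureTheory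
namespace FW
open ValueDistribution

lemma nn_le {φ : ℂ → ℂ} (hφ : Meromorphic φ) {r R : ℝ} (hr : 1 ≤ r) (hrR : r < R) (A : Finset ℂ)
    (hA : ∀ a, a ∈ A ↔ MeromorphicOn.divisor φ (closedBall 0 r) a ≠ 0) :
    ∑ a ∈ A, |(MeromorphicOn.divisor φ (closedBall 0 r) a : ℝ)| ≤
      R / (R - r) * (logCounting φ 0 R + logCounting φ ⊤ R) := by
  classical
  set D := MeromorphicOn.divisor φ univ with hD
  have hφ' : MeromorphicOn φ univ := fun x _ => hφ x
  have hin : ∀ a ∈ A, a ∈ closedBall (0:ℂ) r := by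
    intro a ha
    by_contra h
    exact (hA a).1 ha ((MeromorphicOn.divisor φ (closedBall 0 r)).apply_eq_zero_of_notMem h)
  have heq : ∀ a ∈ A, MeromorphicOn.divisor φ (closedBall 0 r) a = D a := by
    intro a ha
    rw [MeromorphicOn.divisor_apply (fun x _ => hφ x) (hin a ha), hD,
      MeromorphicOn.divisor_apply hφ' (mem_univ _)]
  have hE : (∑ a ∈ A, Function.locallyFinsuppWithin.single a |D a|) ≤ D⁺ + D⁻ := by
    intro z
    simp only [Function.locallyFinsuppWithin.coe_sum, Finset.sum_apply,
      Function.locallyFinsuppWithin.single_apply, Function.locallyFinsuppWithin.coe_add,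
      Pi.add_apply, Function.locallyFinsuppWithin.posPart_apply,
      Function.locallyFinsuppWithin.negPart_apply]
    rw [posPart_add_negPart]
    by_cases hz : z ∈ A
    · rw [Finset.sum_eq_single z]
      · simp
      · intro b _ hb; simp [hb.symm]
      · intro h; exact absurd hz h
    · rw [Finset.sum_eq_zero]
      · positivity
      · intro b hb
        have : z ≠ b := fun h => hz (h ▸ hb)
        simp [this]
  have h1 := Function.locallyFinsuppWithin.logCounting_le hE (by linarith : 1 ≤ R)
  rw [map_add, map_sum, Pi.add_apply, Finset.sum_apply] at h1
  rw [logCounting_zero, logCounting_top]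
  have hlog : (R - r) / R ≤ log R - log r := by
    rw [← Real.log_div (by linarith) (by linarith)]
    have := Real.one_sub_inv_le_log_of_pos (x := R / r) (by apply div_pos <;> linarith)
    refine le_trans (le_of_eq ?_) this
    rw [inv_div, sub_div, div_self (by linarith)]
  have hpos : 0 < (R - r) / R := by apply div_pos <;> linarith
  have h2 : (R - r) / R * ∑ a ∈ A, |(MeromorphicOn.divisor φ (closedBall 0 r) a : ℝ)| ≤
      ∑ a ∈ A, Function.locallyFinsuppWithin.logCounting
        (Function.locallyFinsuppWithin.single a |D a|) R := by
    rw [Finset.mul_sum]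
    apply Finset.sum_le_sum
    intro a ha
    have han : ‖a‖ ≤ r := by simpa using hin a ha
    rw [Function.locallyFinsuppWithin.logCounting_single_eq_log_sub_const (by linarith), heq a ha,
      mul_comm]
    push_cast
    apply mul_le_mul_of_nonneg_left _ (abs_nonneg _)
    refine hlog.trans ?_
    have : log ‖a‖ ≤ log r := by
      rcases eq_or_ne a 0 with h | h
      · simp [h]; exact Real.log_nonneg hr
      · exact Real.log_le_log (norm_pos_iff.2 h) han
    linarith
  have h3 := h2.trans h1
  have : R / (R - r) = ((R - r) / R)⁻¹ := by rw [inv_div]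
  rw [this, inv_mul_eq_div, le_div_iff₀ hpos, mul_comm]
  exact h3

lemma abs_log_eq {x : ℝ} (hx : 0 ≤ x) : |log x| = log⁺ x + log⁺ x⁻¹ := by
  rw [posLog, posLog, Real.log_inv]
  rcases le_total 0 (log x) with h | h
  · rw [abs_of_nonneg h, max_eq_right h, max_eq_left (by linarith)]; ring
  · rw [abs_of_nonpos h, max_eq_left h, max_eq_right (by linarith)]; ring

lemma mean_le {φ : ℂ → ℂ} (hφ : Meromorphic φ) {r : ℝ} :
    circleAverage (fun z => |log ‖φ z‖|) 0 r ≤ proximity φ ⊤ r + proximity φ⁻¹ ⊤ r := by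
  have hi : Meromorphic φ⁻¹ := fun x => (hφ x).inv
  rw [proximity_top, proximity_top, ← circleAverage_add]
  · apply le_of_eq
    congr 1
    ext z
    simp only [Pi.add_apply, Pi.inv_apply, norm_inv]
    exact abs_log_eq (norm_nonneg _)
  · exact MeromorphicOn.circleIntegrable_posLog_norm fun x _ => hφ x
  · exact MeromorphicOn.circleIntegrable_posLog_norm fun x _ => hi x

theorem ldl {φ : ℂ → ℂ} (hφ : Meromorphic φ) (hne : ∀ z, meromorphicOrderAt φ z ≠ ⊤) :
    ∃ C : ℝ, 0 < C ∧ ∀ r R : ℝ, 1 ≤ r → r < R → ∃ X : ℂ → ℝ, (∀ z, 1 ≤ X z) ∧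
      CircleIntegrable X 0 r ∧
      circleAverage X 0 r ≤ C * (R / (R - r)) ^ 3 * (1 + characteristic φ ⊤ R) ∧
      ∀ᶠ z in codiscreteWithin (sphere (0:ℂ) |r|), ∀ l : ℕ,
        ‖iteratedDeriv l φ z‖ ≤ l.factorial * exp 2 * 2 ^ l * X z ^ (2 * l) * ‖φ z‖ := by
  set c := |log ‖meromorphicTrailingCoeffAt φ 0‖| with hc
  have hc0 : 0 ≤ c := abs_nonneg _
  have hC0 := C0_nonneg
  refine ⟨6 + (288 + 2 * C0) * (2 + c), by positivity, ?_⟩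
  intro r R hr hrR
  set R1 := (r + R) / 2 with hR1
  have hfin := (MeromorphicOn.divisor φ (closedBall (0:ℂ) R1)).finiteSupport
    (isCompact_closedBall 0 R1)
  obtain ⟨X, hX1, hXi, hXa, hXd⟩ := ldl_local hφ hne hr (by linarith : r < R1) hfin.toFinset
    (by simp) _ _ _ _ rfl rfl rfl rfl
  refine ⟨X, hX1, hXi, hXa.trans ?_, hXd⟩
  have hnn := nn_le hφ (by linarith : 1 ≤ R1) (by linarith : R1 < R) hfin.toFinset (by simp)
  have hM := mean_le hφ (r := R1)
  set nn := ∑ a ∈ hfin.toFinset, |(MeromorphicOn.divisor φ (closedBall (0:ℂ) R1) a : ℝ)|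
  have hnn0 : 0 ≤ nn := Finset.sum_nonneg fun _ _ => abs_nonneg _
  set M := circleAverage (fun z => |log ‖φ z‖|) 0 R1
  set T := characteristic φ ⊤ R with hT
  have hT0 : 0 ≤ T := characteristic_nonneg (by linarith)
  have hinv : ∀ ρ : ℝ, 1 ≤ ρ → characteristic φ⁻¹ ⊤ ρ ≤ characteristic φ ⊤ ρ + c := by
    intro ρ hρ
    have := characteristic_sub_characteristic_inv_of_ne_zero hφ (by linarith : ρ ≠ 0)
    have h2 := neg_abs_le (log ‖meromorphicTrailingCoeffAt φ 0‖)
    linarith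
  have hTR1 : characteristic φ ⊤ R1 ≤ T :=
    characteristic_monotoneOn hφ (by show 0 < R1; linarith) (by show 0 < R; linarith) (by linarith)
  have e : ∀ (g : ℂ → ℂ) ρ, characteristic g ⊤ ρ = proximity g ⊤ ρ + logCounting g ⊤ ρ :=
    fun g ρ => rfl
  have hMB : M ≤ 2 * T + c := by
    have h1 := hinv R1 (by linarith)
    rw [e, e] at h1
    rw [e] at hTR1
    have h2 : 0 ≤ logCounting φ ⊤ R1 := logCounting_nonneg (by linarith)
    have h3 : 0 ≤ logCounting φ⁻¹ ⊤ R1 := logCounting_nonneg (by linarith)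
    linarith
  have hnB : nn ≤ 2 * (R / (R - r)) * (2 * T + c) := by
    have h1 := hinv R (by linarith)
    rw [← hT, e, logCounting_inv] at h1
    have h2 : 0 ≤ proximity φ⁻¹ ⊤ R := proximity_nonneg _
    have h3 : 0 ≤ proximity φ ⊤ R := proximity_nonneg _
    have h4 := e φ R
    refine hnn.trans ?_
    have : R / (R - R1) = 2 * (R / (R - r)) := by
      have e1 : R - R1 = (R - r) / 2 := by rw [hR1]; ring
      rw [e1, div_div_eq_mul_div]; ring
    rw [this]
    apply mul_le_mul_of_nonneg_left
    · linarith
    · apply mul_nonneg (by norm_num); apply div_nonneg <;> linarith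
  set B := 2 * T + c with hB
  have hB0 : 0 ≤ B := by positivity
  have hBle : B ≤ (2 + c) * (1 + T) := by nlinarith
  set δ := R - r with hδ
  have hδ0 : 0 < δ := by linarith
  set x := R / δ with hx
  have hx1 : 1 ≤ x := by rw [hx, le_div_iff₀ hδ0]; linarith
  have hR0 : 0 < R := by linarith
  have hs : (R1 - r) / 2 = δ / 4 := by rw [hR1, hδ]; ring
  rw [hs]
  have hRx : R = x * δ := by rw [hx]; field_simp
  have k1 : 2 * R1 / (δ / 4) ^ 2 * (M + 4 * R1 * nn) ≤ 288 * x ^ 3 * B := by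
    have a1 : M + 4 * R1 * nn ≤ B + 4 * R * (2 * x * B) := by
      have : R1 * nn ≤ R * (2 * x * B) := by
        apply mul_le_mul (by linarith) hnB hnn0 hR0.le
      linarith
    have a2 : 2 * R1 / (δ / 4) ^ 2 ≤ 2 * R / (δ / 4) ^ 2 := by
      apply div_le_div_of_nonneg_right _ (by positivity); linarith
    have a3 : 2 * R1 / (δ / 4) ^ 2 * (M + 4 * R1 * nn) ≤
        2 * R / (δ / 4) ^ 2 * (B + 4 * R * (2 * x * B)) := by
      apply mul_le_mul a2 a1
      · have : 0 ≤ M := circleAverage_nonneg_of_nonneg fun _ _ => abs_nonneg _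
        have : 0 ≤ R1 := by linarith
        positivity
      · positivity
    refine a3.trans ?_
    have a4 : B + 4 * R * (2 * x * B) ≤ 9 * R * x * B := by
      have : 1 ≤ R * x := by nlinarith
      nlinarith
    have a5 : 2 * R / (δ / 4) ^ 2 * (B + 4 * R * (2 * x * B)) ≤
      2 * R / (δ / 4) ^ 2 * (9 * R * x * B) := mul_le_mul_of_nonneg_left a4 (by positivity)
    refine a5.trans (le_of_eq ?_)
    rw [hRx]
    field_simp
    ring
  have k2 : 1 / (δ / 4) ≤ 4 * x := by
    rw [hx]; field_simp; nlinarith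
  have hx3 : x ≤ x ^ 3 := le_self_pow₀ hx1 (by norm_num)
  have hx13 : 1 ≤ x ^ 3 := one_le_pow₀ hx1
  have k3 : nn * C0 ≤ 2 * x ^ 3 * B * C0 := by
    apply mul_le_mul_of_nonneg_right _ hC0
    refine hnB.trans ?_
    gcongr
  have k4 : (288 + 2 * C0) * x ^ 3 * B ≤ (288 + 2 * C0) * x ^ 3 * ((2 + c) * (1 + T)) :=
    mul_le_mul_of_nonneg_left hBle (by positivity)
  have k5 : x ^ 3 ≤ x ^ 3 * (1 + T) := le_mul_of_one_le_right (by positivity) (by linarith)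
  nlinarith

end FW
end

section
open Metric Set Filter Topology
namespace FW

noncomputable def Wr {k : ℕ} (F : Fin k → ℂ → ℂ) (z : ℂ) : ℂ :=
  Matrix.det (Matrix.of fun i l : Fin k => iteratedDeriv (l : ℕ) (F i) z)

lemma wr_congr {k : ℕ} {F G : Fin k → ℂ → ℂ} {z : ℂ} (h : ∀ i, F i =ᶠ[𝓝 z] G i) :
    Wr F z = Wr G z := by
  unfold Wr
  congr 1
  ext i l
  exact (h i).iteratedDeriv_eq _

lemma analyticAt_iter {f : ℂ → ℂ} {z : ℂ} (hf : AnalyticAt ℂ f z) (l : ℕ) :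
    AnalyticAt ℂ (iteratedDeriv l f) z := by
  rw [iteratedDeriv_eq_iterate]
  exact hf.iterated_deriv l

lemma analyticAt_det {k : ℕ} {A : Fin k → Fin k → ℂ → ℂ} {z : ℂ}
    (h : ∀ i j, AnalyticAt ℂ (A i j) z) :
    AnalyticAt ℂ (fun w => Matrix.det (Matrix.of fun i j => A i j w)) z := by
  simp only [Matrix.det_apply, Matrix.of_apply]
  apply Finset.analyticAt_fun_sum
  intro σ _
  simp only [Units.smul_def, zsmul_eq_mul]
  apply AnalyticAt.mul analyticAt_const
  apply Finset.analyticAt_fun_prod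
  intro i _
  exact h _ _

lemma wr_analyticAt {k : ℕ} {F : Fin k → ℂ → ℂ} {z : ℂ} (h : ∀ i, AnalyticAt ℂ (F i) z) :
    AnalyticAt ℂ (Wr F) z :=
  analyticAt_det (A := fun i l => iteratedDeriv (l : ℕ) (F i)) fun i l => analyticAt_iter (h i) _

lemma wr_mul {k : ℕ} {u : ℂ → ℂ} {F : Fin k → ℂ → ℂ} {z : ℂ} (hu : AnalyticAt ℂ u z)
    (hF : ∀ i, AnalyticAt ℂ (F i) z) :
    Wr (fun i => F i * u) z = u z ^ k * Wr F z := by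
  set T : Matrix (Fin k) (Fin k) ℂ := Matrix.of fun m l =>
    if (m : ℕ) ≤ l then ((l : ℕ).choose m : ℂ) * iteratedDeriv ((l : ℕ) - m) u z else 0 with hT
  have hdet : T.det = u z ^ k := by
    rw [Matrix.det_of_upperTriangular]
    · simp [hT]
    · intro i j hij
      simp only [id] at hij
      have : ¬ ((i : ℕ) ≤ j) := by simpa using hij
      simp only [hT, Matrix.of_apply, if_neg this]
  have hprod : (Matrix.of fun i l : Fin k => iteratedDeriv (l : ℕ) (F i * u) z) =
      (Matrix.of fun i l : Fin k => iteratedDeriv (l : ℕ) (F i) z) * T := by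
    ext i l
    rw [Matrix.mul_apply, Matrix.of_apply,
      iteratedDeriv_mul ((hF i).contDiffAt) hu.contDiffAt]
    simp only [hT, Matrix.of_apply]
    rw [Fin.sum_univ_eq_sum_range (fun m => iteratedDeriv m (F i) z *
      (if m ≤ (l:ℕ) then ((l : ℕ).choose m : ℂ) * iteratedDeriv ((l : ℕ) - m) u z else 0)) k]
    have hsub : Finset.range ((l:ℕ) + 1) ⊆ Finset.range k := by
      intro x hx
      have := l.2
      simp at hx ⊢; omega
    rw [← Finset.sum_subset hsub]
    · apply Finset.sum_congr rfl
      intro x hx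
      have : x ≤ (l:ℕ) := by simp at hx; omega
      rw [if_pos this]; ring
    · intro x _ hx
      have : ¬ x ≤ (l:ℕ) := by simp at hx; omega
      rw [if_neg this, mul_zero]
  unfold Wr
  rw [hprod, Matrix.det_mul, hdet, mul_comm]

lemma iter_factor (f : ℂ → ℂ) (a : ℂ) (n l : ℕ)
    (h : ∃ g, AnalyticAt ℂ g a ∧ ∀ᶠ z in 𝓝 a, f z = (z - a) ^ n * g z) :
    ∃ g, AnalyticAt ℂ g a ∧ ∀ᶠ z in 𝓝 a, iteratedDeriv l f z = (z - a) ^ (n - l) * g z := by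
  induction l with
  | zero => simpa using h
  | succ l ih =>
    obtain ⟨g, hg, hfg⟩ := ih
    rw [iteratedDeriv_succ]
    have e : iteratedDeriv l f =ᶠ[𝓝 a] fun z => (z - a) ^ (n - l) * g z := hfg
    have e2 := e.deriv
    rcases Nat.eq_zero_or_pos (n - l) with h0 | h0
    · refine ⟨deriv g, hg.deriv, ?_⟩
      filter_upwards [e2] with z hz
      rw [hz, h0, show n - (l + 1) = 0 by omega]
      simp
    · obtain ⟨m, hm⟩ : ∃ m, n - l = m + 1 := ⟨n - l - 1, by omega⟩
      have hm2 : n - (l + 1) = m := by omega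
      refine ⟨fun z => (m + 1) * g z + (z - a) * deriv g z, ?_, ?_⟩
      · have := hg.deriv
        fun_prop
      · filter_upwards [e2, hg.eventually_analyticAt] with z hz hgz
        rw [hz, hm, hm2]
        have hd : HasDerivAt (fun z => (z - a) ^ (m + 1) * g z)
            (((m + 1 : ℕ) : ℂ) * (z - a) ^ m * 1 * g z + (z - a) ^ (m + 1) * deriv g z) z := by
          apply HasDerivAt.mul
          · simpa using ((hasDerivAt_id z).sub_const a).fun_pow (m + 1)
          · exact hgz.differentiableAt.hasDerivAt
        rw [hd.deriv]
        push_cast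
        ring

theorem wr_order {k : ℕ} (F : Fin k → ℂ → ℂ) (a : ℂ) (hF : ∀ i, AnalyticAt ℂ (F i) a) (μ : ℕ)
    (d : Fin k → ℕ) (h : ∀ i, ((μ + d i : ℕ) : ℕ∞) ≤ analyticOrderAt (F i) a) :
    ((k * μ + ∑ i, (d i - (k - 1)) : ℕ) : ℕ∞) ≤ analyticOrderAt (Wr F) a := by
  rw [natCast_le_analyticOrderAt (wr_analyticAt hF)]
  choose g hg hfg using fun i => (natCast_le_analyticOrderAt (hF i)).1 (h i)
  set F' : Fin k → ℂ → ℂ := fun i z => (z - a) ^ (d i) * g i z with hF'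
  have hF'a : ∀ i z, AnalyticAt ℂ (g i) z → AnalyticAt ℂ (F' i) z := by
    intro i z hz
    simp only [hF']
    fun_prop
  have key : ∀ i (l : Fin k), ∃ q, AnalyticAt ℂ q a ∧
      ∀ᶠ z in 𝓝 a, iteratedDeriv (l:ℕ) (F' i) z = (z - a) ^ (d i - (k - 1)) * q z := by
    intro i l
    obtain ⟨q, hq, hq2⟩ := iter_factor (F' i) a (d i) l ⟨g i, hg i, Eventually.of_forall fun z => rfl⟩
    refine ⟨fun z => (z - a) ^ ((d i - l) - (d i - (k - 1))) * q z, by fun_prop, ?_⟩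
    filter_upwards [hq2] with z hz
    rw [hz, ← mul_assoc, ← pow_add]
    congr 2
    have := l.2
    omega
  choose q hq hqe using key
  refine ⟨fun z => Matrix.det (Matrix.of fun i l => q i l z), analyticAt_det hq, ?_⟩
  have e1 : ∀ᶠ z in 𝓝 a, ∀ i, F i =ᶠ[𝓝 z] (F' i * fun z => (z - a) ^ μ) := by
    rw [eventually_all]
    intro i
    filter_upwards [(hfg i).eventually_nhds] with z hz
    filter_upwards [hz] with w hw
    rw [hw, Pi.mul_apply]
    simp only [hF', smul_eq_mul, pow_add]; ring
  have e2 : ∀ᶠ z in 𝓝 a, ∀ i, AnalyticAt ℂ (g i) z := by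
    rw [eventually_all]; exact fun i => (hg i).eventually_analyticAt
  have e3 : ∀ᶠ z in 𝓝 a, ∀ i (l : Fin k), iteratedDeriv (l:ℕ) (F' i) z =
      (z - a) ^ (d i - (k - 1)) * q i l z := by
    rw [eventually_all]; intro i; rw [eventually_all]; exact hqe i
  filter_upwards [e1, e2, e3] with z h1 h2 h3
  rw [wr_congr h1, wr_mul (by fun_prop) (fun i => hF'a i z (h2 i))]
  have : Wr F' z = (z - a) ^ (∑ i, (d i - (k - 1))) * Matrix.det (Matrix.of fun i l => q i l z) := by
    unfold Wr
    rw [← Finset.prod_pow_eq_pow_sum]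
    rw [← Matrix.det_mul_column]
    congr 1
    ext i l
    simp [h3]
  rw [this, smul_eq_mul, pow_add, pow_mul', mul_assoc]

theorem wr_indep_local (k : ℕ) : ∀ (F : Fin k → ℂ → ℂ) (U : Set ℂ), IsOpen U → U.Nonempty →
    (∀ i, DifferentiableOn ℂ (F i) U) → (∀ z ∈ U, Wr F z = 0) →
    ∃ V ⊆ U, IsOpen V ∧ V.Nonempty ∧ ∃ c : Fin k → ℂ, c ≠ 0 ∧ ∀ z ∈ V, ∑ i, c i * F i z = 0 := by
  induction k with
  | zero =>
    intro F U _ ⟨z, hz⟩ _ h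
    have := h z hz
    simp [Wr] at this
  | succ k ih =>
    intro F U hU hne hd hW
    by_cases h0 : ∀ z ∈ U, F 0 z = 0
    · refine ⟨U, subset_rfl, hU, hne, Pi.single 0 1, by simp, fun z hz => ?_⟩
      rw [Finset.sum_eq_single 0]
      · simp [h0 z hz]
      · intro b _ hb; simp [hb]
      · simp
    push Not at h0
    obtain ⟨z0, hz0, hF0⟩ := h0
    have hc : ∀ᶠ z in 𝓝 z0, F 0 z ≠ 0 :=
      ((hd 0).continuousOn.continuousAt (hU.mem_nhds hz0)).eventually_ne hF0
    obtain ⟨ε, hε, hball⟩ := Metric.eventually_nhds_iff_ball.1 (hc.and (hU.mem_nhds hz0))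
    have han : ∀ i, ∀ z ∈ ball z0 ε, AnalyticAt ℂ (F i) z := fun i z hz =>
      (hd i).analyticAt (hU.mem_nhds (hball z hz).2)
    set ψ : Fin (k+1) → ℂ → ℂ := fun i z => F i z / F 0 z with hψ
    have hψa : ∀ i, ∀ z ∈ ball z0 ε, AnalyticAt ℂ (ψ i) z := fun i z hz =>
      (han i z hz).div (han 0 z hz) (hball z hz).1
    have hFψ : ∀ z ∈ ball z0 ε, ∀ i, F i =ᶠ[𝓝 z] (ψ i * F 0) := by
      intro z hz i
      filter_upwards [isOpen_ball.mem_nhds hz] with w hw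
      simp only [hψ, Pi.mul_apply]
      rw [div_mul_cancel₀ _ (hball w hw).1]
    have hWψ : ∀ z ∈ ball z0 ε, Wr ψ z = 0 := by
      intro z hz
      have := hW z (hball z hz).2
      rw [wr_congr (hFψ z hz), wr_mul (han 0 z hz) (fun i => hψa i z hz)] at this
      rcases mul_eq_zero.1 this with h | h
      · exact absurd h (pow_ne_zero _ (hball z hz).1)
      · exact h
    have hψ0 : ∀ z ∈ ball z0 ε, ψ 0 =ᶠ[𝓝 z] fun _ => 1 := by
      intro z hz
      filter_upwards [isOpen_ball.mem_nhds hz] with w hw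
      exact div_self (hball w hw).1
    have hW' : ∀ z ∈ ball z0 ε, Wr (fun i => deriv (ψ (Fin.succ i))) z = 0 := by
      intro z hz
      rw [← hWψ z hz]
      unfold Wr
      rw [Matrix.det_succ_row_zero, Finset.sum_eq_single 0]
      · simp only [Matrix.of_apply, Fin.val_zero, pow_zero, one_mul]
        rw [(hψ0 z hz).iteratedDeriv_eq]
        simp only [iteratedDeriv_zero, one_mul]
        congr 1
        ext i l
        rw [Matrix.submatrix_apply, Matrix.of_apply, Matrix.of_apply, Fin.succAbove_zero, Fin.val_succ,
          iteratedDeriv_succ']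
      · intro b _ hb
        rw [Matrix.of_apply, (hψ0 z hz).iteratedDeriv_eq, iteratedDeriv_const,
          if_neg (show ¬ ((b : ℕ) = 0) from fun h => hb (Fin.ext h)), mul_zero, zero_mul]
      · simp
    obtain ⟨V, hV, hVo, ⟨v, hv⟩, c, hcne, hcs⟩ := ih _ (ball z0 ε) isOpen_ball ⟨z0, mem_ball_self hε⟩
      (fun i z hz => (hψa _ z hz).deriv.differentiableAt.differentiableWithinAt) hW'
    obtain ⟨δ, hδ, hVb⟩ := Metric.isOpen_iff.1 hVo v hv
    set S : ℂ → ℂ := fun z => ∑ i, c i * ψ (Fin.succ i) z with hS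
    have hSd : ∀ z ∈ ball v δ, HasDerivAt S 0 z := by
      intro z hz
      have hzV := hVb hz
      rw [← hcs z hzV]
      apply HasDerivAt.fun_sum
      intro i _
      exact ((hψa _ z (hV hzV)).differentiableAt.hasDerivAt).const_mul _
    have hSc : ∀ z ∈ ball v δ, S z = S v := by
      intro z hz
      refine (convex_ball v δ).is_const_of_fderivWithin_eq_zero (𝕜 := ℂ) (f := S)
        (fun w hw => (hSd w hw).differentiableAt.differentiableWithinAt) ?_ hz (mem_ball_self hδ)
      intro w hw
      rw [fderivWithin_of_isOpen isOpen_ball hw]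
      ext
      simp [(hSd w hw).deriv]
    refine ⟨ball v δ, fun z hz => (hball z (hV (hVb hz))).2, isOpen_ball, ⟨v, mem_ball_self hδ⟩,
      Fin.cons (-S v) c, ?_, ?_⟩
    · intro h
      apply hcne
      ext i
      have := congrFun h (Fin.succ i)
      simpa using this
    · intro z hz
      have hzb := hball z (hV (hVb hz))
      rw [Fin.sum_univ_succ]
      simp only [Fin.cons_zero, Fin.cons_succ]
      have : ∀ i : Fin k, c i * F (Fin.succ i) z = (c i * ψ (Fin.succ i) z) * F 0 z := by
        intro i
        simp only [hψ]
        rw [mul_assoc, div_mul_cancel₀ _ hzb.1]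
      rw [Finset.sum_congr rfl fun i _ => this i, ← Finset.sum_mul]
      have h2 := hSc z hz
      simp only [hS] at h2 ⊢
      rw [h2]; ring

theorem wr_indep {k : ℕ} (F : Fin k → ℂ → ℂ) (hF : ∀ i, Differentiable ℂ (F i))
    (hl : LinearIndependent ℂ F) : ∃ z, Wr F z ≠ 0 := by
  by_contra hcon
  push Not at hcon
  obtain ⟨V, _, hVo, ⟨v, hv⟩, c, hc, hs⟩ := wr_indep_local k F univ isOpen_univ univ_nonempty
    (fun i => (hF i).differentiableOn) (fun z _ => hcon z)
  apply hc
  have hsum : (fun z => ∑ i, c i * F i z) = fun _ => 0 := by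
    have hd : Differentiable ℂ (fun z => ∑ i, c i * F i z) := by fun_prop
    apply AnalyticOnNhd.eq_of_eventuallyEq (𝕜 := ℂ) (z₀ := v) (fun z _ => hd.analyticAt z)
      (fun z _ => analyticAt_const)
    filter_upwards [hVo.mem_nhds hv] with z hz using hs z hz
  rw [Fintype.linearIndependent_iff] at hl
  ext i
  apply hl c
  ext z
  simpa using congrFun hsum z

end FW
end

section
open Real
namespace FW

lemma iter_growth (T : ℝ → ℝ) (C : ℝ) (hC : 0 < C)
    (hb : ∀ R, ∃ M, ∀ r, 1 ≤ r → r ≤ R → T r ≤ M)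
    (h : ∀ r R, 1 ≤ r → r < R → T r ≤ C * (1 + log (1 + max (T R) 0) + log (R / (R - r)))) :
    ∀ r, 1 ≤ r → T r ≤ C * (2 * log (r + 2) + 10 * C + 4) := by
  intro r hr
  by_contra hcon
  push Not at hcon
  set L := log (r + 2) with hL
  have hL0 : 0 ≤ L := Real.log_nonneg (by linarith)
  set rr : ℕ → ℝ := fun j => r + 2 - 2 * (1/2)^j with hrr
  have hp : ∀ j : ℕ, (0:ℝ) < (1/2)^j := fun j => by positivity
  have hp1 : ∀ j : ℕ, ((1:ℝ)/2)^j ≤ 1 := fun j => pow_le_one₀ (by norm_num) (by norm_num)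
  have hge : ∀ j, r ≤ rr j := fun j => by simp only [hrr]; linarith [hp1 j]
  have hle : ∀ j, rr j ≤ r + 2 := fun j => by simp only [hrr]; linarith [hp j]
  have hdiff : ∀ j, rr (j+1) - rr j = (1/2)^j := fun j => by simp only [hrr]; ring
  have key : ∀ j : ℕ, C * (1 + L + j + (10 * C + 2 + L + j)) ≤ T (rr j) := by
    intro j
    induction j with
    | zero =>
      have : rr 0 = r := by simp [hrr]
      rw [this]
      refine le_trans ?_ hcon.le
      apply mul_le_mul_of_nonneg_left _ hC.le
      push_cast; linarith
    | succ j ih =>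
      have h1 := h (rr j) (rr (j+1)) (hr.trans (hge j)) (by linarith [hdiff j, hp j])
      have h2 := ih.trans h1
      have h3 := le_of_mul_le_mul_left h2 hC
      have hlog : log (rr (j+1) / (rr (j+1) - rr j)) ≤ L + j := by
        rw [hdiff, Real.log_div (by linarith [hge (j+1)]) (hp j).ne', Real.log_pow, one_div,
          Real.log_inv]
        have a1 : log (rr (j+1)) ≤ L := Real.log_le_log (by linarith [hge (j+1)]) (hle _)
        have a2 : log 2 ≤ 1 := by linarith [Real.log_two_lt_d9]
        have a3 : (j:ℝ) * log 2 ≤ j * 1 := mul_le_mul_of_nonneg_left a2 (Nat.cast_nonneg j)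
        linarith
      set y := 10 * C + 2 + L + j with hy
      have hj : (0:ℝ) ≤ j := Nat.cast_nonneg j
      have hylog : y ≤ log (1 + max (T (rr (j+1))) 0) := by linarith
      have hu : 0 < 1 + max (T (rr (j+1))) 0 := by
        have := le_max_right (T (rr (j+1))) 0; linarith
      have hexp := (Real.le_log_iff_exp_le hu).1 hylog
      have hq := Real.quadratic_le_exp_of_nonneg (by linarith : 0 ≤ y)
      have hm : y + y ^ 2 / 2 ≤ max (T (rr (j+1))) 0 := by linarith
      have hy2 : 10 * C + 2 ≤ y := by linarith
      have hpos : 0 < y + y ^ 2 / 2 := by nlinarith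
      have hmax : max (T (rr (j+1))) 0 = T (rr (j+1)) := by
        rcases max_choice (T (rr (j+1))) 0 with h | h
        · exact h
        · rw [h] at hm; linarith
      rw [hmax] at hm
      refine le_trans ?_ hm
      push_cast
      have : C * (1 + L + (j + 1) + (10 * C + 2 + L + (j + 1))) ≤ C * (3 + 2 * y) := by
        apply mul_le_mul_of_nonneg_left _ hC.le
        linarith
      nlinarith
  obtain ⟨M, hM⟩ := hb (r + 2)
  obtain ⟨j, hj⟩ := exists_nat_gt (M / C)
  have h1 := hM (rr j) (hr.trans (hge j)) (hle j)
  have h2 := key j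
  rw [div_lt_iff₀ hC] at hj
  have : C * (j:ℝ) ≤ C * (1 + L + j + (10 * C + 2 + L + j)) := by
    apply mul_le_mul_of_nonneg_left _ hC.le
    have : (0:ℝ) ≤ j := Nat.cast_nonneg j
    linarith
  linarith

end FW
end

section
open Real Metric Set Filter Topology MeasureTheory
namespace FW
open ValueDistribution Function.locallyFinsuppWithin

noncomputable abbrev dv (f : ℂ → ℂ) : Function.locallyFinsuppWithin (univ : Set ℂ) ℤ :=
  MeromorphicOn.divisor f univ

noncomputable abbrev tc (f : ℂ → ℂ) : ℝ := log ‖meromorphicTrailingCoeffAt f 0‖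

lemma ent_mer {f : ℂ → ℂ} (hf : Differentiable ℂ f) : Meromorphic f :=
  fun z => (hf.analyticAt z).meromorphicAt

lemma ent_order {f : ℂ → ℂ} (hf : Differentiable ℂ f) (h : ∃ z, f z ≠ 0) (z : ℂ) :
    analyticOrderAt f z ≠ ⊤ := by
  obtain ⟨w, hw⟩ := h
  intro hz
  rw [analyticOrderAt_eq_top] at hz
  apply hw
  have : f = fun _ => 0 := AnalyticOnNhd.eq_of_eventuallyEq (𝕜 := ℂ) (z₀ := z)
    (fun z _ => hf.analyticAt z) (fun z _ => analyticAt_const) hz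
  rw [this]

lemma ent_mord {f : ℂ → ℂ} (hf : Differentiable ℂ f) (h : ∃ z, f z ≠ 0) (z : ℂ) :
    meromorphicOrderAt f z = ((analyticOrderNatAt f z : ℤ) : WithTop ℤ) := by
  rw [(hf.analyticAt z).meromorphicOrderAt_eq, ← Nat.cast_analyticOrderNatAt (ent_order hf h z)]
  simp

lemma dv_apply {f : ℂ → ℂ} (hf : Differentiable ℂ f) (h : ∃ z, f z ≠ 0) (z : ℂ) :
    dv f z = (analyticOrderNatAt f z : ℤ) := by
  rw [MeromorphicOn.divisor_apply (fun x _ => ent_mer hf x) (mem_univ _), ent_mord hf h]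
  simp

lemma jensen {f : ℂ → ℂ} (hf : Differentiable ℂ f) {r : ℝ} (hr : 1 ≤ r) :
    circleAverage (fun z => log ‖f z‖) 0 r = logCounting (dv f) r + tc f := by
  rw [logCounting_divisor_eq_circleAverage_sub_const (ent_mer hf) (by linarith)]
  ring

lemma ev_ne {f : ℂ → ℂ} (hf : Differentiable ℂ f) (h : ∃ z, f z ≠ 0) (r : ℝ) :
    ∀ᶠ z in codiscreteWithin (sphere (0:ℂ) |r|), f z ≠ 0 := by
  obtain ⟨w, hw⟩ := h
  have := AnalyticOnNhd.preimage_zero_mem_codiscrete (fun z _ => hf.analyticAt z) hw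
  exact Filter.codiscreteWithin_mono (subset_univ _) this

lemma ci_log {f : ℂ → ℂ} (hf : Differentiable ℂ f) (r : ℝ) :
    CircleIntegrable (fun z => log ‖f z‖) 0 r :=
  MeromorphicOn.circleIntegrable_log_norm fun x _ => ent_mer hf x

lemma CircleIntegrable.sup' {f g : ℂ → ℝ} {c : ℂ} {r : ℝ} (hf : CircleIntegrable f c r)
    (hg : CircleIntegrable g c r) : CircleIntegrable (f ⊔ g) c r :=
  ⟨hf.1.sup hg.1, hf.2.sup hg.2⟩

section
variable {k : ℕ} (G : Fin (k+1) → ℂ → ℂ)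

noncomputable def mx (z : ℂ) : ℝ :=
  Finset.univ.sup' Finset.univ_nonempty (fun i : Fin (k+1) => log ‖G i z‖)

noncomputable def mu : Function.locallyFinsuppWithin (univ : Set ℂ) ℤ :=
  Finset.univ.inf' Finset.univ_nonempty (fun i : Fin (k+1) => dv (G i))

noncomputable def TC (r : ℝ) : ℝ := circleAverage (mx G) 0 r - logCounting (mu G) r

variable {G}

lemma le_mx (z : ℂ) (i : Fin (k+1)) : log ‖G i z‖ ≤ mx G z :=
  Finset.le_sup' (fun i : Fin (k+1) => log ‖G i z‖) (Finset.mem_univ i)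

lemma mx_eq (z : ℂ) : ∃ i, mx G z = log ‖G i z‖ := by
  obtain ⟨i, _, hi⟩ := Finset.exists_mem_eq_sup' (Finset.univ_nonempty)
    (fun i : Fin (k+1) => log ‖G i z‖)
  exact ⟨i, hi⟩

lemma mu_le (i : Fin (k+1)) : mu G ≤ dv (G i) :=
  Finset.inf'_le (fun i : Fin (k+1) => dv (G i)) (Finset.mem_univ i)

lemma mu_eq (z : ℂ) : ∃ i, mu G z = dv (G i) z := by
  have h : ∀ (s : Finset (Fin (k+1))) (hs : s.Nonempty),
      ∃ i, (s.inf' hs (fun i : Fin (k+1) => dv (G i))) z = dv (G i) z := by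
    intro s hs
    refine Finset.inf'_induction hs (fun i : Fin (k+1) => dv (G i))
      (p := fun D => ∃ i, D z = dv (G i) z) ?_ (fun i _ => ⟨i, rfl⟩)
    rintro a ⟨i, hi⟩ b ⟨j, hj⟩
    have : (a ⊓ b) z = min (a z) (b z) := rfl
    rcases min_choice (a z) (b z) with h | h
    · exact ⟨i, by rw [this, h, hi]⟩
    · exact ⟨j, by rw [this, h, hj]⟩
  exact h _ _

lemma ci_mx (hG : ∀ i, Differentiable ℂ (G i)) (r : ℝ) : CircleIntegrable (mx G) 0 r := by
  have : mx G = Finset.univ.sup' Finset.univ_nonempty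
      (fun (i : Fin (k+1)) (z : ℂ) => log ‖G i z‖) := by
    ext z
    rw [Finset.sup'_apply]
    rfl
  rw [this]
  refine Finset.sup'_induction (p := fun f => CircleIntegrable f 0 r) _ _ ?_ ?_
  · intro a ha b hb
    exact CircleIntegrable.sup' ha hb
  · intro i _
    exact ci_log (hG i) r

lemma mu_nonneg (hG : ∀ i, Differentiable ℂ (G i)) (hne : ∀ i, ∃ z, G i z ≠ 0) : 0 ≤ mu G := by
  intro z
  obtain ⟨i, hi⟩ := mu_eq (G := G) z
  rw [hi, dv_apply (hG i) (hne i)]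
  simp

lemma TC_bdd (hG : ∀ i, Differentiable ℂ (G i)) (hne : ∀ i, ∃ z, G i z ≠ 0) (R : ℝ) : ∃ M, ∀ r, 1 ≤ r → r ≤ R → TC G r ≤ M := by
  have hc : ContinuousOn (fun z => ∑ i, ‖G i z‖) (closedBall (0:ℂ) R) := by
    apply Continuous.continuousOn
    exact continuous_finset_sum _ fun i _ => (hG i).continuous.norm
  obtain ⟨M, hM⟩ := (isCompact_closedBall (0:ℂ) R).bddAbove_image hc
  refine ⟨M, fun r hr hrR => ?_⟩
  have h1 : 0 ≤ logCounting (mu G) r := logCounting_nonneg (mu_nonneg hG hne) hr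
  have h2 : circleAverage (mx G) 0 r ≤ M := by
    apply circleAverage_mono_on_of_le_circle (ci_mx hG r)
    intro z hz
    obtain ⟨i, hi⟩ := mx_eq (G := G) z
    rw [hi]
    have hz' : z ∈ closedBall (0:ℂ) R := by
      have h3 : ‖z‖ = |r| := by simpa using hz
      rw [abs_of_nonneg (by linarith)] at h3
      simp; linarith
    refine le_trans (Real.log_le_self (norm_nonneg _)) (le_trans ?_ (hM ⟨z, hz', rfl⟩))
    exact Finset.single_le_sum (f := fun i => ‖G i z‖) (fun i _ => norm_nonneg _) (Finset.mem_univ i)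
  unfold TC
  linarith

lemma char_le (hG : ∀ i, Differentiable ℂ (G i)) (hne : ∀ i, ∃ z, G i z ≠ 0) (i : Fin (k+1)) {r : ℝ} (hr : 1 ≤ r) :
    characteristic (fun z => G i z / G 0 z) ⊤ r ≤ TC G r - tc (G 0) := by
  have hm0 := ent_mer (hG 0)
  have hmi := ent_mer (hG i)
  have hφ : Meromorphic (fun z => G i z / G 0 z) := fun z => (hmi z).fun_div (hm0 z)
  have hP : proximity (fun z => G i z / G 0 z) ⊤ r ≤ circleAverage (mx G) 0 r -
      circleAverage (fun z => log ‖G 0 z‖) 0 r := by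
    rw [proximity_top]
    have e : circleAverage (mx G) 0 r - circleAverage (fun z => log ‖G 0 z‖) 0 r =
        circleAverage (mx G - fun z => log ‖G 0 z‖) 0 r :=
      (circleAverage_sub (ci_mx hG r) (ci_log (hG 0) r)).symm
    rw [e]
    apply circleAverage_mono_cod (by linarith)
      (MeromorphicOn.circleIntegrable_posLog_norm fun x _ => hφ x)
      ((ci_mx hG r).sub (ci_log (hG 0) r))
    filter_upwards [ev_ne (hG 0) (hne 0) r, ev_ne (hG i) (hne i) r] with z h0 hi
    show log⁺ ‖G i z / G 0 z‖ ≤ mx G z - log ‖G 0 z‖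
    rw [posLog, norm_div, Real.log_div (norm_ne_zero_iff.2 hi) (norm_ne_zero_iff.2 h0)]
    apply max_le
    · linarith [le_mx (G := G) z 0]
    · linarith [le_mx (G := G) z i]
  have hN : ValueDistribution.logCounting (fun z => G i z / G 0 z) ⊤ r ≤
      logCounting (dv (G 0)) r - logCounting (mu G) r := by
    rw [ValueDistribution.logCounting_top]
    have : logCounting (dv (G 0)) r - logCounting (mu G) r =
      logCounting (dv (G 0) - mu G) r := by rw [map_sub]; rfl
    rw [this]
    apply logCounting_le _ hr
    intro z
    rw [negPart_apply]
    have e1 : dv (fun z => G i z / G 0 z) z = dv (G i) z - dv (G 0) z := by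
      rw [dv_apply (hG i) (hne i), dv_apply (hG 0) (hne 0),
        MeromorphicOn.divisor_apply (fun x _ => hφ x) (mem_univ _)]
      have : meromorphicOrderAt (fun z => G i z / G 0 z) z =
          meromorphicOrderAt (G i) z + meromorphicOrderAt (G 0)⁻¹ z := by
        rw [← meromorphicOrderAt_mul (hmi z) (hm0 z).inv]
        congr 1
      rw [this, meromorphicOrderAt_inv, ent_mord (hG i) (hne i), ent_mord (hG 0) (hne 0)]
      rfl
    show (dv (fun z => G i z / G 0 z) z)⁻ ≤ (dv (G 0) - mu G) z
    rw [e1, coe_sub, Pi.sub_apply]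
    have h1 := mu_le (G := G) i z
    have h2 := mu_le (G := G) 0 z
    rw [negPart_def]
    apply max_le
    · linarith
    · linarith
  have := jensen (hG 0) hr
  show proximity (fun z => G i z / G 0 z) ⊤ r +
    ValueDistribution.logCounting (fun z => G i z / G 0 z) ⊤ r ≤ _
  unfold TC
  linarith

end
end FW
end

section
open Real Metric Set Filter Topology MeasureTheory
namespace FW
open ValueDistribution Function.locallyFinsuppWithin

lemma wr_sign {k : ℕ} {G : Fin (k+1) → ℂ → ℂ} (hG : ∀ i, Differentiable ℂ (G i))
    (hs : ∀ z, ∑ i, G i z = 0) (m : Fin (k+1)) :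
    ∃ ε : ℂ, ‖ε‖ = 1 ∧ ∀ z, Wr (fun i => G i.succ) z = ε * Wr (fun i => G (m.succAbove i)) z := by
  have key : ∀ z, Wr (fun i => G i.succ) z =
      ((Int.negOnePow (((0 : Fin (k+1)) : ℤ) - m) : ℤ) : ℂ) * Wr (fun i => G (m.succAbove i)) z := by
    intro z
    have := Matrix.submatrix_succAbove_det_eq_negOnePow_submatrix_succAbove_det
      (Matrix.of fun (i : Fin (k+1)) (l : Fin k) => iteratedDeriv (l:ℕ) (G i) z) ?_ 0 m
    · rw [Units.smul_def, zsmul_eq_mul] at this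
      have hz : (fun i : Fin k => G i.succ) = fun i => G ((0 : Fin (k+1)).succAbove i) := by simp
      rw [hz]
      exact this
    · change (∑ j, fun l : Fin k => iteratedDeriv (l:ℕ) (G j) z) = 0
      ext l
      rw [Finset.sum_apply]
      simp only [Pi.zero_apply]
      have h0 : (fun z => ∑ i, G i z) = fun _ => (0:ℂ) := funext hs
      have := iteratedDeriv_fun_sum (n := (l:ℕ)) (x := z) (I := (Finset.univ : Finset (Fin (k+1)))) (f := G)
        (fun i _ => ((hG i).contDiff (n := (l:ℕ))).contDiffAt)
      rw [← this, h0]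
      simp [iteratedDeriv_const]
  refine ⟨_, ?_, key⟩
  rcases Int.units_eq_one_or (Int.negOnePow (((0 : Fin (k+1)) : ℤ) - m)) with h | h <;> rw [h] <;> simp

lemma det_bound {k : ℕ} (A : Matrix (Fin k) (Fin k) ℂ) (b : Fin k → ℝ)
    (h : ∀ i l, ‖A i l‖ ≤ b i) : ‖A.det‖ ≤ k.factorial * ∏ i, b i := by
  rw [← Matrix.det_transpose, Matrix.det_apply]
  refine (norm_sum_le _ _).trans ?_
  have : ∀ σ ∈ (Finset.univ : Finset (Equiv.Perm (Fin k))),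
      ‖Equiv.Perm.sign σ • ∏ i, A.transpose (σ i) i‖ ≤ ∏ i, b i := by
    intro σ _
    have e : ‖Equiv.Perm.sign σ • ∏ i, A.transpose (σ i) i‖ = ∏ i, ‖A i (σ i)‖ := by
      rcases Int.units_eq_one_or (Equiv.Perm.sign σ) with h | h <;> rw [h] <;> simp
    rw [e]
    exact Finset.prod_le_prod (fun i _ => norm_nonneg _) (fun i _ => h _ _)
  refine (Finset.sum_le_card_nsmul _ _ _ this).trans ?_
  simp [Fintype.card_perm]

lemma pt_bound {k : ℕ} {G : Fin (k+1) → ℂ → ℂ} (hG : ∀ i, Differentiable ℂ (G i))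
    (hs : ∀ z, ∑ i, G i z = 0) (z : ℂ) (hz : ∀ i, G i z ≠ 0)
    (hW : Wr (fun i => G i.succ) z ≠ 0) (X : Fin (k+1) → ℝ) (hX : ∀ i, 1 ≤ X i)
    (h : ∀ i (l : ℕ), ‖iteratedDeriv l (fun z => G i z / G 0 z) z‖
      ≤ l.factorial * exp 2 * 2 ^ l * X i ^ (2 * l) * ‖G i z / G 0 z‖) :
    log ‖Wr (fun i => G i.succ) z‖ + mx G z ≤
      log (k.factorial * (k.factorial * exp 2 * 2 ^ k) ^ k) + ∑ i, 2 * k * log (X i)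
        + ∑ i, log ‖G i z‖ := by
  set K : ℝ := k.factorial * exp 2 * 2 ^ k with hK
  have hKpos : 0 < K := by positivity
  obtain ⟨m, hm⟩ := mx_eq (G := G) z
  obtain ⟨ε, hε, hw⟩ := wr_sign hG hs m
  have h0 := norm_pos_iff.2 (hz 0)
  have e1 : Wr (fun i => G (m.succAbove i)) z =
      (G 0 z) ^ k * Wr (fun i z => G (m.succAbove i) z / G 0 z) z := by
    rw [← wr_mul ((hG 0).analyticAt z)]
    · apply wr_congr
      intro i
      filter_upwards [(hG 0).continuous.continuousAt.eventually_ne (hz 0)] with w hw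
      show G (m.succAbove i) w = G (m.succAbove i) w / G 0 w * G 0 w
      field_simp
    · intro i
      exact ((hG _).analyticAt z).fun_div ((hG 0).analyticAt z) (hz 0)
  have e2 : ‖Wr (fun i z => G (m.succAbove i) z / G 0 z) z‖ ≤ k.factorial *
      ∏ i, (K * X (m.succAbove i) ^ (2 * k) * ‖G (m.succAbove i) z / G 0 z‖) := by
    apply det_bound
    intro i l
    refine (h (m.succAbove i) l).trans ?_
    have h1 : ((l:ℕ).factorial : ℝ) ≤ k.factorial := by
      exact_mod_cast Nat.factorial_le l.2.le
    have h2 : (2:ℝ) ^ (l:ℕ) ≤ 2 ^ k := pow_le_pow_right₀ (by norm_num) l.2.le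
    have h3 : X (m.succAbove i) ^ (2 * (l:ℕ)) ≤ X (m.succAbove i) ^ (2 * k) :=
      pow_le_pow_right₀ (hX _) (by have := l.2; omega)
    have := hX (m.succAbove i)
    rw [hK]
    gcongr
  have e3 : ∏ i, (K * X (m.succAbove i) ^ (2 * k) * ‖G (m.succAbove i) z / G 0 z‖) * ‖G 0 z‖ =
      ∏ i, (K * X (m.succAbove i) ^ (2 * k) * ‖G (m.succAbove i) z‖) := by
    apply Finset.prod_congr rfl
    intro i _
    rw [norm_div]
    field_simp
  have e4 : ‖Wr (fun i => G i.succ) z‖ ≤ k.factorial * (K ^ k *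
      ∏ i, (X (m.succAbove i) ^ (2 * k) * ‖G (m.succAbove i) z‖)) := by
    rw [hw, norm_mul, hε, one_mul, e1, norm_mul, norm_pow]
    calc _ ≤ ‖G 0 z‖ ^ k * (k.factorial *
      ∏ i, (K * X (m.succAbove i) ^ (2 * k) * ‖G (m.succAbove i) z / G 0 z‖)) := by gcongr
      _ = k.factorial * ∏ i, (K * X (m.succAbove i) ^ (2 * k) * ‖G (m.succAbove i) z / G 0 z‖) * ‖G 0 z‖ := by
        rw [Finset.prod_mul_distrib (g := fun _ => ‖G 0 z‖)]; simp; ring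
      _ = _ := by
        rw [e3]
        simp only [mul_assoc]
        rw [Finset.prod_mul_distrib (f := fun _ => K)]; simp
  have hXp : ∀ i, 0 < X i := fun i => lt_of_lt_of_le one_pos (hX i)
  have hGp : ∀ i, 0 < ‖G i z‖ := fun i => norm_pos_iff.2 (hz i)
  have e5 := Real.log_le_log (norm_pos_iff.2 hW) e4
  rw [← mul_assoc, Real.log_mul (by positivity)
    (Finset.prod_ne_zero_iff.2 fun i _ => (mul_pos (pow_pos (hXp _) _) (hGp _)).ne'),
    Real.log_prod (fun i _ => (mul_pos (pow_pos (hXp _) _) (hGp _)).ne')] at e5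
  have e6 : ∀ i : Fin k, log (X (m.succAbove i) ^ (2 * k) * ‖G (m.succAbove i) z‖) =
      2 * k * log (X (m.succAbove i)) + log ‖G (m.succAbove i) z‖ := by
    intro i
    rw [Real.log_mul (pow_pos (hXp _) _).ne' (hGp _).ne', Real.log_pow]
    push_cast; ring
  simp only [e6, Finset.sum_add_distrib] at e5
  rw [Fin.sum_univ_succAbove _ m, Fin.sum_univ_succAbove (fun i => log ‖G i z‖) m, hm]
  have : 0 ≤ 2 * k * log (X m) := by
    have := Real.log_nonneg (hX m); positivity
  linarith

lemma div_bound {k p : ℕ} (hp : k ≤ p) {g : Fin (k+1) → ℂ → ℂ} (hg : ∀ i, Differentiable ℂ (g i))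
    (hne : ∀ i, ∃ z, (g i ^ p) z ≠ 0)
    (hs : ∀ z, ∑ i, (g i ^ p) z = 0) (hW : ∃ z, Wr (fun i : Fin k => g i.succ ^ p) z ≠ 0) (hk : 1 ≤ k) (z : ℂ) :
    p * (∑ i, dv (g i ^ p) z - dv (Wr (fun i : Fin k => g i.succ ^ p)) z - mu (fun i => g i ^ p) z) ≤
      (k - 1) * ∑ i, (dv (g i ^ p) z - mu (fun i => g i ^ p) z) := by
  have hG : ∀ i, Differentiable ℂ (g i ^ p) := fun i => (hg i).pow p
  obtain ⟨m, hm⟩ := mu_eq (G := fun i => g i ^ p) z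
  obtain ⟨ε, hε, hw⟩ := wr_sign hG hs m
  have hWd : Differentiable ℂ (Wr (fun i : Fin k => g i.succ ^ p)) := fun z =>
    (wr_analyticAt (fun i => (hG _).analyticAt z)).differentiableAt
  have hmle : ∀ i, mu (fun i => g i ^ p) z ≤ dv (g i ^ p) z := fun i => mu_le (G := fun i => g i ^ p) i z
  rw [dv_apply hWd hW]
  simp only [fun i => dv_apply (hG i) (hne i) z, hm] at hmle ⊢
  set o : Fin (k+1) → ℕ := fun i => analyticOrderNatAt (g i ^ p) z with ho
  have hop : ∀ i, o i = p * analyticOrderNatAt (g i) z := by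
    intro i
    rw [ho]
    simp only
    rw [analyticOrderNatAt_pow ((hg i).analyticAt z), smul_eq_mul]
  have hcast : ∀ i, analyticOrderAt (g i ^ p) z = (o i : ℕ∞) := fun i =>
    (Nat.cast_analyticOrderNatAt (ent_order (hG i) (hne i) z)).symm
  have hle : ∀ i, o m ≤ o i := fun i => by exact_mod_cast hmle i
  have h1 := wr_order (fun i : Fin k => g (m.succAbove i) ^ p) z (fun i => (hG _).analyticAt z)
    (o m) (fun i => o (m.succAbove i) - o m) (fun i => by
      rw [hcast]; exact_mod_cast (by have := hle (m.succAbove i); omega))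
  have h2 : analyticOrderAt (Wr (fun i : Fin k => g (m.succAbove i) ^ p)) z ≤
      analyticOrderAt (Wr (fun i : Fin k => g i.succ ^ p)) z := by
    have : Wr (fun i : Fin k => g i.succ ^ p) = (fun _ => ε) * Wr (fun i => g (m.succAbove i) ^ p) :=
      funext hw
    rw [this, analyticOrderAt_mul analyticAt_const (wr_analyticAt (fun i => (hG _).analyticAt z))]
    exact le_add_self
  have h3 := h1.trans h2
  rw [← Nat.cast_analyticOrderNatAt (ent_order hWd hW z)] at h3
  have h4 : k * o m + ∑ i : Fin k, (o (m.succAbove i) - o m - (k - 1)) ≤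
    analyticOrderNatAt (Wr (fun i : Fin k => g i.succ ^ p)) z := by exact_mod_cast h3
  rw [Fin.sum_univ_succAbove _ m, Fin.sum_univ_succAbove (fun i => (o i : ℤ) - o m) m]
  have h5 : ∀ i : Fin k, (p:ℤ) * ((o (m.succAbove i) : ℤ) - o m -
      ((o (m.succAbove i) - o m - (k - 1) : ℕ) : ℤ)) ≤ (k - 1) * ((o (m.succAbove i) : ℤ) - o m) := by
    intro i
    have hl := hle (m.succAbove i)
    have e : o (m.succAbove i) - o m = p * (analyticOrderNatAt (g (m.succAbove i)) z - analyticOrderNatAt (g m) z) := by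
      rw [hop, hop, Nat.mul_sub]
    rw [show ((o (m.succAbove i) : ℤ) - o m) = ((o (m.succAbove i) - o m : ℕ) : ℤ) by omega, e]
    generalize analyticOrderNatAt (g (m.succAbove i)) z - analyticOrderNatAt (g m) z = t
    obtain ⟨j, rfl⟩ : ∃ j, k = j + 1 := ⟨k - 1, by omega⟩
    rcases Nat.eq_zero_or_pos t with rfl | ht
    · simp
    · have : j ≤ p * t := by nlinarith
      rw [show j + 1 - 1 = j from rfl, Nat.cast_sub this]
      push_cast
      have : (1:ℤ) ≤ t := by exact_mod_cast ht
      have hj : (0:ℤ) ≤ (j:ℤ) * p := by positivity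
      nlinarith
  have h6 := Finset.sum_le_sum (s := Finset.univ) (fun i _ => h5 i)
  rw [← Finset.mul_sum, ← Finset.mul_sum, Finset.sum_sub_distrib] at h6
  have h7 : (k:ℤ) * o m + ∑ i : Fin k, ((o (m.succAbove i) - o m - (k - 1) : ℕ) : ℤ) ≤
    analyticOrderNatAt (Wr (fun i : Fin k => g i.succ ^ p)) z := by exact_mod_cast h4
  have h8 : ∑ i : Fin k, ((o (m.succAbove i) : ℤ) - o m) = ∑ i : Fin k, (o (m.succAbove i) : ℤ) - k * o m := by
    simp [Finset.sum_sub_distrib]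
  rw [h8] at h6
  rw [sub_self, zero_add, h8]
  refine le_trans ?_ h6
  apply mul_le_mul_of_nonneg_left _ (by positivity)
  linarith

end FW
end

section
open Real Metric Set Filter Topology MeasureTheory
namespace FW
open ValueDistribution Function.locallyFinsuppWithin

lemma phi_order {f g : ℂ → ℂ} (hf : Differentiable ℂ f) (hg : Differentiable ℂ g)
    (hf0 : ∃ z, f z ≠ 0) (hg0 : ∃ z, g z ≠ 0) (z : ℂ) :
    meromorphicOrderAt (fun z => f z / g z) z ≠ ⊤ := by
  have : meromorphicOrderAt (fun z => f z / g z) z =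
      meromorphicOrderAt f z + meromorphicOrderAt g⁻¹ z := by
    rw [← meromorphicOrderAt_mul (ent_mer hf z) (ent_mer hg z).inv]
    congr 1
  rw [this, meromorphicOrderAt_inv, ent_mord hf hf0, ent_mord hg hg0]
  exact WithTop.coe_ne_top

lemma ca_mul (c : ℝ) (f : ℂ → ℝ) (r : ℝ) :
    circleAverage (fun z => c * f z) 0 r = c * circleAverage f 0 r := by
  rw [← smul_eq_mul, ← circleAverage_fun_smul]; rfl

lemma ci_mul (c : ℝ) {f : ℂ → ℝ} {r : ℝ} (h : CircleIntegrable f 0 r) :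
    CircleIntegrable (fun z => c * f z) 0 r :=
  IntervalIntegrable.const_mul h c

lemma ci_sum {m : ℕ} {f : Fin m → ℂ → ℝ} {r : ℝ} (h : ∀ i, CircleIntegrable (f i) 0 r) :
    CircleIntegrable (fun z => ∑ i, f i z) 0 r := by
  have := CircleIntegrable.sum Finset.univ (fun i _ => h i)
  convert this using 1
  ext z; simp

/-- integrated inequality -/
lemma int_bound {k p : ℕ} (hk : 1 ≤ k) (hp : (k + 1) * (k - 1) < p) {g : Fin (k+1) → ℂ → ℂ}
    (hg : ∀ i, Differentiable ℂ (g i))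
    (hne : ∀ i, ∃ z, (g i ^ p) z ≠ 0)
    (hs : ∀ z, ∑ i, (g i ^ p) z = 0) (hW : ∃ z, Wr (fun i : Fin k => g i.succ ^ p) z ≠ 0) :
    ∃ B : ℝ, ∀ r, 1 ≤ r → ∀ (X : Fin (k+1) → ℂ → ℝ) (M : Fin (k+1) → ℝ),
      (∀ i z, 1 ≤ X i z) → (∀ i, CircleIntegrable (X i) 0 r) → (∀ i, 0 < M i) →
      (∀ i, circleAverage (X i) 0 r ≤ M i) →
      (∀ i, ∀ᶠ z in codiscreteWithin (sphere (0:ℂ) |r|), ∀ l : ℕ,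
        ‖iteratedDeriv l (fun z => (g i ^ p) z / (g 0 ^ p) z) z‖
          ≤ l.factorial * exp 2 * 2 ^ l * X i z ^ (2 * l) * ‖(g i ^ p) z / (g 0 ^ p) z‖) →
      (p - (k + 1) * (k - 1) : ℝ) * TC (fun i => g i ^ p) r ≤ B + 2 * k * p * ∑ i, log (M i) := by
  have hkp : k ≤ p := by
    obtain ⟨j, rfl⟩ : ∃ j, k = j + 1 := ⟨k - 1, by omega⟩
    simp at hp
    nlinarith
  have hG : ∀ i, Differentiable ℂ (g i ^ p) := fun i => (hg i).pow p
  set G : Fin (k+1) → ℂ → ℂ := fun i => g i ^ p with hGdef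
  set W := Wr (fun i : Fin k => g i.succ ^ p) with hWdef
  have hWd : Differentiable ℂ W := fun z =>
    (wr_analyticAt (fun i => (hG _).analyticAt z)).differentiableAt
  set c : ℝ := log (k.factorial * (k.factorial * exp 2 * 2 ^ k) ^ k) with hc
  refine ⟨p * (c + ∑ i, tc (G i) - tc W) - (k - 1) * ∑ i, tc (G i), ?_⟩
  intro r hr X M hX1 hXi hM hXM hXd
  have key : circleAverage (fun z => log ‖W z‖) 0 r + circleAverage (mx G) 0 r ≤
      c + 2 * k * ∑ i, log (M i) + ∑ i, circleAverage (fun z => log ‖G i z‖) 0 r := by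
    have i1 : ∀ i, CircleIntegrable (fun z => X i z / M i) 0 r := by
      intro i
      simp only [div_eq_inv_mul]
      exact ci_mul _ (hXi i)
    have i2 : CircleIntegrable (fun z => ∑ i, (X i z / M i)) 0 r := ci_sum i1
    have i3 : CircleIntegrable (fun z => ∑ i, log ‖G i z‖) 0 r := ci_sum fun i => ci_log (hG i) r
    have i4 : CircleIntegrable (fun z => 2 * k * ∑ i, (X i z / M i)) 0 r := ci_mul _ i2
    have e1 : circleAverage (fun z => log ‖W z‖ + mx G z) 0 r =
        circleAverage (fun z => log ‖W z‖) 0 r + circleAverage (mx G) 0 r :=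
      circleAverage_fun_add (ci_log hWd r) (ci_mx hG r)
    have i5 : CircleIntegrable (fun _ : ℂ => c + 2 * k * ∑ i, (log (M i) - 1)) 0 r :=
      circleIntegrable_const _ _ _
    have e2 : circleAverage (fun z => (c + 2 * k * ∑ i, (log (M i) - 1)) + 2 * k * ∑ i, (X i z / M i) +
        ∑ i, log ‖G i z‖) 0 r = (c + 2 * k * ∑ i, (log (M i) - 1)) +
          2 * k * ∑ i, (circleAverage (X i) 0 r / M i) + ∑ i, circleAverage (fun z => log ‖G i z‖) 0 r := by
      rw [circleAverage_fun_add (i5.fun_add i4) i3, circleAverage_fun_add i5 i4, circleAverage_const]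
      congr 1
      · congr 1
        have a1 : circleAverage (fun z => 2 * k * ∑ i, (X i z / M i)) 0 r =
            2 * k * circleAverage (fun z => ∑ i, (X i z / M i)) 0 r := ca_mul _ _ _
        rw [a1, circleAverage_fun_sum (fun i _ => i1 i)]
        congr 1
        apply Finset.sum_congr rfl
        intro i _
        simp only [div_eq_inv_mul]
        exact ca_mul _ _ _
      · rw [circleAverage_fun_sum (fun i _ => ci_log (hG i) r)]
    have main := circleAverage_mono_cod (c := 0) (R := r) (by linarith)
      ((ci_log hWd r).fun_add (ci_mx hG r)) ((i5.fun_add i4).fun_add i3) ?_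
    · rw [e1, e2] at main
      have : ∑ i, (circleAverage (X i) 0 r / M i) ≤ ∑ i : Fin (k+1), (1:ℝ) :=
        Finset.sum_le_sum fun i _ => (div_le_one (hM i)).2 (hXM i)
      have h2 : (2 * k : ℝ) * ∑ i, (circleAverage (X i) 0 r / M i) ≤ 2 * k * ∑ i : Fin (k+1), (1:ℝ) := by
        gcongr
      rw [Finset.sum_sub_distrib] at main
      linarith
    · have hall : ∀ᶠ z in codiscreteWithin (sphere (0:ℂ) |r|), ∀ i, G i z ≠ 0 :=
        eventually_all.2 fun i => ev_ne (hG i) (hne i) r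
      filter_upwards [hall, ev_ne hWd hW r, eventually_all.2 hXd] with z h1 h2 h3
      show log ‖W z‖ + mx G z ≤ (c + 2 * k * ∑ i, (log (M i) - 1)) + 2 * k * ∑ i, (X i z / M i) +
        ∑ i, log ‖G i z‖
      have := pt_bound hG hs z h1 h2 (fun i => X i z) (fun i => hX1 i z) h3
      have h4 : ∀ i, 2 * k * log (X i z) ≤ 2 * k * (log (M i) - 1) + 2 * k * (X i z / M i) := by
        intro i
        have hx : 0 < X i z := lt_of_lt_of_le one_pos (hX1 i z)
        have : log (X i z) ≤ log (M i) - 1 + X i z / M i := by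
          have := Real.log_le_sub_one_of_pos (div_pos hx (hM i))
          rw [Real.log_div hx.ne' (hM i).ne'] at this
          linarith
        have hk0 : (0:ℝ) ≤ 2 * k := by positivity
        nlinarith
      have h5 := Finset.sum_le_sum (s := Finset.univ) (fun i _ => h4 i)
      rw [Finset.sum_add_distrib, ← Finset.mul_sum (a := (2 * k : ℝ)) (f := fun i => log (M i) - 1),
        ← Finset.mul_sum (a := (2 * k : ℝ)) (f := fun i => X i z / M i)] at h5
      change log ‖W z‖ + mx G z ≤ c + _ + ∑ i, log ‖G i z‖ at this
      linarith
  have hJ : ∀ i, circleAverage (fun z => log ‖G i z‖) 0 r = logCounting (dv (G i)) r + tc (G i) :=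
    fun i => jensen (hG i) hr
  have hJW := jensen hWd hr
  have hi : ∀ i, logCounting (dv (G i)) r - logCounting (mu G) r ≤ TC G r - tc (G i) := by
    intro i
    have := circleAverage_mono (ci_log (hG i) r) (ci_mx hG r) (fun z _ => le_mx (G := G) z i)
    unfold TC
    linarith [hJ i]
  have hD : (p:ℝ) * (∑ i, logCounting (dv (G i)) r - logCounting (dv W) r - logCounting (mu G) r) ≤
      (k - 1) * ∑ i, (logCounting (dv (G i)) r - logCounting (mu G) r) := by
    have hle : (p • (∑ i, dv (G i) - dv W - mu G)) ≤
        (k - 1) • ∑ i, (dv (G i) - mu G) := by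
      intro z
      have := div_bound hkp hg hne hs hW hk z
      have hev : ∀ (F : Fin (k+1) → Function.locallyFinsuppWithin (univ : Set ℂ) ℤ),
          (∑ i, F i) z = ∑ i, F i z := by
        intro F
        rw [coe_sum, Finset.sum_apply]
      show (p • (∑ i, dv (G i) - dv W - mu G)) z ≤ ((k - 1) • ∑ i, (dv (G i) - mu G)) z
      rw [coe_nsmul, coe_nsmul, Pi.smul_apply, Pi.smul_apply, coe_sub, coe_sub, Pi.sub_apply, Pi.sub_apply,
        hev, hev]
      simp only [coe_sub, Pi.sub_apply, nsmul_eq_mul]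
      rw [Nat.cast_sub hk]
      exact_mod_cast this
    have := logCounting_le hle hr
    rw [map_nsmul, map_nsmul, map_sub, map_sub, map_sum, map_sum] at this
    simp only [map_sub, Pi.smul_apply, Pi.sub_apply, Finset.sum_apply, nsmul_eq_mul] at this
    rw [Nat.cast_sub hk] at this
    exact_mod_cast this
  have hS := Finset.sum_le_sum (s := Finset.univ) (fun i _ => hi i)
  have hS2 : ∑ i, (TC G r - tc (G i)) = (k + 1) * TC G r - ∑ i, tc (G i) := by
    rw [Finset.sum_sub_distrib]; simp
  rw [hS2] at hS
  have hk1 : (0:ℝ) ≤ (k:ℝ) - 1 := by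
    have : (1:ℝ) ≤ k := by exact_mod_cast hk
    linarith
  have hD2 := hD.trans (mul_le_mul_of_nonneg_left hS hk1)
  simp only [hJ, Finset.sum_add_distrib] at key
  have hT : TC G r ≤ (∑ i, logCounting (dv (G i)) r - logCounting (dv W) r - logCounting (mu G) r) +
      (c + ∑ i, tc (G i) - tc W + 2 * k * ∑ i, log (M i)) := by
    rw [TC]
    linarith
  have hp0 : (0:ℝ) ≤ p := by positivity
  have hT2 := mul_le_mul_of_nonneg_left hT hp0
  nlinarith

theorem TC_growth {k p : ℕ} (hk : 1 ≤ k) (hp : (k + 1) * (k - 1) < p) {g : Fin (k+1) → ℂ → ℂ}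
    (hg : ∀ i, Differentiable ℂ (g i))
    (hne : ∀ i, ∃ z, (g i ^ p) z ≠ 0)
    (hs : ∀ z, ∑ i, (g i ^ p) z = 0) (hW : ∃ z, Wr (fun i : Fin k => g i.succ ^ p) z ≠ 0) :
    ∃ C : ℝ, ∀ r, 1 ≤ r → TC (fun i => g i ^ p) r ≤ C * (log (r + 2) + 1) := by
  have hG : ∀ i, Differentiable ℂ (g i ^ p) := fun i => (hg i).pow p
  obtain ⟨B, hB⟩ := int_bound hk hp hg hne hs hW
  choose C hC0 hC using fun i => ldl (φ := fun z => (g i ^ p) z / (g 0 ^ p) z)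
    (fun z => (ent_mer (hG i) z).fun_div (ent_mer (hG 0) z)) (phi_order (hG i) (hG 0) (hne i) (hne 0))
  set t := |tc (g 0 ^ p)| with ht
  have ht0 : 0 ≤ t := abs_nonneg _
  set T := TC (fun i => g i ^ p) with hT
  set S : ℝ := ∑ i, |log (C i)| + (k + 1) * log (1 + t) + |B| + 1 with hS
  have hlt : 0 ≤ log (1 + t) := Real.log_nonneg (by linarith)
  have hS0 : 0 < S := by
    have : 0 ≤ ∑ i, |log (C i)| := Finset.sum_nonneg fun i _ => abs_nonneg _
    have : 0 ≤ |B| := abs_nonneg _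
    positivity
  set Q : ℝ := S * (1 + 2 * k * p) + 3 * 2 * k * p * (k + 1) with hQ
  have hQ0 : 0 < Q := by positivity
  have hgr := iter_growth T Q hQ0 (TC_bdd hG hne) ?_
  · refine ⟨Q * (2 + 10 * Q + 4), fun r hr => (hgr r hr).trans ?_⟩
    have : 0 ≤ log (r + 2) := Real.log_nonneg (by linarith)
    rw [mul_assoc]
    apply mul_le_mul_of_nonneg_left _ hQ0.le
    nlinarith
  intro r R hr hrR
  choose X hX1 hXi hXm hXd using fun i => hC i r R hr hrR
  set m := max (T R) 0 with hm
  have hm0 : 0 ≤ m := le_max_right _ _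
  have hRr : 1 ≤ R / (R - r) := by
    rw [one_le_div (by linarith)]; linarith
  have hRr0 : 0 < R / (R - r) := by linarith
  set M : Fin (k+1) → ℝ := fun i => C i * (R / (R - r)) ^ 3 * ((1 + t) * (1 + m)) with hM
  have hMpos : ∀ i, 0 < M i := by
    intro i
    have := hC0 i
    positivity
  have := hB r hr X M hX1 hXi hMpos ?_ hXd
  · have hl : ∀ i, log (M i) = log (C i) + 3 * log (R / (R - r)) + (log (1 + t) + log (1 + m)) := by
      intro i
      have := hC0 i
      rw [hM]
      simp only
      rw [Real.log_mul (by positivity) (by positivity), Real.log_mul (by positivity) (by positivity),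
        Real.log_mul (by positivity) (by positivity), Real.log_pow]
      push_cast; ring
    simp only [hl, Finset.sum_add_distrib] at this
    simp only [Finset.sum_const, Finset.card_univ, Fintype.card_fin, nsmul_eq_mul] at this
    push_cast at this
    have hL1 : 0 ≤ log (1 + m) := Real.log_nonneg (by linarith)
    have hL2 : 0 ≤ log (R / (R - r)) := Real.log_nonneg hRr
    set L1 := log (1 + m)
    set L2 := log (R / (R - r))
    have hcl : ∑ i, log (C i) ≤ ∑ i, |log (C i)| := Finset.sum_le_sum fun i _ => le_abs_self _
    have hSs : ∑ i, |log (C i)| + (k + 1) * log (1 + t) ≤ S := by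
      rw [hS]; linarith [abs_nonneg B]
    have hBS : B ≤ S := by
      rw [hS]
      have : 0 ≤ ∑ i, |log (C i)| := Finset.sum_nonneg fun i _ => abs_nonneg _
      have h2 : 0 ≤ (k + 1 : ℝ) * log (1 + t) := by positivity
      linarith [le_abs_self B]
    have hkp0 : (0:ℝ) ≤ 2 * k * p := by positivity
    have hbig : B + 2 * k * p * (∑ i, log (C i) + (k + 1) * (3 * L2) + ((k + 1) * log (1 + t) + (k + 1) * L1))
        ≤ Q * (1 + L1 + L2) := by
      calc _ ≤ S + 2 * k * p * (S + (k + 1) * (3 * L2) + (k + 1) * L1) := by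
            have : ∑ i, log (C i) + (k + 1) * (3 * L2) + ((k + 1) * log (1 + t) + (k + 1) * L1) ≤
              S + (k + 1) * (3 * L2) + (k + 1) * L1 := by linarith
            have := mul_le_mul_of_nonneg_left this hkp0
            linarith
        _ ≤ _ := by
            rw [hQ]
            have a1 : 0 ≤ S * (1 + 2 * k * p) * (L1 + L2) := by positivity
            have a2 : 0 ≤ 2 * k * p * (k + 1) * (3 + 2 * L1) := by positivity
            nlinarith
    have hfac : (1:ℝ) ≤ p - (k + 1) * (k - 1) := by
      have : (k + 1) * (k - 1) + 1 ≤ p := hp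
      have h2 : (((k + 1) * (k - 1) + 1 : ℕ) : ℝ) ≤ p := by exact_mod_cast this
      push_cast [Nat.cast_sub hk] at h2
      linarith
    have hfin := this.trans hbig
    rcases le_or_gt (T r) 0 with h0 | h0
    · exact h0.trans (by positivity)
    · refine le_trans ?_ hfin
      change T r ≤ _ * T r
      nlinarith
  · intro i
    refine (hXm i).trans ?_
    rw [hM]
    apply mul_le_mul_of_nonneg_left _ (by have := hC0 i; positivity)
    have h1 := char_le (G := fun i => g i ^ p) hG hne i (r := R) (by linarith)
    change characteristic (fun z => (g i ^ p) z / (g 0 ^ p) z) ⊤ R ≤ T R - tc (g 0 ^ p) at h1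
    have h2 : T R ≤ m := le_max_left _ _
    have h3 : - tc (g 0 ^ p) ≤ t := neg_le_abs _
    nlinarith

end FW
end

section
open Real Metric Set Filter Topology MeasureTheory
namespace FW
open ValueDistribution Function.locallyFinsuppWithin

lemma zero_of_exp {f : ℂ → ℂ} (hf : Continuous f) (h : ∀ z, f (Complex.exp z) = 0) (z : ℂ) : f z = 0 := by
  have : f = fun _ => 0 := by
    apply Continuous.ext_on (dense_compl_singleton (0:ℂ)) hf continuous_const
    intro w hw
    have := h (Complex.log w)
    rwa [Complex.exp_log hw] at this
  rw [this]

theorem no_indep {k p : ℕ} (hk : 2 ≤ k) (hp : (k + 1) * (k - 1) < p) {g : Fin (k+1) → ℂ → ℂ}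
    (hg : ∀ i, Differentiable ℂ (g i))
    (hne : ∀ i, ∃ z, g i z ≠ 0)
    (hs : ∀ z, ∑ i, g i z ^ p = 0)
    (hl : LinearIndependent ℂ (fun i : Fin k => g i.succ ^ p)) : False := by
  have hp0 : p ≠ 0 := by omega
  set h : Fin (k+1) → ℂ → ℂ := fun i z => g i (Complex.exp z) with hh
  have hhd : ∀ i, Differentiable ℂ (h i) := fun i => (hg i).comp Complex.differentiable_exp
  have hhne : ∀ i, ∃ z, h i z ≠ 0 := by
    intro i
    by_contra hc
    push Not at hc
    obtain ⟨z, hz⟩ := hne i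
    exact hz (zero_of_exp (hg i).continuous hc z)
  have hGne : ∀ i, ∃ z, (h i ^ p) z ≠ 0 := fun i => by
    obtain ⟨z, hz⟩ := hhne i
    exact ⟨z, pow_ne_zero _ hz⟩
  have hGd : ∀ i, Differentiable ℂ (h i ^ p) := fun i => (hhd i).pow p
  have hhs : ∀ z, ∑ i, (h i ^ p) z = 0 := fun z => hs _
  have hhl : LinearIndependent ℂ (fun i : Fin k => h i.succ ^ p) := by
    rw [Fintype.linearIndependent_iff] at hl ⊢
    intro c hc
    apply hl c
    ext z
    have := zero_of_exp (f := fun z => (∑ i, c i • g i.succ ^ p) z) ?_ ?_ z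
    · exact this
    · simp only [Finset.sum_apply, Pi.smul_apply, Pi.pow_apply]
      exact continuous_finset_sum _ fun i _ => by
        have := (hg i.succ).continuous
        fun_prop
    · intro w
      have := congrFun hc w
      simpa [hh] using this
  have hW := wr_indep (fun i : Fin k => h i.succ ^ p) (fun i => hGd _) hhl
  obtain ⟨C, hC⟩ := TC_growth (by omega) hp hhd hGne hhs hW
  set G : Fin (k+1) → ℂ → ℂ := fun i => h i ^ p with hG
  replace hGd : ∀ i, Differentiable ℂ (G i) := hGd
  replace hGne : ∀ i, ∃ z, G i z ≠ 0 := hGne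
  obtain ⟨z0, hz0⟩ := hGne (⟨1, by omega⟩ : Fin k).succ
  set a : Fin k := ⟨0, by omega⟩ with ha
  set b : Fin k := ⟨1, by omega⟩ with hb
  have hab : a ≠ b := by simp [ha, hb]
  set c : ℂ := G a.succ z0 / G b.succ z0 with hc
  set F : ℂ → ℂ := G a.succ + (fun _ => -c) * G b.succ with hF
  have hFd : Differentiable ℂ F := (hGd _).add ((differentiable_const _).mul (hGd _))
  have hF0 : ∃ z, F z ≠ 0 := by
    by_contra hcon
    push Not at hcon
    have := Fintype.linearIndependent_iff.1 hhl (Pi.single a 1 + Pi.single b (-c)) ?_ a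
    · simp [hab] at this
    · have e : ∑ i : Fin k, (Pi.single a (1:ℂ) + Pi.single b (-c) : Fin k → ℂ) i • (h i.succ ^ p) =
          h a.succ ^ p + (-c) • h b.succ ^ p := by
        simp only [add_smul, Pi.add_apply, Finset.sum_add_distrib, Pi.single_apply, ite_smul, zero_smul,
          one_smul, Finset.sum_ite_eq', Finset.mem_univ, if_true]
      rw [e]
      ext z
      exact hcon z
  have hge : mu G ≤ dv F := by
    intro z
    have h1 := mu_le (G := G) a.succ z
    have h2 := mu_le (G := G) b.succ z
    rw [dv_apply (hGd _) (hGne _)] at h1 h2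
    rw [dv_apply hFd hF0]
    have h3 : min (analyticOrderAt (G a.succ) z) (analyticOrderAt (G b.succ) z) ≤ analyticOrderAt F z := by
      refine le_trans ?_ le_analyticOrderAt_add
      rw [analyticOrderAt_mul analyticAt_const ((hGd _).analyticAt z)]
      exact min_le_min le_rfl le_add_self
    rw [← Nat.cast_analyticOrderNatAt (ent_order hFd hF0 z),
      ← Nat.cast_analyticOrderNatAt (ent_order (hGd a.succ) (hGne _) z),
      ← Nat.cast_analyticOrderNatAt (ent_order (hGd b.succ) (hGne _) z)] at h3
    have h5 : analyticOrderNatAt (G a.succ) z ≤ analyticOrderNatAt F z ∨ analyticOrderNatAt (G b.succ) z ≤ analyticOrderNatAt F z := by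
      rcases min_le_iff.1 h3 with h | h
      · exact Or.inl (by exact_mod_cast h)
      · exact Or.inr (by exact_mod_cast h)
    change mu G z ≤ (analyticOrderNatAt F z : ℤ)
    replace h1 : mu G z ≤ (analyticOrderNatAt (G a.succ) z : ℤ) := h1
    replace h2 : mu G z ≤ (analyticOrderNatAt (G b.succ) z : ℤ) := h2
    omega
  have hD0 : 0 ≤ dv F - mu G := sub_nonneg.2 hge
  have hinf : ¬ (dv F - mu G).support.Finite := by
    intro hfin
    have hinj : Function.Injective (fun j : ℕ => z0 + j * (2 * π * Complex.I)) := by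
      intro i j hij
      have h1 : (i:ℂ) * (2 * π * Complex.I) = j * (2 * π * Complex.I) := add_left_cancel hij
      have := mul_right_cancel₀ Complex.two_pi_I_ne_zero h1
      exact_mod_cast this
    apply Set.infinite_range_of_injective hinj
    apply hfin.subset
    rintro _ ⟨j, rfl⟩
    have hper : ∀ i, G i (z0 + j * (2 * π * Complex.I)) = G i z0 := by
      intro i
      simp only [hG, hh, Pi.pow_apply]
      rw [Complex.exp_add, Complex.exp_nat_mul, Complex.exp_two_pi_mul_I]
      simp
    show (dv F - mu G) (z0 + j * (2 * π * Complex.I)) ≠ 0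
    set w := z0 + j * (2 * π * Complex.I) with hw
    have hFw : F w = 0 := by
      simp only [hF, Pi.add_apply, Pi.mul_apply]
      rw [hper, hper, hc]
      have : G b.succ z0 ≠ 0 := hz0
      field_simp
      ring
    rw [coe_sub, Pi.sub_apply, dv_apply hFd hF0]
    have h1 := mu_le (G := G) b.succ w
    rw [dv_apply (hGd _) (hGne _)] at h1
    have h2 : analyticOrderAt (G b.succ) w = 0 := by
      rw [((hGd _).analyticAt w).analyticOrderAt_eq_zero, hper]
      exact hz0
    have h3 : analyticOrderNatAt (G b.succ) w = 0 := by
      simp [analyticOrderNatAt, h2]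
    have h4 : analyticOrderNatAt F w ≠ 0 := by
      intro h0
      have : analyticOrderAt F w = 0 := by
        rw [← Nat.cast_analyticOrderNatAt (ent_order hFd hF0 w), h0]; rfl
      rw [(hFd.analyticAt w).analyticOrderAt_eq_zero] at this
      exact this hFw
    rw [h3] at h1
    have h1' : mu G w ≤ 0 := h1
    omega
  apply hinf
  rw [finite_support_iff_logCounting_isBigO_log hD0]
  set E : ℝ := log (1 + ‖c‖) - tc F with hE
  apply Asymptotics.IsBigO.of_bound (3 * |C| + |E|)
  filter_upwards [eventually_ge_atTop 3] with r hr
  show ‖logCounting (dv F - mu G) r‖ ≤ (3 * |C| + |E|) * ‖log r‖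
  have hlr : 1 ≤ log r := by
    rw [Real.le_log_iff_exp_le (by linarith)]
    exact Real.exp_one_lt_d9.le.trans (by linarith)
  rw [Real.norm_of_nonneg (logCounting_nonneg hD0 (by linarith)), Real.norm_of_nonneg (by linarith)]
  have hsub : logCounting (dv F - mu G) r = logCounting (dv F) r - logCounting (mu G) r := by
    rw [map_sub]; rfl
  have hJ := jensen hFd (r := r) (by linarith)
  have hmean : circleAverage (fun z => log ‖F z‖) 0 r ≤ log (1 + ‖c‖) + circleAverage (mx G) 0 r := by
    have e : circleAverage (fun z => log (1 + ‖c‖) + mx G z) 0 r = log (1 + ‖c‖) + circleAverage (mx G) 0 r := by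
      rw [circleAverage_fun_add (circleIntegrable_const _ _ _) (ci_mx hGd r), circleAverage_const]
    rw [← e]
    apply circleAverage_mono_cod (by linarith) (ci_log hFd r)
      ((circleIntegrable_const _ _ _).fun_add (ci_mx hGd r))
    filter_upwards [ev_ne hFd hF0 r, ev_ne (hGd a.succ) (hGne _) r, ev_ne (hGd b.succ) (hGne _) r] with z h1 h2 h3
    show log ‖F z‖ ≤ log (1 + ‖c‖) + mx G z
    have ea : ‖G a.succ z‖ ≤ exp (mx G z) := by
      rw [← Real.log_le_iff_le_exp (norm_pos_iff.2 h2)]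
      exact le_mx (G := G) z _
    have eb : ‖G b.succ z‖ ≤ exp (mx G z) := by
      rw [← Real.log_le_iff_le_exp (norm_pos_iff.2 h3)]
      exact le_mx (G := G) z _
    have hc0 := norm_nonneg c
    have : ‖F z‖ ≤ (1 + ‖c‖) * exp (mx G z) := by
      calc ‖F z‖ ≤ ‖G a.succ z‖ + ‖-c * G b.succ z‖ := norm_add_le _ _
        _ = ‖G a.succ z‖ + ‖c‖ * ‖G b.succ z‖ := by rw [norm_mul, norm_neg]
        _ ≤ exp (mx G z) + ‖c‖ * exp (mx G z) := by gcongr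
        _ = _ := by ring
    have := Real.log_le_log (norm_pos_iff.2 h1) this
    rwa [Real.log_mul (by positivity) (by positivity), Real.log_exp] at this
  have hTr := hC r (by linarith)
  rw [TC] at hTr
  have hl2 : log (r + 2) ≤ 2 * log r := by
    rw [show 2 * log r = log (r ^ 2) by rw [Real.log_pow]; norm_num]
    apply Real.log_le_log (by linarith)
    nlinarith
  have hl3 : 0 ≤ log (r + 2) := Real.log_nonneg (by linarith)
  have h1 : C * (log (r + 2) + 1) ≤ |C| * (3 * log r) := by
    calc _ ≤ |C| * (log (r + 2) + 1) := by gcongr; exact le_abs_self _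
      _ ≤ _ := by gcongr; linarith
  have h2 : E ≤ |E| * log r := by
    have := abs_nonneg E
    nlinarith [le_abs_self E]
  rw [hsub]
  have : logCounting (dv F) r - logCounting (mu G) r ≤ C * (log (r + 2) + 1) + E := by
    rw [hE]; linarith
  linarith

end FW
end

section
open Set Filter Topology
namespace FW

lemma comb {N q : ℕ} (Z : Finset (Fin N)) (r : Setoid (Fin N)) (hq : 0 < q) (hN : N < 2 * (q + 1))
    (h : ∀ j ∈ Z, ∃ i ∈ Z, i ≠ j ∧ r i j) :
    ∃ σ : Fin N → Fin q, ∀ i ∈ Z, ∀ j ∈ Z, σ i = σ j → r i j := by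
  classical
  set π : Fin N → Quotient r := fun j => Quotient.mk r j with hπ
  set Q := Z.image π with hQ
  have hcard : 2 * Q.card ≤ Z.card := by
    apply Finset.mul_card_image_le_card
    intro b hb
    obtain ⟨j, hj, rfl⟩ := Finset.mem_image.1 hb
    obtain ⟨i, hi, hij, hr⟩ := h j hj
    have : 1 < (Finset.filter (fun a => π a = π j) Z).card :=
      Finset.one_lt_card.2 ⟨i, Finset.mem_filter.2 ⟨hi, Quotient.sound hr⟩, j,
        Finset.mem_filter.2 ⟨hj, rfl⟩, hij⟩
    exact this
  have hZ : Z.card ≤ N := by simpa using Finset.card_le_univ Z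
  have hQq : Q.card ≤ q := by omega
  refine ⟨fun j => if hj : π j ∈ Q then Fin.castLE hQq (Q.equivFin ⟨π j, hj⟩) else ⟨0, hq⟩, ?_⟩
  intro i hi j hj hij
  have hi' : π i ∈ Q := Finset.mem_image_of_mem _ hi
  have hj' : π j ∈ Q := Finset.mem_image_of_mem _ hj
  simp only [hi', hj', dif_pos] at hij
  have := Q.equivFin.injective (Fin.castLE_injective _ hij)
  exact Quotient.exact (Subtype.ext_iff.1 this)

lemma root_prop {p : ℕ} (hp : 0 < p) {f h : ℂ → ℂ} (hf : Differentiable ℂ f) (hh : Differentiable ℂ h)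
    (e : ∀ z, f z ^ p = h z ^ p) : ∃ ω : ℂ, ω ≠ 0 ∧ ∀ z, f z = ω * h z := by
  classical
  have hex : ∃ ω ∈ Polynomial.nthRootsFinset p (1:ℂ), ∃ᶠ z in 𝓝[≠] (0:ℂ), f z = ω * h z := by
    by_contra hcon
    push Not at hcon
    have : ∀ᶠ z in 𝓝[≠] (0:ℂ), ∀ ω ∈ Polynomial.nthRootsFinset p (1:ℂ), f z ≠ ω * h z := by
      rw [Filter.eventually_all_finset]
      intro ω hω
      have := hcon ω hω
      simpa [Filter.not_frequently] using this
    obtain ⟨z, hz⟩ := this.exists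
    have ez := e z
    by_cases h0 : h z = 0
    · apply hz 1 (by rw [Polynomial.mem_nthRootsFinset hp]; simp)
      rw [h0, zero_pow hp.ne'] at ez
      rw [h0, pow_eq_zero_iff hp.ne' |>.1 ez]; simp
    · apply hz (f z / h z)
      · rw [Polynomial.mem_nthRootsFinset hp, div_pow, ez, div_self (pow_ne_zero _ h0)]
      · field_simp
  obtain ⟨ω, hω, hfr⟩ := hex
  refine ⟨ω, ?_, ?_⟩
  · rintro rfl
    rw [Polynomial.mem_nthRootsFinset hp, zero_pow hp.ne'] at hω
    exact zero_ne_one hω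
  · have := AnalyticOnNhd.eq_of_frequently_eq (𝕜 := ℂ) (f := f) (g := fun z => ω * h z) (z₀ := 0)
      (fun z _ => hf.analyticAt z) (fun z _ => analyticAt_const.fun_mul (hh.analyticAt z)) hfr
    intro z
    exact congrFun this z

lemma exists_root {p : ℕ} (hp : 0 < p) (c : ℂ) : ∃ γ : ℂ, γ ^ p = c := IsAlgClosed.exists_pow_nat_eq c hp

lemma partner {N p : ℕ} (hp : N * (N - 2) < p) (g : Fin N → ℂ → ℂ) (hg : ∀ i, Differentiable ℂ (g i))
    (hs : ∀ z, ∑ i, g i z ^ p = 0) (j : Fin N) (hj : ∃ z, g j z ≠ 0) :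
    ∃ i, i ≠ j ∧ ∃ c : ℂ, c ≠ 0 ∧ ∀ z, g j z = c * g i z := by
  classical
  have hp0 : 0 < p := by omega
  set v : Fin N → ℂ → ℂ := fun i => g i ^ p with hv
  have hex : ∃ m, ∃ S : Finset (Fin N), S.card = m ∧ j ∉ S ∧ ∃ c : Fin N → ℂ, v j = ∑ i ∈ S, c i • v i := by
    refine ⟨_, Finset.univ.erase j, rfl, by simp, fun _ => -1, ?_⟩
    have h1 : ∑ i, v i = 0 := by
      ext z
      rw [Finset.sum_apply]
      exact hs z
    rw [← Finset.add_sum_erase _ _ (Finset.mem_univ j)] at h1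
    rw [eq_neg_of_add_eq_zero_left h1]
    simp
  obtain ⟨S, hSc, hjS, c, hc⟩ := Nat.find_spec hex
  have hmin : ∀ T : Finset (Fin N), T ⊂ S → ¬ ∃ c : Fin N → ℂ, v j = ∑ i ∈ T, c i • v i := by
    rintro T hT hc'
    have := Finset.card_lt_card hT
    exact Nat.find_min hex (hSc ▸ this) ⟨T, rfl, fun h => hjS (hT.1 h), hc'⟩
  have hcne : ∀ i ∈ S, c i ≠ 0 := by
    intro i hi h0
    apply hmin _ (Finset.erase_ssubset hi)
    refine ⟨c, ?_⟩
    rw [hc, ← Finset.add_sum_erase _ _ hi, h0, zero_smul, zero_add]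
  have hind : ∀ d : Fin N → ℂ, ∑ i ∈ S, d i • v i = 0 → ∀ i ∈ S, d i = 0 := by
    intro d hd i hi
    by_contra h0
    apply hmin _ (Finset.erase_ssubset hi)
    refine ⟨fun l => c l - c i / d i * d l, ?_⟩
    have : v j = ∑ l ∈ S, (c l - c i / d i * d l) • v l := by
      simp only [sub_smul, mul_smul]
      rw [Finset.sum_sub_distrib, ← Finset.smul_sum, hd, smul_zero, sub_zero, hc]
    rw [this, ← Finset.add_sum_erase _ _ hi, div_mul_cancel₀ _ h0, sub_self, zero_smul, zero_add]
  have hvj : v j ≠ 0 := by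
    obtain ⟨z, hz⟩ := hj
    intro h0
    exact pow_ne_zero p hz (congrFun h0 z)
  have hSN : S.card + 1 ≤ N := by
    have := Finset.card_le_univ (insert j S)
    rwa [Finset.card_insert_of_notMem hjS, Fintype.card_fin] at this
  rcases Nat.lt_or_ge S.card 2 with hlt | hge
  · have h1 : S.card = 1 := by
      rcases Nat.eq_zero_or_pos S.card with h0 | h0
      · rw [Finset.card_eq_zero] at h0
        rw [h0] at hc
        exact absurd hc (by simpa using hvj)
      · omega
    obtain ⟨i, rfl⟩ := Finset.card_eq_one.1 h1
    have hij : i ≠ j := fun h => hjS (by simp [h])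
    obtain ⟨γ, hγ⟩ := exists_root hp0 (c i)
    obtain ⟨ω, hω, h⟩ := root_prop hp0 (hg j) ((hg i).const_mul γ) (by
      intro z
      have := congrFun hc z
      simp only [Finset.sum_singleton, hv, Pi.pow_apply, Pi.smul_apply, smul_eq_mul] at this
      rw [this, mul_pow, hγ])
    refine ⟨i, hij, ω * γ, mul_ne_zero hω ?_, fun z => by rw [h z]; ring⟩
    rintro rfl
    rw [zero_pow hp0.ne'] at hγ
    exact hcne i (by simp) hγ.symm
  · exfalso
    set k := S.card with hk
    set e : Fin k ≃ S := S.equivFin.symm with he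
    choose γ hγ using fun i => exists_root hp0 (c i)
    obtain ⟨ρ, hρ⟩ := exists_root hp0 (-1)
    have hρ0 : ρ ≠ 0 := by
      rintro rfl
      rw [zero_pow hp0.ne'] at hρ
      norm_num at hρ
    have hγ0 : ∀ i ∈ S, γ i ≠ 0 := by
      intro i hi h0
      have := hγ i
      rw [h0, zero_pow hp0.ne'] at this
      exact hcne i hi this.symm
    have hsum : ∀ F : Fin N → ℂ → ℂ, ∑ i : Fin k, F (e i) = ∑ i ∈ S, F i := by
      intro F
      rw [e.sum_comp (fun i : S => F i), Finset.sum_coe_sort]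
    have hpw : ∀ i : Fin k, (fun z => γ (e i) * g (e i) z) ^ p = c (e i) • v (e i) := by
      intro i
      ext z
      simp [hv, mul_pow, hγ]
    have hvne : ∀ i ∈ S, ∃ z, g i z ≠ 0 := by
      intro i hi
      by_contra hcon
      push Not at hcon
      have : v i = 0 := by
        ext z; simp [hv, hcon z, hp0.ne']
      have := hind (Pi.single i 1) (by
        rw [← Finset.add_sum_erase _ _ hi, this, smul_zero, zero_add]
        apply Finset.sum_eq_zero
        intro l hl
        rw [Pi.single_eq_of_ne (Finset.ne_of_mem_erase hl), zero_smul]) i hi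
      simp at this
    refine no_indep (k := k) (p := p) hge ?_
      (g := Fin.cons (fun z => ρ * g j z) (fun (i : Fin k) z => γ (e i) * g (e i) z)) ?_ ?_ ?_ ?_
    · refine lt_of_le_of_lt ?_ hp
      exact Nat.mul_le_mul hSN (by omega)
    · intro i
      refine Fin.cases ?_ (fun i => ?_) i
      · exact (hg j).const_mul ρ
      · exact (hg _).const_mul _
    · intro i
      refine Fin.cases ?_ (fun i => ?_) i
      · obtain ⟨z, hz⟩ := hj
        exact ⟨z, mul_ne_zero hρ0 hz⟩
      · obtain ⟨z, hz⟩ := hvne (e i) (e i).2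
        exact ⟨z, mul_ne_zero (hγ0 _ (e i).2) hz⟩
    · intro z
      rw [Fin.sum_univ_succ]
      simp only [Fin.cons_zero, Fin.cons_succ]
      have h1 : ∑ i : Fin k, (γ (e i) * g (e i) z) ^ p = v j z := by
        rw [hc, ← hsum (fun i => c i • v i), Finset.sum_apply]
        apply Finset.sum_congr rfl
        intro i _
        exact congrFun (hpw i) z
      rw [h1, mul_pow, hρ]
      simp [hv]
    · simp only [Fin.cons_succ, hpw]
      rw [Fintype.linearIndependent_iff]
      intro d hd i
      have h1 := hind (fun l => if hl : l ∈ S then d (e.symm ⟨l, hl⟩) * c l else 0) (by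
        rw [← hsum (fun l => (if hl : l ∈ S then d (e.symm ⟨l, hl⟩) * c l else 0) • v l), ← hd]
        apply Finset.sum_congr rfl
        intro i _
        simp [mul_smul]) (e i) (e i).2
      simp at h1
      exact h1.resolve_right (hcne _ (e i).2)

end FW


end

theorem hyperbolic_hypersurface_of_low_degree
    (n : ℕ) (hn : 2 ≤ n) (N p : ℕ) (hN : N = 4 * n - 3) (hp : p = 16 * (n - 1) ^ 2) :
    ∃ U : Set (Fin N → ((Fin (n + 1) → ℂ) →L[ℂ] ℂ)),
      IsOpen U ∧ Dense U ∧
      ∀ H ∈ U, ∀ f : Fin (n + 1) → ℂ → ℂ,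
        (∀ i, Differentiable ℂ (f i)) →
        (∀ z : ℂ, ∃ i, f i z ≠ 0) →
        (∀ z : ℂ, ∑ j : Fin N, (H j (fun i => f i z)) ^ p = 0) →
        ∀ z w : ℂ, ¬ LinearIndependent ℂ ![fun i => f i z, fun i => f i w] := by
  classical
  obtain ⟨U, hUo, hUd, hU⟩ := FW.generic_forms (n := n) (N := N) (q := 2 * n - 2) (by omega) hn
  refine ⟨U, hUo, hUd, ?_⟩
  intro H hH f hf _ hs z w hli
  have hpN : N * (N - 2) < p := by
    obtain ⟨m, rfl⟩ : ∃ m, n = m + 1 := ⟨n - 1, by omega⟩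
    obtain ⟨l, rfl⟩ : ∃ l, m = l + 1 := ⟨m - 1, by omega⟩
    have e1 : N = 4 * l + 5 := by omega
    subst e1
    rw [hp]
    simp only [Nat.add_sub_cancel, show 4 * l + 5 - 2 = 4 * l + 3 by omega]
    nlinarith
  set g : Fin N → ℂ → ℂ := fun j ζ => H j (fun i => f i ζ) with hg
  have hgd : ∀ j, Differentiable ℂ (g j) := by
    intro j
    exact (H j).differentiable.comp (differentiable_pi.2 hf)
  let r : Setoid (Fin N) :=
    { r := fun i j => ∃ c : ℂ, c ≠ 0 ∧ ∀ ζ, g i ζ = c * g j ζ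
      iseqv := ⟨fun i => ⟨1, one_ne_zero, fun ζ => by simp⟩,
        fun {i j} ⟨c, hc, h⟩ => ⟨c⁻¹, inv_ne_zero hc, fun ζ => by rw [h ζ]; field_simp⟩,
        fun {i j l} ⟨c, hc, h⟩ ⟨d, hd, h'⟩ => ⟨c * d, mul_ne_zero hc hd, fun ζ => by rw [h, h']; ring⟩⟩ }
  obtain ⟨σ, hσ⟩ := FW.comb (q := 2 * n - 2) (Finset.univ.filter fun j => ∃ ζ, g j ζ ≠ 0) r
    (by omega) (by omega) (by
      intro j hj
      simp only [Finset.mem_filter, Finset.mem_univ, true_and] at hj ⊢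
      obtain ⟨i, hij, c, hc, h⟩ := FW.partner hpN g hgd hs j hj
      refine ⟨i, ?_, hij, r.symm ⟨c, hc, h⟩⟩
      obtain ⟨ζ, hζ⟩ := hj
      rw [h] at hζ
      exact ⟨ζ, right_ne_zero_of_mul hζ⟩)
  have hab : ∀ k : Fin (2 * n - 2), ∃ ab : ℂ × ℂ, (ab.1 ≠ 0 ∨ ab.2 ≠ 0) ∧
      ∀ j, σ j = k → ab.1 * g j z + ab.2 * g j w = 0 := by
    intro k
    by_cases hk : ∃ j, σ j = k ∧ ∃ ζ, g j ζ ≠ 0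
    · obtain ⟨j, hjk, hj⟩ := hk
      have key : ∃ ab : ℂ × ℂ, (ab.1 ≠ 0 ∨ ab.2 ≠ 0) ∧ ab.1 * g j z + ab.2 * g j w = 0 := by
        by_cases h0 : g j z = 0 ∧ g j w = 0
        · exact ⟨(1, 0), by simp, by simp [h0.1]⟩
        · refine ⟨(g j w, - g j z), ?_, by ring⟩
          by_contra hcon
          push Not at hcon
          exact h0 ⟨by simpa using hcon.2, hcon.1⟩
      obtain ⟨ab, hne, hz⟩ := key
      refine ⟨ab, hne, fun i hi => ?_⟩
      by_cases hi0 : ∃ ζ, g i ζ ≠ 0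
      · obtain ⟨c, hc, h⟩ := hσ i (by simpa using hi0) j (by simpa using hj) (hi.trans hjk.symm)
        rw [h, h]
        linear_combination c * hz
      · push Not at hi0
        simp [hi0]
    · push Not at hk
      exact ⟨(1, 0), by simp, fun j hj => by simp [hk j hj]⟩
  choose ab hab1 hab2 using hab
  obtain ⟨j, hj⟩ := hU H hH σ _ _ hli (fun k => (ab k).1) (fun k => (ab k).2) hab1
  apply hj
  rw [map_add, map_smul, map_smul, smul_eq_mul, smul_eq_mul]
  exact hab2 (σ j) j rfl
end

section
/- (Generalized Borel lemma.) Let n ≥ 2 be an integer and, for 0 ≤ j ≤ n, let g_j(x₀, …, x_n) be a homogeneous polynomial of degree δ_j over ℂ. Let p be an integer with p > (n+1)(n−1) + ∑_{j=0}^n δ_j. Suppose f₀, …, f_n : ℂ → ℂ are entire functions with no common zero (representing a holomorphic map ℂ → ℙ_n(ℂ)) satisfying ∑_{j=0}^n f_j(z)^{p−δ_j} · g_j(f₀(z), …, f_n(z)) = 0 for all z ∈ ℂ. Then there is a nontrivial linear relation among x₁^{p−δ₁}g₁, …, x_n^{p−δ_n}g_n on the image of f: there exist complex numbers c₁, …,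 c_n, not all zero, such that ∑_{j=1}^n c_j · f_j(z)^{p−δ_j} · g_j(f₀(z), …, f_n(z)) = 0 for all z ∈ ℂ. -/
open Filter Topology
open scoped Matrix

lemma gbl_dense {A : ℂ → ℂ} (hA : Differentiable ℂ A) (h : ∃ z, A z ≠ 0) (w : ℂ) :
    ∀ᶠ z in 𝓝[≠] w, A z ≠ 0 := by
  have h1 : AnalyticOnNhd ℂ A Set.univ := fun z _ => hA.analyticAt z
  rcases h1.eqOn_zero_or_eventually_ne_zero_of_preconnected isPreconnected_univ with h2 | h2
  · obtain ⟨z, hz⟩ := h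
    exact absurd (h2 (Set.mem_univ z)) hz
  · rcases (hA.analyticAt w).eventually_eq_zero_or_eventually_ne_zero with h3 | h3
    · obtain ⟨z, hz⟩ := h
      have := h1.eqOn_zero_of_preconnected_of_eventuallyEq_zero isPreconnected_univ
        (Set.mem_univ w) h3
      exact absurd (this (Set.mem_univ z)) hz
    · exact h3

lemma gbl_identity {A B C : ℂ → ℂ} (hA : Differentiable ℂ A) (h : ∃ z, A z ≠ 0)
    (hB : Continuous B) (hC : Continuous C) (hBC : ∀ z, A z ≠ 0 → B z = C z) (z : ℂ) :
    B z = C z := by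
  have h1 := (gbl_dense hA h z).mono hBC
  have hb : Tendsto B (𝓝[≠] z) (𝓝 (B z)) := hB.continuousAt.tendsto.mono_left nhdsWithin_le_nhds
  have hc : Tendsto C (𝓝[≠] z) (𝓝 (C z)) := hC.continuousAt.tendsto.mono_left nhdsWithin_le_nhds
  exact tendsto_nhds_unique (hb.congr' h1) hc

lemma gbl_diff_iter {F : ℂ → ℂ} (hF : Differentiable ℂ F) (i : ℕ) :
    Differentiable ℂ (iteratedDeriv i F) :=
  (hF.contDiff (n := ⊤)).differentiable_iteratedDeriv i (by exact_mod_cast WithTop.coe_lt_top _)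

lemma gbl_det_diff {n : ℕ} {M : ℂ → Matrix (Fin n) (Fin n) ℂ}
    (h : ∀ i j, Differentiable ℂ (fun z => M z i j)) : Differentiable ℂ (fun z => (M z).det) := by
  simp only [Matrix.det_apply]
  refine Differentiable.fun_sum fun σ _ => ?_
  refine Differentiable.const_smul ?_ _
  exact Differentiable.fun_finsetProd fun i _ => h _ _

/-- Vanishing Wronskian implies linear dependence. -/
lemma gbl_wronskian (n : ℕ) : ∀ (F : Fin n → ℂ → ℂ), (∀ j, Differentiable ℂ (F j)) →
    (∀ z, (Matrix.of fun i j : Fin n => iteratedDeriv i (F j) z).det = 0) →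
    ∃ c : Fin n → ℂ, c ≠ 0 ∧ ∀ z, ∑ j, c j * F j z = 0 := by
  induction n with
  | zero => intro F _ h; simpa using h 0
  | succ n ih =>
    intro F hF hdet
    by_cases hW : ∀ z, (Matrix.of fun i j : Fin n => iteratedDeriv i (F j.castSucc) z).det = 0
    · obtain ⟨c, hc, h⟩ := ih (fun j => F j.castSucc) (fun j => hF _) hW
      refine ⟨Fin.snoc c 0, ?_, ?_⟩
      · intro h0
        apply hc
        funext j
        have := congrFun h0 j.castSucc
        simpa using this
      · intro z
        rw [Fin.sum_univ_castSucc]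
        simpa using h z
    · push Not at hW
      obtain ⟨z1, hz1⟩ := hW
      set A : ℂ → Matrix (Fin n) (Fin n) ℂ :=
        fun z => Matrix.of fun i j : Fin n => iteratedDeriv i (F j.castSucc) z with hAdef
      have hAd : Differentiable ℂ fun z => (A z).det :=
        gbl_det_diff fun i j => gbl_diff_iter (hF _) _
      set b : ℂ → Fin n → ℂ := fun z i => iteratedDeriv i (F (Fin.last n)) z with hbdef
      set c : ℂ → Fin n → ℂ := fun z j => (A z).cramer (b z) j / (A z).det with hcdef
      have hcr : ∀ j, Differentiable ℂ fun z => (A z).cramer (b z) j := by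
        intro j
        simp only [Matrix.cramer_apply]
        refine gbl_det_diff fun i k => ?_
        simp only [Matrix.updateCol_apply]
        split_ifs
        · exact gbl_diff_iter (hF _) _
        · exact gbl_diff_iter (hF _) _
      have hAc : ∀ z, (A z).det ≠ 0 → A z *ᵥ c z = b z := by
        intro z hz
        have h1 := Matrix.mulVec_cramer (A z) (b z)
        have h2 : c z = ((A z).det)⁻¹ • (A z).cramer (b z) := by
          funext j; simp [hcdef, div_eq_inv_mul]
        rw [h2, Matrix.mulVec_smul, h1, smul_smul, inv_mul_cancel₀ hz, one_smul]
      have hinj : ∀ z, (A z).det ≠ 0 → ∀ v, A z *ᵥ v = 0 → v = 0 := by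
        intro z hz v hv
        by_contra hne
        exact hz (Matrix.exists_mulVec_eq_zero_iff.1 ⟨v, hne, hv⟩)
      have hrow : ∀ z, (A z).det ≠ 0 → ∀ i : Fin (n + 1),
          ∑ j, c z j * iteratedDeriv i (F j.castSucc) z = iteratedDeriv i (F (Fin.last n)) z := by
        intro z hz
        obtain ⟨x, hx0, hx⟩ := Matrix.exists_mulVec_eq_zero_iff.2 (hdet z)
        have hx' : ∀ i : Fin (n + 1), ∑ j : Fin n, iteratedDeriv i (F j.castSucc) z * x j.castSucc
            + iteratedDeriv i (F (Fin.last n)) z * x (Fin.last n) = 0 := by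
          intro i
          have := congrFun hx i
          simpa [Matrix.mulVec, dotProduct, Fin.sum_univ_castSucc] using this
        have hAx : A z *ᵥ (fun j => x j.castSucc) = - (x (Fin.last n)) • b z := by
          funext i
          have := hx' i.castSucc
          simp only [Matrix.mulVec, dotProduct, hAdef, hbdef, Matrix.of_apply, Pi.smul_apply,
            smul_eq_mul]
          simp only [Fin.val_castSucc] at this
          linear_combination this
        have hxl : x (Fin.last n) ≠ 0 := by
          intro h0
          rw [h0] at hAx
          have h1 := hinj z hz _ (by simpa using hAx)
          apply hx0
          funext j
          refine Fin.lastCases ?_ (fun j => ?_) j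
          · exact h0
          · exact congrFun h1 j
        have hcx : (fun j => x j.castSucc) + (x (Fin.last n)) • c z = 0 := by
          apply hinj z hz
          rw [Matrix.mulVec_add, Matrix.mulVec_smul, hAc z hz, hAx]
          simp
        intro i
        have h3 : ∀ j, x j.castSucc = - (x (Fin.last n) * c z j) := by
          intro j
          have := congrFun hcx j
          simp only [Pi.add_apply, Pi.smul_apply, smul_eq_mul, Pi.zero_apply] at this
          linear_combination this
        have h4 := hx' i
        simp only [h3] at h4
        have h5 : ∑ j : Fin n, iteratedDeriv i (F j.castSucc) z * -(x (Fin.last n) * c z j)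
            = - x (Fin.last n) * ∑ j, c z j * iteratedDeriv i (F j.castSucc) z := by
          rw [Finset.mul_sum]
          exact Finset.sum_congr rfl fun j _ => by ring
        rw [h5] at h4
        have h6 : x (Fin.last n) * (∑ j, c z j * iteratedDeriv i (F j.castSucc) z
          - iteratedDeriv i (F (Fin.last n)) z) = 0 := by linear_combination -h4
        exact sub_eq_zero.1 ((mul_eq_zero.1 h6).resolve_left hxl)
      have hopen : IsOpen {z | (A z).det ≠ 0} := hAd.continuous.isOpen_preimage _ isOpen_ne
      obtain ⟨ε, hε, hball⟩ := Metric.isOpen_iff.1 hopen z1 hz1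
      have hcd : ∀ z, (A z).det ≠ 0 → ∀ j, DifferentiableAt ℂ (fun w => c w j) z :=
        fun z hz j => ((hcr j) z).div (hAd z) hz
      have hc' : ∀ z, (A z).det ≠ 0 → (fun j => deriv (fun w => c w j) z) = 0 := by
        intro z hz
        apply hinj z hz
        funext i
        have hev : (fun w => ∑ j, c w j * iteratedDeriv i (F j.castSucc) w) =ᶠ[𝓝 z]
            iteratedDeriv i (F (Fin.last n)) := by
          filter_upwards [hopen.mem_nhds hz] with w hw
          exact hrow w hw i.castSucc
        have h1 := hev.deriv_eq
        have h2 : HasDerivAt (fun w => ∑ j, c w j * iteratedDeriv i (F j.castSucc) w)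
            (∑ j, (deriv (fun w => c w j) z * iteratedDeriv i (F j.castSucc) z +
              c z j * deriv (iteratedDeriv i (F j.castSucc)) z)) z := by
          refine HasDerivAt.fun_sum fun j _ => ?_
          exact (hcd z hz j).hasDerivAt.mul (gbl_diff_iter (hF _) _ z).hasDerivAt
        rw [h2.deriv] at h1
        simp only [← iteratedDeriv_succ] at h1
        have h3 := hrow z hz i.succ
        simp only [Fin.val_succ] at h3
        rw [Finset.sum_add_distrib, h3] at h1
        have h4 : ∑ j : Fin n, deriv (fun w => c w j) z * iteratedDeriv i (F j.castSucc) z = 0 := by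
          linear_combination h1
        simp only [Matrix.mulVec, dotProduct, hAdef, Matrix.of_apply, Pi.zero_apply]
        rw [← h4]
        exact Finset.sum_congr rfl fun j _ => by ring
      have hconst : ∀ z ∈ Metric.ball z1 ε, ∀ j, c z j = c z1 j := by
        intro z hz j
        refine Metric.isOpen_ball.is_const_of_deriv_eq_zero (f := fun w => c w j)
          (convex_ball z1 ε).isPreconnected ?_ ?_ hz (Metric.mem_ball_self hε)
        · intro w hw
          exact (hcd w (hball hw) j).differentiableWithinAt
        · intro w hw
          exact congrFun (hc' w (hball hw)) j
      refine ⟨Fin.snoc (c z1) (-1), ?_, ?_⟩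
      · intro h0
        have := congrFun h0 (Fin.last n)
        simp at this
      · set T : ℂ → ℂ := fun z => ∑ j, (Fin.snoc (c z1) (-1) : Fin (n + 1) → ℂ) j * F j z with hT
        have hTd : Differentiable ℂ T :=
          Differentiable.fun_sum fun j _ => (hF j).const_mul _
        have hTa : AnalyticOnNhd ℂ T Set.univ := fun z _ => hTd.analyticAt z
        have hT0 : T =ᶠ[𝓝 z1] 0 := by
          filter_upwards [Metric.ball_mem_nhds z1 hε] with z hz
          have h1 := hrow z (hball hz) 0
          simp only [hconst z hz, Fin.val_zero, iteratedDeriv_zero] at h1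
          simp [hT, Fin.sum_univ_castSucc, h1]
        intro z
        exact hTa.eqOn_zero_of_preconnected_of_eventuallyEq_zero isPreconnected_univ
          (Set.mem_univ z1) hT0 (Set.mem_univ z)

/-- Scaling of the Wronskian. -/
lemma gbl_scale (n : ℕ) (s : ℂ → ℂ) (F : Fin n → ℂ → ℂ) (w : ℂ) (hs : AnalyticAt ℂ s w)
    (hF : ∀ j, AnalyticAt ℂ (F j) w) :
    (Matrix.of fun i j : Fin n => iteratedDeriv i (fun z => s z * F j z) w).det =
      s w ^ n * (Matrix.of fun i j : Fin n => iteratedDeriv i (F j) w).det := by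
  set L : Matrix (Fin n) (Fin n) ℂ := Matrix.of fun i l =>
    if l ≤ i then ((i : ℕ).choose l : ℂ) * iteratedDeriv ((i : ℕ) - l) s w else 0 with hL
  have hLdet : L.det = s w ^ n := by
    rw [Matrix.det_of_isLowerTriangular]
    · simp [hL]
    · intro i j hij
      simp only [hL, Matrix.of_apply]
      rw [if_neg]
      simpa using hij
  rw [← hLdet, ← Matrix.det_mul]
  congr 1
  ext i j
  simp only [Matrix.of_apply, Matrix.mul_apply]
  have h1 : (fun z => s z * F j z) = F j * s := by funext z; simp [mul_comm]
  rw [h1, iteratedDeriv_mul (hF j).contDiffAt hs.contDiffAt]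
  simp only [hL, Matrix.of_apply, ite_mul, zero_mul]
  rw [Finset.sum_fin_eq_sum_range]
  have hsub : Finset.range ((i : ℕ) + 1) ⊆ Finset.range n := by
    intro x hx; simp only [Finset.mem_range] at hx ⊢; omega
  rw [← Finset.sum_subset hsub]
  · refine Finset.sum_congr rfl fun l hl => ?_
    simp only [Finset.mem_range] at hl
    have hln : l < n := by omega
    have : (⟨l, hln⟩ : Fin n) ≤ i := by rw [Fin.le_def]; simp; omega
    rw [dif_pos hln, if_pos this]
    simp only []
    ring
  · intro l _ hl
    simp only [Finset.mem_range] at hl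
    split_ifs with h1 h2
    · rw [Fin.le_def] at h2; simp at h2; omega
    · rfl
    · rfl

/-- Cauchy estimates for derivatives of `φ ^ (a + i) * ψ`, with a factor `φ ^ a` split off. -/
lemma gbl_bound {B : ℝ} (hB : 0 < B) (a i : ℕ) : ∃ K : ℝ, 0 < K ∧ ∀ (ρ : ℝ) (w : ℂ) (C : ℝ)
    (φ ψ : ℂ → ℂ), 0 < ρ → DifferentiableOn ℂ φ (Metric.ball w ρ) →
    DifferentiableOn ℂ ψ (Metric.ball w ρ) → (∀ z ∈ Metric.ball w ρ, ‖φ z‖ ≤ B) →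
    (∀ z ∈ Metric.ball w ρ, ‖ψ z‖ ≤ C) →
    ∃ E : ℂ, iteratedDeriv i (fun z => φ z ^ (a + i) * ψ z) w = φ w ^ a * E ∧
      ‖E‖ * ρ ^ i ≤ K * C := by
  induction i with
  | zero =>
    refine ⟨1, one_pos, fun ρ w C φ ψ hρ _ _ _ hψ => ⟨ψ w, by simp, ?_⟩⟩
    simpa using hψ w (Metric.mem_ball_self hρ)
  | succ i ih =>
    obtain ⟨K, hK, h⟩ := ih
    refine ⟨K * 2 ^ i * ((a + i + 2) * (4 * B)), by positivity, ?_⟩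
    intro ρ w C φ ψ hρ hφd hψd hφ hψ
    have hC : 0 ≤ C := (norm_nonneg _).trans (hψ w (Metric.mem_ball_self hρ))
    have hsub : Metric.ball w (ρ / 2) ⊆ Metric.ball w ρ := Metric.ball_subset_ball (by linarith)
    have hder : ∀ (χ : ℂ → ℂ) (b : ℝ), DifferentiableOn ℂ χ (Metric.ball w ρ) →
        (∀ z ∈ Metric.ball w ρ, ‖χ z‖ ≤ b) → ∀ z ∈ Metric.ball w (ρ / 2),
        ‖deriv χ z‖ ≤ b / (ρ / 4) := by
      intro χ b hχd hχ z hz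
      have hsub2 : Metric.closedBall z (ρ / 4) ⊆ Metric.ball w ρ := by
        intro x hx
        rw [Metric.mem_closedBall] at hx
        rw [Metric.mem_ball] at hz ⊢
        linarith [dist_triangle x z w]
      refine Complex.norm_deriv_le_of_forall_mem_sphere_norm_le (by positivity)
        (hχd.diffContOnCl_ball hsub2) ?_
      intro x hx
      exact hχ x (hsub2 (Metric.sphere_subset_closedBall hx))
    set ψ1 : ℂ → ℂ := fun z => ((a + i + 1 : ℕ) : ℂ) * deriv φ z * ψ z + φ z * deriv ψ z with hψ1
    have hψ1d : DifferentiableOn ℂ ψ1 (Metric.ball w (ρ / 2)) := by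
      have h1 := (hφd.deriv Metric.isOpen_ball).mono hsub
      have h2 := (hψd.deriv Metric.isOpen_ball).mono hsub
      exact ((h1.const_mul _).mul (hψd.mono hsub)).add ((hφd.mono hsub).mul h2)
    have hψ1b : ∀ z ∈ Metric.ball w (ρ / 2), ‖ψ1 z‖ ≤ (a + i + 2) * (4 * B) * C / ρ := by
      intro z hz
      have h1 := hder φ B hφd hφ z hz
      have h2 := hder ψ C hψd hψ z hz
      have h3 := hφ z (hsub hz)
      have h4 := hψ z (hsub hz)
      calc ‖ψ1 z‖ ≤ ‖((a + i + 1 : ℕ) : ℂ) * deriv φ z * ψ z‖ + ‖φ z * deriv ψ z‖ :=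
            norm_add_le _ _
        _ = ((a + i + 1 : ℕ) : ℝ) * ‖deriv φ z‖ * ‖ψ z‖ + ‖φ z‖ * ‖deriv ψ z‖ := by
            simp only [norm_mul, Complex.norm_natCast]
        _ ≤ ((a + i + 1 : ℕ) : ℝ) * (B / (ρ / 4)) * C + B * (C / (ρ / 4)) := by
            gcongr
        _ = _ := by push_cast; field_simp; ring
    obtain ⟨E, hE, hEb⟩ := h (ρ / 2) w _ φ ψ1 (by positivity) (hφd.mono hsub) hψ1d
      (fun z hz => hφ z (hsub hz)) hψ1b
    refine ⟨E, ?_, ?_⟩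
    · rw [iteratedDeriv_succ', ← hE]
      apply Filter.EventuallyEq.iteratedDeriv_eq
      filter_upwards [Metric.ball_mem_nhds w hρ] with z hz
      have hφz := (hφd.differentiableAt (Metric.isOpen_ball.mem_nhds hz)).hasDerivAt
      have hψz := (hψd.differentiableAt (Metric.isOpen_ball.mem_nhds hz)).hasDerivAt
      have := ((hφz.pow (a + (i + 1))).mul hψz).deriv
      have h2 : a + (i + 1) - 1 = a + i := by omega
      rw [h2] at this
      refine Eq.trans this ?_
      simp only [hψ1, Pi.pow_apply]
      push_cast
      ring
    · calc ‖E‖ * ρ ^ (i + 1) = ‖E‖ * (ρ / 2) ^ i * (2 ^ i * ρ) := by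
            rw [div_pow]; field_simp; ring
        _ ≤ K * ((a + i + 2) * (4 * B) * C / ρ) * (2 ^ i * ρ) := by gcongr
        _ = _ := by field_simp

lemma gbl_bound' {B : ℝ} (hB : 0 < B) (a N i : ℕ) (hi : i ≤ N) : ∃ K : ℝ, 0 < K ∧
    ∀ (ρ : ℝ) (w : ℂ) (C : ℝ)
    (φ ψ : ℂ → ℂ), 0 < ρ → DifferentiableOn ℂ φ (Metric.ball w ρ) →
    DifferentiableOn ℂ ψ (Metric.ball w ρ) → (∀ z ∈ Metric.ball w ρ, ‖φ z‖ ≤ B) →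
    (∀ z ∈ Metric.ball w ρ, ‖ψ z‖ ≤ C) →
    ∃ E : ℂ, iteratedDeriv i (fun z => φ z ^ (a + N) * ψ z) w = φ w ^ a * E ∧
      ‖E‖ * ρ ^ i ≤ K * C := by
  obtain ⟨K, hK, h⟩ := gbl_bound hB (a + (N - i)) i
  refine ⟨B ^ (N - i) * K, by positivity, ?_⟩
  intro ρ w C φ ψ hρ hφd hψd hφ hψ
  obtain ⟨E, hE, hEb⟩ := h ρ w C φ ψ hρ hφd hψd hφ hψ
  have hN : a + (N - i) + i = a + N := by omega
  rw [hN] at hE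
  refine ⟨φ w ^ (N - i) * E, by rw [hE]; ring, ?_⟩
  have := hφ w (Metric.mem_ball_self hρ)
  rw [norm_mul, norm_pow, mul_assoc, mul_assoc]
  gcongr

/-- Derivatives of `φ ^ (a + i) * ψ` are divisible by `φ ^ a`. -/
lemma gbl_div (a i : ℕ) : ∀ (φ ψ : ℂ → ℂ), Differentiable ℂ φ → Differentiable ℂ ψ →
    ∃ E : ℂ → ℂ, Differentiable ℂ E ∧
      ∀ w, iteratedDeriv i (fun z => φ z ^ (a + i) * ψ z) w = φ w ^ a * E w := by
  induction i with
  | zero => intro φ ψ _ hψ; exact ⟨ψ, hψ, by simp⟩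
  | succ i ih =>
    intro φ ψ hφ hψ
    obtain ⟨E, hEd, hE⟩ := ih φ
      (fun z => ((a + i + 1 : ℕ) : ℂ) * deriv φ z * ψ z + φ z * deriv ψ z) hφ
      (((hφ.deriv.const_mul _).mul hψ).add (hφ.mul hψ.deriv))
    refine ⟨E, hEd, fun w => ?_⟩
    rw [iteratedDeriv_succ', ← hE]
    congr 1
    funext z
    have := (((hφ z).hasDerivAt.pow (a + (i + 1))).mul (hψ z).hasDerivAt).deriv
    have h2 : a + (i + 1) - 1 = a + i := by omega
    rw [h2] at this
    refine Eq.trans this ?_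
    simp only [Pi.pow_apply]
    push_cast
    ring

lemma gbl_div' (a N i : ℕ) (hi : i ≤ N) (φ ψ : ℂ → ℂ) (hφ : Differentiable ℂ φ)
    (hψ : Differentiable ℂ ψ) : ∃ E : ℂ → ℂ, Differentiable ℂ E ∧
      ∀ w, iteratedDeriv i (fun z => φ z ^ (a + N) * ψ z) w = φ w ^ a * E w := by
  obtain ⟨E, hEd, hE⟩ := gbl_div (a + (N - i)) i φ ψ hφ hψ
  have hN : a + (N - i) + i = a + N := by omega
  rw [hN] at hE
  refine ⟨fun w => φ w ^ (N - i) * E w, (hφ.pow _).mul hEd, fun w => ?_⟩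
  rw [hE]; ring

lemma gbl_glue {ι : Type*} (f D : ι → ℂ → ℂ) (a : ι → ℕ) (A W : ℂ → ℂ)
    (hf : ∀ j, Differentiable ℂ (f j)) (hD : ∀ j, Differentiable ℂ (D j))
    (hA : Differentiable ℂ A) (hA0 : ∃ z, A z ≠ 0) (hnz : ∀ z : ℂ, ∃ j, f j z ≠ 0)
    (h : ∀ k z, f k z ^ a k * W z = A z * D k z) :
    ∃ H : ℂ → ℂ, Differentiable ℂ H ∧ ∀ z, W z = A z * H z := by
  choose k hk using hnz
  have hcross : ∀ k l z, f l z ^ a l * D k z = f k z ^ a k * D l z := by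
    intro k l
    apply gbl_identity hA hA0
    · exact (((hf l).pow _).mul (hD k)).continuous
    · exact (((hf k).pow _).mul (hD l)).continuous
    · intro z hz
      apply mul_left_cancel₀ hz
      have h1 := h k z
      have h2 := h l z
      linear_combination f k z ^ a k * h2 - f l z ^ a l * h1
  have hH : ∀ j z, f j z ≠ 0 → D (k z) z / f (k z) z ^ a (k z) = D j z / f j z ^ a j := by
    intro j z hj
    rw [div_eq_div_iff (pow_ne_zero _ (hk z)) (pow_ne_zero _ hj)]
    have := hcross (k z) j z
    linear_combination this
  refine ⟨fun z => D (k z) z / f (k z) z ^ a (k z), ?_, ?_⟩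
  · intro z
    have hd : DifferentiableAt ℂ (fun w => D (k z) w / f (k z) w ^ a (k z)) z :=
      (hD _ z).div ((hf _ z).pow _) (pow_ne_zero _ (hk z))
    refine hd.congr_of_eventuallyEq ?_
    filter_upwards [(hf (k z)).continuous.continuousAt.eventually_ne (hk z)] with w hw
    exact hH (k z) w hw
  · intro z
    have := h (k z) z
    have h0 := pow_ne_zero (a (k z)) (hk z)
    field_simp
    linear_combination this

/-- A doubling argument. -/
lemma gbl_doubling {E : Type*} [NormedAddCommGroup E] (G : ℂ → E) (hG : Continuous G) (N : ℕ)
    (hN : 1 ≤ N) (K : ℝ) (h : ∀ (z₀ : ℂ) (ρ : ℝ), 0 < ρ →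
      (∀ z ∈ Metric.ball z₀ ρ, ‖G z‖ ≤ 2 ^ N * ‖G z₀‖) → ‖G z₀‖ * ρ ^ N ≤ K) (z : ℂ) : G z = 0 := by
  by_contra hz
  set μ := ‖G z‖ with hμ
  have hμ0 : 0 < μ := norm_pos_iff.2 hz
  obtain ⟨c, hc0, hc⟩ : ∃ c : ℝ, 0 < c ∧ K < μ * c ^ N := by
    refine ⟨max 1 (K / μ + 1), by positivity, ?_⟩
    have h1 : (1 : ℝ) ≤ max 1 (K / μ + 1) := le_max_left _ _
    have h2 : K / μ + 1 ≤ max 1 (K / μ + 1) := le_max_right _ _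
    have h3 := le_self_pow₀ h1 (by omega : N ≠ 0)
    calc K = μ * (K / μ) := by field_simp
      _ < μ * (max 1 (K / μ + 1)) ^ N := by gcongr; linarith
  have step : ∀ (k : ℕ) (x : ℂ), ∃ y : ℂ, μ * (2 ^ N) ^ k ≤ ‖G x‖ →
      dist x y ≤ 2 * c / 2 / 2 ^ k ∧ μ * (2 ^ N) ^ (k + 1) ≤ ‖G y‖ := by
    intro k x
    by_cases hx : μ * (2 ^ N) ^ k ≤ ‖G x‖
    · by_contra! hcon
      have hρ : 0 < c / 2 ^ k := by positivity
      have := h x (c / 2 ^ k) hρ (by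
        intro y hy
        obtain ⟨_, h2⟩ := hcon y
        rw [Metric.mem_ball, dist_comm] at hy
        have h3 := h2 (by
          have : 2 * c / 2 / 2 ^ k = c / 2 ^ k := by ring
          rw [this]; exact hy.le)
        calc ‖G y‖ ≤ μ * (2 ^ N) ^ (k + 1) := h3.le
          _ = 2 ^ N * (μ * (2 ^ N) ^ k) := by ring
          _ ≤ _ := by gcongr)
      have h4 : μ * c ^ N ≤ ‖G x‖ * (c / 2 ^ k) ^ N := by
        calc μ * c ^ N = (μ * (2 ^ N) ^ k) * (c / 2 ^ k) ^ N := by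
              rw [div_pow, ← pow_mul, ← pow_mul, mul_comm N k]; field_simp
          _ ≤ _ := by gcongr
      linarith
    · exact ⟨x, fun h => absurd h hx⟩
  choose s hs using step
  let u : ℕ → ℂ := fun k => Nat.rec z (fun k x => s k x) k
  have hu : ∀ k, μ * (2 ^ N) ^ k ≤ ‖G (u k)‖ := by
    intro k
    induction k with
    | zero => simp [u, hμ]
    | succ k ih => exact (hs k (u k) ih).2
  have hcau : CauchySeq u :=
    cauchySeq_of_le_geometric_two (C := 2 * c) fun k => (hs k (u k) (hu k)).1
  obtain ⟨L, hL⟩ := cauchySeq_tendsto_of_complete hcau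
  have h1 : Tendsto (fun k => ‖G (u k)‖) atTop (𝓝 ‖G L‖) :=
    ((hG.norm.tendsto L).comp hL)
  have h2 : Tendsto (fun k : ℕ => μ * ((2 : ℝ) ^ N) ^ k) atTop atTop := by
    apply Tendsto.const_mul_atTop hμ0
    apply tendsto_pow_atTop_atTop_of_one_lt
    exact one_lt_pow₀ (by norm_num) (by omega)
  exact not_tendsto_nhds_of_tendsto_atTop (tendsto_atTop_mono hu h2) _ h1

lemma gbl_det_bound {n : ℕ} (M : Matrix (Fin n) (Fin n) ℂ) (ρ K : ℝ) (hρ : 0 < ρ)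
    (h : ∀ i j, ‖M i j‖ * ρ ^ (i : ℕ) ≤ K) :
    ‖M.det‖ * ρ ^ (∑ i : Fin n, (i : ℕ)) ≤ n.factorial * K ^ n := by
  have h1 := Matrix.det_mul_column (fun i : Fin n => ((ρ : ℂ) ^ (i : ℕ))) M
  have h2 := Matrix.det_le (A := Matrix.of fun i j : Fin n => (ρ : ℂ) ^ (i : ℕ) * M i j)
    (abv := NormedField.toAbsoluteValue ℂ) (x := K) (by
      intro i j
      have := h i j
      simp only [Matrix.of_apply]
      change ‖(ρ : ℂ) ^ (i : ℕ) * M i j‖ ≤ K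
      rw [norm_mul, norm_pow, Complex.norm_real, Real.norm_of_nonneg hρ.le]
      linarith)
  rw [h1] at h2
  change ‖(∏ i : Fin n, (ρ : ℂ) ^ (i : ℕ)) * M.det‖ ≤ _ at h2
  rw [norm_mul, norm_prod] at h2
  simp only [norm_pow, Complex.norm_real, Real.norm_of_nonneg hρ.le, Finset.prod_pow_eq_pow_sum] at h2
  simp only [Fintype.card_fin, nsmul_eq_mul] at h2
  linarith

lemma gbl_homog {σ : Type*} [Fintype σ] (g : MvPolynomial σ ℂ) (d : ℕ) (hg : g.IsHomogeneous d)
    (s : ℂ) (x : σ → ℂ) :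
    MvPolynomial.eval (fun i => s * x i) g = s ^ d * MvPolynomial.eval x g := by
  rw [MvPolynomial.eval_eq', MvPolynomial.eval_eq', Finset.mul_sum]
  refine Finset.sum_congr rfl fun m hm => ?_
  have hd : ∑ i, m i = d := by
    have := hg (MvPolynomial.mem_support_iff.1 hm)
    rw [← this, Finsupp.weight_apply, Finsupp.sum_fintype] <;> simp
  simp only [mul_pow, Finset.prod_mul_distrib, Finset.prod_pow_eq_pow_sum, hd]
  ring

lemma gbl_eval_diffOn {m : ℕ} (g : MvPolynomial (Fin m) ℂ) (φ : Fin m → ℂ → ℂ) (U : Set ℂ)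
    (h : ∀ i, DifferentiableOn ℂ (φ i) U) :
    DifferentiableOn ℂ (fun z => MvPolynomial.eval (fun i => φ i z) g) U := by
  simp only [MvPolynomial.eval_eq']
  refine DifferentiableOn.fun_sum fun d _ => ?_
  refine DifferentiableOn.const_mul ?_ _
  exact DifferentiableOn.fun_finsetProd fun i _ => (h i).pow _

lemma gbl_eval_bound {m : ℕ} (g : MvPolynomial (Fin m) ℂ) (B : ℝ) (hB : 0 ≤ B) :
    ∃ C : ℝ, 0 < C ∧ ∀ x : Fin m → ℂ, (∀ i, ‖x i‖ ≤ B) → ‖MvPolynomial.eval x g‖ ≤ C := by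
  have hc : Continuous fun x : Fin m → ℂ => MvPolynomial.eval x g := MvPolynomial.continuous_eval g
  obtain ⟨C, hC⟩ := (isCompact_closedBall (0 : Fin m → ℂ) B).exists_bound_of_continuousOn
    hc.continuousOn
  refine ⟨max C 1, by positivity, fun x hx => (hC x ?_).trans (le_max_left _ _)⟩
  rw [mem_closedBall_zero_iff]
  exact (pi_norm_le_iff_of_nonneg hB).2 hx

open MvPolynomial in
/-- Pointwise factorization and bound of the Wronskian. -/
lemma gbl_point (n : ℕ) (δ a : Fin (n + 1) → ℕ)
    (g : Fin (n + 1) → MvPolynomial (Fin (n + 1)) ℂ)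
    (hg : ∀ j, (g j).IsHomogeneous (δ j)) (p : ℕ) (hpa : ∀ j, p = δ j + (a j + (n - 1)))
    (f : Fin (n + 1) → ℂ → ℂ) (hf : ∀ j, Differentiable ℂ (f j)) (B : ℝ) (hB : 0 < B) :
    ∃ K : ℝ, ∀ (k : Fin (n + 1)) (w : ℂ) (ρ : ℝ), 0 < ρ →
      (∀ z ∈ Metric.ball w ρ, f k z ≠ 0 ∧ ∀ j, ‖f j z‖ ≤ B * ‖f k z‖) →
      ∃ D : ℂ, (Matrix.of fun i j : Fin n => iteratedDeriv i
          (fun z => f (k.succAbove j) z ^ (a (k.succAbove j) + (n - 1)) *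
            eval (fun i => f i z) (g (k.succAbove j))) w).det =
        (f k w ^ p) ^ n * ((∏ j, (f (k.succAbove j) w / f k w) ^ a (k.succAbove j)) * D) ∧
        ‖D‖ * ρ ^ (∑ i : Fin n, (i : ℕ)) ≤ K := by
  have hC := fun j => gbl_eval_bound (g j) B hB.le
  choose C hC0 hC using hC
  have hK := fun (j : Fin (n + 1)) (i : Fin n) => gbl_bound' hB (a j) (n - 1) i (by omega)
  choose K hK0 hK using hK
  have hterm : ∀ j i, K j i * C j ≤ ∑ j, ∑ i, K j i * C j := by
    intro j i
    have h0 : ∀ j i, 0 ≤ K j i * C j := fun j i => (mul_pos (hK0 j i) (hC0 j)).le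
    refine (Finset.single_le_sum (f := fun i => K j i * C j) (fun i _ => h0 j i)
      (Finset.mem_univ i)).trans ?_
    exact Finset.single_le_sum (f := fun j => ∑ i, K j i * C j)
      (fun j _ => Finset.sum_nonneg fun i _ => h0 j i) (Finset.mem_univ j)
  refine ⟨n.factorial * (∑ j, ∑ i, K j i * C j) ^ n, ?_⟩
  intro k w ρ hρ hk
  set φ : Fin (n + 1) → ℂ → ℂ := fun j z => f j z / f k z with hφ
  have hφd : ∀ j, DifferentiableOn ℂ (φ j) (Metric.ball w ρ) := fun j =>
    (hf j).differentiableOn.div (hf k).differentiableOn fun z hz => (hk z hz).1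
  have hφb : ∀ j, ∀ z ∈ Metric.ball w ρ, ‖φ j z‖ ≤ B := by
    intro j z hz
    obtain ⟨h1, h2⟩ := hk z hz
    simp only [hφ, norm_div]
    rw [div_le_iff₀ (norm_pos_iff.2 h1)]
    exact h2 j
  set ψ : Fin (n + 1) → ℂ → ℂ := fun j z => eval (fun i => φ i z) (g j) with hψ
  have hψd : ∀ j, DifferentiableOn ℂ (ψ j) (Metric.ball w ρ) := fun j =>
    gbl_eval_diffOn _ _ _ hφd
  have hψb : ∀ j, ∀ z ∈ Metric.ball w ρ, ‖ψ j z‖ ≤ C j :=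
    fun j z hz => hC j _ fun i => hφb i z hz
  have hE := fun (j : Fin (n + 1)) (i : Fin n) =>
    hK j i ρ w (C j) (φ j) (ψ j) hρ (hφd j) (hψd j) (hφb j) (hψb j)
  choose E hE hEb using hE
  refine ⟨(Matrix.of fun i j : Fin n => E (k.succAbove j) i).det, ?_, ?_⟩
  · have hmem : Metric.ball w ρ ∈ 𝓝 w := Metric.ball_mem_nhds w hρ
    have h1 := gbl_scale n (fun z => f k z ^ p)
      (fun j z => φ (k.succAbove j) z ^ (a (k.succAbove j) + (n - 1)) * ψ (k.succAbove j) z) w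
      (((hf k).pow p).analyticAt w)
      (fun j => (((hφd _).pow _).mul (hψd _)).analyticAt hmem)
    rw [← Matrix.det_mul_row]
    convert h1 using 2
    · ext i j
      simp only [Matrix.of_apply]
      apply Filter.EventuallyEq.iteratedDeriv_eq
      filter_upwards [hmem] with z hz
      have hfk := (hk z hz).1
      have hfe : (fun i => f i z) = fun i => f k z * φ i z := by
        funext i; simp only [hφ]; field_simp
      rw [hfe, gbl_homog _ _ (hg _)]
      have h3 : f (k.succAbove j) z = f k z * φ (k.succAbove j) z := congrFun hfe _
      have h4 : f k z ^ p = f k z ^ δ (k.succAbove j) *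
        f k z ^ (a (k.succAbove j) + (n - 1)) := by rw [← pow_add, ← hpa]
      simp only [h4, hψ]
      rw [h3, mul_pow]
      ring
    · congr 1
      ext i j
      simp only [Matrix.of_apply]
      rw [hE]
  · refine gbl_det_bound _ _ _ hρ fun i j => ?_
    exact (hEb _ _).trans (hterm _ _)

open MvPolynomial in
lemma gbl_main
    (n : ℕ) (hn : 2 ≤ n) (δ a : Fin (n + 1) → ℕ)
    (g : Fin (n + 1) → MvPolynomial (Fin (n + 1)) ℂ)
    (hg : ∀ j, (g j).IsHomogeneous (δ j))
    (p q : ℕ) (hpa : ∀ j, p = δ j + (a j + (n - 1))) (hq : 1 ≤ q)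
    (hsum : ∑ j, a j = n * p + q)
    (f : Fin (n + 1) → ℂ → ℂ)
    (hf : ∀ j, Differentiable ℂ (f j))
    (hnz : ∀ z : ℂ, ∃ j, f j z ≠ 0)
    (heq : ∀ z : ℂ,
      ∑ j : Fin (n + 1), f j z ^ (a j + (n - 1)) * eval (fun i => f i z) (g j) = 0) :
    ∃ c : Fin n → ℂ, c ≠ 0 ∧
      ∀ z : ℂ,
        ∑ j : Fin n,
          c j * (f j.succ z ^ (a j.succ + (n - 1)) * eval (fun i => f i z) (g j.succ)) = 0 := by
  set F : Fin (n + 1) → ℂ → ℂ :=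
    fun j z => f j z ^ (a j + (n - 1)) * eval (fun i => f i z) (g j) with hF
  have hgd : ∀ j, Differentiable ℂ (fun z => eval (fun i => f i z) (g j)) := fun j =>
    differentiableOn_univ.1 (gbl_eval_diffOn _ _ _ fun i => (hf i).differentiableOn)
  have hFd : ∀ j, Differentiable ℂ (F j) := fun j => ((hf j).pow _).mul (hgd j)
  set W : Fin (n + 1) → ℂ → ℂ := fun k z =>
    (Matrix.of fun i j : Fin n => iteratedDeriv i (F (k.succAbove j)) z).det with hW
  have hWd : ∀ k, Differentiable ℂ (W k) := fun k =>
    gbl_det_diff fun i j => gbl_diff_iter (hFd _) _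
  -- the Wronskians agree up to a constant of modulus one
  have hsign : ∀ k, ∃ ε : ℂ, ‖ε‖ = 1 ∧ ∀ z, W 0 z = ε * W k z := by
    intro k
    refine ⟨((Int.negOnePow (((0 : Fin (n + 1)) : ℕ) - (k : ℕ) : ℤ) : ℤ) : ℂ), ?_, fun z => ?_⟩
    · rcases Int.units_eq_one_or (Int.negOnePow (((0 : Fin (n + 1)) : ℕ) - (k : ℕ) : ℤ)) with h | h
        <;> rw [h] <;> simp
    · have := Matrix.submatrix_succAbove_det_eq_negOnePow_submatrix_succAbove_det'
        (Matrix.of fun (i : Fin n) (j : Fin (n + 1)) => iteratedDeriv i (F j) z) (by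
          intro i
          simp only [Matrix.of_apply]
          have h1 : (fun w => ∑ j, F j w) = fun _ => 0 := funext heq
          have h2 := iteratedDeriv_fun_sum (n := i) (x := z) (I := Finset.univ) (f := F)
            (fun j _ => ((hFd j).contDiff).contDiffAt)
          rw [← h2, h1]
          simp) 0 k
      refine this.trans ?_
      rw [Units.smul_def, zsmul_eq_mul]
      rfl
  by_contra hcon
  -- the Wronskian does not vanish identically
  have hW0 : ∃ z, W 0 z ≠ 0 := by
    by_contra! h0
    exact hcon (gbl_wronskian n (fun j => F j.succ) (fun j => hFd _) (by simpa [hW] using h0))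
  set A : ℂ → ℂ := fun z => ∏ j, f j z ^ a j with hA
  have hAd : Differentiable ℂ A := Differentiable.fun_finsetProd fun j _ => (hf j).pow _
  have hE := fun (j : Fin (n + 1)) (i : Fin n) =>
    gbl_div' (a j) (n - 1) i (by omega) (f j) (fun z => eval (fun i => f i z) (g j)) (hf j) (hgd j)
  choose E hEd hE using hE
  choose ε hε1 hε using hsign
  set D : Fin (n + 1) → ℂ → ℂ := fun k z =>
    ε k * (Matrix.of fun i j : Fin n => E (k.succAbove j) i z).det with hD
  have hDd : ∀ k, Differentiable ℂ (D k) := fun k =>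
    (gbl_det_diff fun i j => hEd _ _).const_mul _
  have hAW : ∀ k z, f k z ^ a k * W 0 z = A z * D k z := by
    intro k z
    have h1 : W k z = (∏ j, f (k.succAbove j) z ^ a (k.succAbove j)) *
        (Matrix.of fun i j : Fin n => E (k.succAbove j) i z).det := by
      rw [← Matrix.det_mul_row]
      simp only [hW]
      congr 1
      ext i j
      exact hE _ _ _
    rw [hε k, h1]
    simp only [hA, hD]
    rw [Fin.prod_univ_succAbove _ k]
    ring
  have hA0 : ∃ z, A z ≠ 0 := by
    obtain ⟨z, hz⟩ := hW0
    obtain ⟨k, hk⟩ := hnz z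
    refine ⟨z, fun h0 => ?_⟩
    have := hAW k z
    rw [h0, zero_mul] at this
    exact (mul_ne_zero (pow_ne_zero _ hk) hz) this
  obtain ⟨H, hHd, hH⟩ := gbl_glue f D a A (W 0) hf hDd hAd hA0 hnz hAW
  set G : ℂ → Fin (n + 1) → ℂ := fun z k => f k z ^ q * H z with hG
  have hGd : ∀ k, Differentiable ℂ (fun z => G z k) := fun k => ((hf k).pow q).mul hHd
  have hGc : Continuous G := continuous_pi fun k => (hGd k).continuous
  set N := ∑ i : Fin n, (i : ℕ) with hN
  have hN1 : 1 ≤ N := by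
    exact Finset.single_le_sum (f := fun i : Fin n => (i : ℕ)) (fun _ _ => Nat.zero_le _)
      (Finset.mem_univ (⟨1, by omega⟩ : Fin n))
  set β : ℝ := 2 ^ N with hβ
  have hβ1 : 1 ≤ β := one_le_pow₀ (by norm_num)
  obtain ⟨K, hK⟩ := gbl_point n δ a g hg p hpa f hf (2 * β) (by positivity)
  have hzero : ∀ z, G z = 0 := by
    refine gbl_doubling G hGc N hN1 (max 0 (K * (4 * (β + 1)) ^ N)) ?_
    intro z₀ ρ hρ hb
    by_cases hG0 : G z₀ = 0
    · rw [hG0]; simp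
    refine le_trans ?_ (le_max_right _ _)
    set μ := ‖G z₀‖ with hμ
    have hμ0 : 0 < μ := norm_pos_iff.2 hG0
    obtain ⟨k, hk⟩ : ∃ k, ‖G z₀ k‖ = μ := by
      obtain ⟨k, hk⟩ := Finite.exists_max fun k => ‖G z₀ k‖
      refine ⟨k, le_antisymm (norm_le_pi_norm _ _) ?_⟩
      exact (pi_norm_le_iff_of_nonneg (norm_nonneg _)).2 hk
    set r := ρ / (4 * (β + 1)) with hr
    have hr0 : 0 < r := by positivity
    have hrρ : 2 * r ≤ ρ := by
      rw [hr, mul_div_assoc', div_le_iff₀ (by positivity)]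
      nlinarith
    have hgood : ∀ z ∈ Metric.ball z₀ (2 * r), f k z ≠ 0 ∧ ∀ j, ‖f j z‖ ≤ 2 * β * ‖f k z‖ := by
      intro z hz
      have hzρ : z ∈ Metric.ball z₀ ρ := Metric.ball_subset_ball hrρ hz
      have h1 := Complex.dist_le_div_mul_dist_of_mapsTo_ball (f := fun z => G z k) (c := z₀)
        (R₁ := ρ) (R₂ := (β + 1) * μ) (hGd k).differentiableOn (by
          intro x hx
          rw [Metric.mem_closedBall, dist_eq_norm]
          have h2 : ‖G x k‖ ≤ β * μ := (norm_le_pi_norm _ _).trans (hb x hx)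
          have h3 := norm_sub_le (G x k) (G z₀ k)
          rw [hk] at h3
          linarith) hzρ
      have h2 : dist (G z k) (G z₀ k) ≤ μ / 2 := by
        refine h1.trans ?_
        rw [Metric.mem_ball] at hz
        calc (β + 1) * μ / ρ * dist z z₀ ≤ (β + 1) * μ / ρ * (2 * r) := by gcongr
          _ = μ / 2 := by rw [hr]; field_simp; ring
      have h3 : μ / 2 ≤ ‖G z k‖ := by
        rw [dist_eq_norm, norm_sub_rev] at h2
        have := norm_sub_norm_le (G z₀ k) (G z k)
        rw [hk] at this
        linarith
      have hGk : G z k ≠ 0 := by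
        rw [← norm_pos_iff]; linarith
      have hGk' : f k z ^ q ≠ 0 ∧ H z ≠ 0 := mul_ne_zero_iff.1 hGk
      refine ⟨fun h0 => hGk'.1 (by rw [h0]; exact zero_pow (by omega)), fun j => ?_⟩
      have h4 : ‖G z j‖ ≤ β * μ := (norm_le_pi_norm _ _).trans (hb z hzρ)
      have h5 : ‖G z j‖ ≤ 2 * β * ‖G z k‖ := by nlinarith
      simp only [hG, norm_mul, norm_pow] at h5
      have h6 : ‖f j z‖ ^ q ≤ 2 * β * ‖f k z‖ ^ q := by
        refine le_of_mul_le_mul_right ?_ (norm_pos_iff.2 hGk'.2)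
        linarith
      have h7 : 2 * β ≤ (2 * β) ^ q := le_self_pow₀ (by linarith) (by omega)
      refine le_of_pow_le_pow_left₀ (n := q) (by omega) (by positivity) ?_
      rw [mul_pow]
      refine h6.trans ?_
      gcongr
    -- the estimate at nearby generic points
    have hgen : ∀ w ∈ Metric.ball z₀ r, A w ≠ 0 → ‖G w k‖ * r ^ N ≤ K := by
      intro w hw hAw
      have hsubw : Metric.ball w r ⊆ Metric.ball z₀ (2 * r) := by
        intro x hx
        rw [Metric.mem_ball] at hx hw ⊢
        linarith [dist_triangle x w z₀]
      obtain ⟨D', hD', hDb⟩ := hK k w r hr0 fun z hz => hgood z (hsubw hz)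
      have hfk : f k w ≠ 0 := (hgood w (hsubw (Metric.mem_ball_self hr0))).1
      have e1 : W k w = (f k w ^ p) ^ n *
        ((∏ j, (f (k.succAbove j) w / f k w) ^ a (k.succAbove j)) * D') := hD'
      have e2 : A w * H w = ε k * W k w := by rw [← hH, hε k]
      have e3 : A w = f k w ^ a k * ∏ j, f (k.succAbove j) w ^ a (k.succAbove j) := by
        simp only [hA]; rw [Fin.prod_univ_succAbove _ k]
      have e4 : ∏ j, f (k.succAbove j) w ^ a (k.succAbove j) ≠ 0 := by
        intro h0; rw [h0, mul_zero] at e3; exact hAw e3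
      have e5 : ∑ j, a (k.succAbove j) + a k = n * p + q := by
        rw [← hsum, Fin.sum_univ_succAbove _ k, add_comm]
      simp only [div_pow, Finset.prod_div_distrib, Finset.prod_pow_eq_pow_sum] at e1
      have e6 : G w k = ε k * D' := by
        have hp1 : f k w ^ (∑ j, a (k.succAbove j)) ≠ 0 := pow_ne_zero _ hfk
        have hp2 : f k w ^ (n * p) ≠ 0 := pow_ne_zero _ hfk
        have hp3 : f k w ^ (∑ j, a (k.succAbove j)) * f k w ^ a k =
          f k w ^ (n * p) * f k w ^ q := by rw [← pow_add, e5, pow_add]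
        rw [e1, e3] at e2
        have hp4 : (f k w ^ p) ^ n = f k w ^ (n * p) := by rw [← pow_mul, mul_comm]
        rw [hp4] at e2
        simp only [hG]
        apply mul_left_cancel₀ hp2
        field_simp at e2
        linear_combination e2 - H w * hp3
      rw [e6, norm_mul, hε1, one_mul]
      exact hDb
    have hlim : ‖G z₀ k‖ * r ^ N ≤ K := by
      have ht : Tendsto (fun w => ‖G w k‖ * r ^ N) (𝓝[≠] z₀) (𝓝 (‖G z₀ k‖ * r ^ N)) :=
        (((hGd k).continuous.norm.mul continuous_const).tendsto z₀).mono_left nhdsWithin_le_nhds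
      refine le_of_tendsto ht ?_
      filter_upwards [gbl_dense hAd hA0 z₀,
        mem_nhdsWithin_of_mem_nhds (Metric.ball_mem_nhds z₀ hr0)] with w h1 h2
      exact hgen w h2 h1
    rw [hk, hr, div_pow, mul_div_assoc', div_le_iff₀ (by positivity)] at hlim
    exact hlim
  obtain ⟨z, hz⟩ := hW0
  obtain ⟨k, hk⟩ := hnz z
  have h1 := congrFun (hzero z) k
  have h2 : H z = 0 := (mul_eq_zero.1 h1).resolve_left (pow_ne_zero _ hk)
  apply hz
  rw [hH, h2, mul_zero]

open MvPolynomial in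
/-- **Generalized Borel lemma (Proposition 2 of Siu–Yeung).** Let `gⱼ` be homogeneous
polynomials of degree `δⱼ` on `ℂ^{n+1}` for `0 ≤ j ≤ n`, and let
`p > (n+1)(n−1) + ∑ δⱼ`. If entire functions `f₀, …, f_n` without common zeros satisfy
`∑ⱼ fⱼ^{p−δⱼ} gⱼ(f₀,…,f_n) ≡ 0`, then there is a nontrivial linear relation among
`x₁^{p−δ₁}g₁, …, x_n^{p−δ_n}g_n` on the image of `f`. -/
theorem generalized_borel_lemma
    (n : ℕ) (hn : 2 ≤ n) (δ : Fin (n + 1) → ℕ)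
    (g : Fin (n + 1) → MvPolynomial (Fin (n + 1)) ℂ)
    (hg : ∀ j, (g j).IsHomogeneous (δ j))
    (p : ℕ) (hp : (n + 1) * (n - 1) + ∑ j, δ j < p)
    (f : Fin (n + 1) → ℂ → ℂ)
    (hf : ∀ j, Differentiable ℂ (f j))
    (hnz : ∀ z : ℂ, ∃ j, f j z ≠ 0)
    (heq : ∀ z : ℂ,
      ∑ j : Fin (n + 1), f j z ^ (p - δ j) * eval (fun i => f i z) (g j) = 0) :
    ∃ c : Fin n → ℂ, c ≠ 0 ∧
      ∀ z : ℂ,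
        ∑ j : Fin n,
          c j * (f j.succ z ^ (p - δ j.succ) * eval (fun i => f i z) (g j.succ)) = 0 := by
  have hle : ∀ j, δ j ≤ ∑ j, δ j := fun j =>
    Finset.single_le_sum (fun _ _ => Nat.zero_le _) (Finset.mem_univ j)
  have hn1 : n - 1 ≤ (n + 1) * (n - 1) := Nat.le_mul_of_pos_left _ (by omega)
  have hpa : ∀ j, p - δ j = (p - δ j - (n - 1)) + (n - 1) := by
    intro j
    have := hle j
    omega
  have hpa' : ∀ j, p = δ j + ((p - δ j - (n - 1)) + (n - 1)) := by
    intro j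
    have := hle j
    omega
  have hsum : ∑ j, (p - δ j - (n - 1)) = n * p + (p - ((n + 1) * (n - 1) + ∑ j, δ j)) := by
    have h1 : ∑ j : Fin (n + 1), p =
        ∑ j, (δ j + ((p - δ j - (n - 1)) + (n - 1))) := Finset.sum_congr rfl fun j _ => hpa' j
    rw [Finset.sum_add_distrib, Finset.sum_add_distrib] at h1
    simp only [Finset.sum_const, Finset.card_univ, Fintype.card_fin, smul_eq_mul] at h1
    have h2 : (n + 1) * p = n * p + p := by ring
    omega
  have key := gbl_main n hn δ (fun j => p - δ j - (n - 1)) g hg p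
    (p - ((n + 1) * (n - 1) + ∑ j, δ j)) hpa' (by omega) hsum f hf hnz (by
      intro z
      rw [← heq z]
      exact Finset.sum_congr rfl fun j _ => by rw [← hpa j])
  obtain ⟨c, hc, h⟩ := key
  refine ⟨c, hc, fun z => ?_⟩
  rw [← h z]
  exact Finset.sum_congr rfl fun j _ => by rw [← hpa j.succ]
end
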